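/- arXiv:1210.1635 — 3 statements merged into one kernel-verified Lean document; each statement's English description precedes it below -/
import Mathlib

section
/- Let W be an infinite, irreducible, non-affine right-angled Coxeter group with finite generating set S, and let T be a proper normal subgroup of W of finite index. Then r(T) ≤ 1; that is, there exist finitely many elements t_1, …, t_m ∈ T such that T = t_1·A_1(T) ∪ ⋯ ∪ t_m·A_1(T). -/
open scoped Pointwise

/-- `algA G i` is the set of elements of `G` whose centralizer contains a
free abelian subgroup of rank at most `i` as a subgroup of finite index. -/
def algA (G : Type*) [Group G] (i : ℕ) : Set G :=
  {g : G | ∃ H : Subgroup (Subgroup.centralizer ({g} : Set G)),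
    H.FiniteIndex ∧ ∃ n : ℕ, n ≤ i ∧ Nonempty (H ≃* Multiplicative (Fin n → ℤ))}

/-- `G` is covered by finitely many left translates of `algA G i`. -/
def algCovers (G : Type*) [Group G] (i : ℕ) : Prop :=
  ∃ F : Finset G, (⋃ g ∈ F, g • algA G i) = Set.univ

/-- `r(G)`: the least `i` such that `G` is a finite union of translates of `algA G i`
(`⊤` if there is no such `i`). -/
noncomputable def algr (G : Type*) [Group G] : ℕ∞ :=
  sInf {n : ℕ∞ | ∃ i : ℕ, n = (i : ℕ∞) ∧ algCovers G i}

/-- The algebraic rank of `G`: the supremum of `r(G*)` over all finite index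
subgroups `G*` of `G`. -/
noncomputable def algRank (G : Type*) [Group G] : ℕ∞ :=
  ⨆ (H : Subgroup G) (_ : H.FiniteIndex), algr H

/-- A Coxeter matrix is right-angled if all off-diagonal entries are `2` or `∞`
(`0` encodes `∞` in Mathlib's convention, i.e. the order of `st` is `2` or `∞`). -/
def CoxeterMatrix.IsRightAngled {B : Type*} (M : CoxeterMatrix B) : Prop :=
  ∀ i j : B, i ≠ j → M i j = 2 ∨ M i j = 0

namespace CoxeterSystem

variable {B : Type*} {W : Type*} [Group W] {M : CoxeterMatrix B} (cs : CoxeterSystem M W)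

/-- The Coxeter system is irreducible: the generating set cannot be partitioned into two
nonempty subsets such that every generator in one commutes with every generator in the
other. -/
def IsIrreducible : Prop :=
  ¬ ∃ A : Set B, A.Nonempty ∧ Aᶜ.Nonempty ∧
      ∀ i ∈ A, ∀ j ∈ Aᶜ, Commute (cs.simple i) (cs.simple j)

/-- A word over `S` is reduced if no shorter word represents the same element of `W`. -/
def ReducedWord (l : List B) : Prop :=
  ∀ l' : List B, cs.wordProd l' = cs.wordProd l → l.length ≤ l'.length

/-- An element `w ∈ W` is essential if the only parabolic subgroup containing it is `W`
itself: whenever `w ∈ u W_J u⁻¹` (equivalently `u⁻¹ w u ∈ W_J`), one has `J = S`. -/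
def IsEssential (w : W) : Prop :=
  ∀ (u : W) (J : Set B),
    u⁻¹ * w * u ∈ Subgroup.closure (cs.simple '' J) → J = Set.univ

/-- `t` is an `s`-blocker if the generators `s` and `t` do not commute. -/
def IsBlocker (s t : B) : Prop := ¬ Commute (cs.simple s) (cs.simple t)

/-- A word is `s`-minimal if between any two consecutive occurrences of `s`
there is an `s`-blocker (vacuously so if `s` occurs at most once). -/
def SMinimal (l : List B) (s : B) : Prop :=
  ∀ l₁ l₂ l₃ : List B, l = l₁ ++ s :: l₂ ++ s :: l₃ → s ∉ l₂ →
    ∃ t ∈ l₂, cs.IsBlocker s t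

/-- A word `l` is `s`-good if it is `s`-minimal and, whenever `s` occurs at least twice
(with `l₁` the prefix before the first occurrence of `s` and `l₃` the suffix after the
last occurrence), the word `l₃ ++ l₁` contains an `s`-blocker. -/
def SGood (l : List B) (s : B) : Prop :=
  cs.SMinimal l s ∧
    ∀ l₁ l₂ l₃ : List B, l = l₁ ++ s :: l₂ ++ s :: l₃ → s ∉ l₁ → s ∉ l₃ →
      ∃ t ∈ l₃ ++ l₁, cs.IsBlocker s t

/-- `B(w)`: the set of "bad" generators of a word, i.e. those for which the word is
not good. -/
def badSet (l : List B) : Set B := {s : B | ¬ cs.SGood l s}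

end CoxeterSystem

/-- A group is affine (in the sense relevant here) if it contains a free abelian
subgroup of finite index. -/
def IsVirtuallyFreeAbelian (W : Type*) [Group W] : Prop :=
  ∃ H : Subgroup W, H.FiniteIndex ∧ ∃ ι : Type, Nonempty (H ≃* Multiplicative (ι →₀ ℤ))

namespace CoxeterSystem

variable {B : Type*} {W : Type*} [Group W] {M : CoxeterMatrix B} (cs : CoxeterSystem M W)

/-- The standard parabolic subgroup generated by all simple reflections commuting with `s`.
Its cosets are the walls of type `s`. -/
def starSubgroup (s : B) : Subgroup W :=
  Subgroup.closure (cs.simple '' {t | Commute (cs.simple s) (cs.simple t)})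

theorem simple_mem_starSubgroup {s t : B} (h : Commute (cs.simple s) (cs.simple t)) :
    cs.simple t ∈ cs.starSubgroup s :=
  Subgroup.subset_closure ⟨t, h, rfl⟩

theorem commute_of_mem_starSubgroup {s : B} {p : W} (hp : p ∈ cs.starSubgroup s) :
    Commute (cs.simple s) p := by
  have h : cs.starSubgroup s ≤ Subgroup.centralizer {cs.simple s} := by
    rw [starSubgroup, Subgroup.closure_le]
    rintro _ ⟨t, ht, rfl⟩
    exact Subgroup.mem_centralizer_singleton_iff.2 ht.symm.eq
  exact (Subgroup.mem_centralizer_singleton_iff.1 (h hp)).symm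

/-- The base wall of type `s`, separating `1` from `s`. -/
def baseWall (s : B) : W ⧸ cs.starSubgroup s := ((1 : W) : W ⧸ cs.starSubgroup s)

theorem simple_smul_eq_baseWall_iff {s t : B} (h : Commute (cs.simple s) (cs.simple t))
    (q : W ⧸ cs.starSubgroup s) : cs.simple t • q = cs.baseWall s ↔ q = cs.baseWall s := by
  have key : cs.simple t • cs.baseWall s = cs.baseWall s := by
    rw [baseWall, MulAction.Quotient.smul_coe, QuotientGroup.eq]
    simpa using cs.simple_mem_starSubgroup h
  constructor
  · intro hq
    rw [← key] at hq
    exact MulAction.injective _ hq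
  · rintro rfl
    exact key

open Classical in
/-- The action of the simple reflection `t` on the sided walls of type `s`. -/
noncomputable def wallFun (s t : B) (x : (W ⧸ cs.starSubgroup s) × Bool) :
    (W ⧸ cs.starSubgroup s) × Bool :=
  (cs.simple t • x.1, if t = s ∧ x.1 = cs.baseWall s then !x.2 else x.2)

theorem wallFun_baseWall (s : B) (ε : Bool) :
    cs.wallFun s s (cs.baseWall s, ε) = (cs.baseWall s, !ε) := by
  simp [wallFun, (cs.simple_smul_eq_baseWall_iff (Commute.refl _) _).2]

theorem wallFun_of_ne {s t : B} {q : W ⧸ cs.starSubgroup s}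
    (h : ¬ (t = s ∧ q = cs.baseWall s)) (ε : Bool) :
    cs.wallFun s t (q, ε) = (cs.simple t • q, ε) := by
  rw [wallFun, if_neg h]

theorem wallFun_not (s t : B) (q : W ⧸ cs.starSubgroup s) (ε : Bool) :
    cs.wallFun s t (q, !ε) = ((cs.wallFun s t (q, ε)).1, !(cs.wallFun s t (q, ε)).2) := by
  by_cases h : t = s ∧ q = cs.baseWall s
  · obtain ⟨rfl, rfl⟩ := h
    rw [wallFun_baseWall, wallFun_baseWall]
  · rw [wallFun_of_ne cs h, wallFun_of_ne cs h]

theorem wallFun_involutive (s t : B) : Function.Involutive (cs.wallFun s t) := by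
  rintro ⟨q, ε⟩
  have h1 : cs.simple t • cs.simple t • q = q := by
    rw [← mul_smul, simple_mul_simple_self, one_smul]
  rcases eq_or_ne t s with rfl | h
  · by_cases hq : q = cs.baseWall t <;>
      simp [wallFun, h1, cs.simple_smul_eq_baseWall_iff (Commute.refl _), hq]
  · simp [wallFun, h1, h]

/-- The permutation of the sided walls of type `s` induced by the simple reflection `t`. -/
noncomputable def wallPerm (s t : B) : Equiv.Perm ((W ⧸ cs.starSubgroup s) × Bool) :=
  (cs.wallFun_involutive s t).toPerm

theorem wallPerm_commute {s i j : B} (h : Commute (cs.simple i) (cs.simple j)) :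
    Commute (cs.wallPerm s i) (cs.wallPerm s j) := by
  rcases eq_or_ne i j with rfl | hij
  · exact Commute.refl _
  ext1 ⟨q, ε⟩
  have h1 : cs.simple i • cs.simple j • q = cs.simple j • cs.simple i • q := by
    rw [← mul_smul, ← mul_smul, h.eq]
  change cs.wallFun s i (cs.wallFun s j _) = cs.wallFun s j (cs.wallFun s i _)
  have key : ∀ {i j : B}, Commute (cs.simple i) (cs.simple j) → i ≠ j →
      cs.wallFun i i (cs.wallFun i j (cs.baseWall i, ε)) =
        cs.wallFun i j (cs.wallFun i i (cs.baseWall i, ε)) := by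
    intro i j h hij
    rw [wallFun_baseWall, wallFun_of_ne cs fun h' ↦ hij h'.1.symm,
      wallFun_of_ne cs fun h' ↦ hij h'.1.symm, (cs.simple_smul_eq_baseWall_iff h _).2 rfl,
      wallFun_baseWall]
  by_cases hi : i = s ∧ q = cs.baseWall s
  · obtain ⟨rfl, rfl⟩ := hi
    exact key h hij
  by_cases hj : j = s ∧ q = cs.baseWall s
  · obtain ⟨rfl, rfl⟩ := hj
    exact (key h.symm hij.symm).symm
  rw [wallFun_of_ne cs hi, wallFun_of_ne cs hj, wallFun_of_ne, wallFun_of_ne, h1]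
  · rintro ⟨rfl, h'⟩
    exact hj ⟨rfl, (cs.simple_smul_eq_baseWall_iff h.symm q).1 h'⟩
  · rintro ⟨rfl, h'⟩
    exact hi ⟨rfl, (cs.simple_smul_eq_baseWall_iff h q).1 h'⟩

theorem wallPerm_isLiftable (hra : M.IsRightAngled) (s : B) : M.IsLiftable (cs.wallPerm s) := by
  have hsq : ∀ i, cs.wallPerm s i * cs.wallPerm s i = 1 := fun i ↦ by
    ext1 x
    exact cs.wallFun_involutive s i x
  intro i j
  rcases eq_or_ne i j with rfl | hij
  · rw [M.diagonal, pow_one, hsq]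
  rcases hra i j hij with h | h
  · have hc : Commute (cs.simple i) (cs.simple j) := by
      have h2 := cs.simple_mul_simple_pow i j
      rw [h, pow_two, mul_eq_one_iff_eq_inv, mul_inv_rev, inv_simple, inv_simple] at h2
      exact h2
    rw [h, (cs.wallPerm_commute hc).mul_pow, pow_two, pow_two, hsq, hsq, one_mul]
  · rw [h, pow_zero]

/-- The action of `W` on the sided walls of type `s`. -/
noncomputable def wallRep (hra : M.IsRightAngled) (s : B) :
    W →* Equiv.Perm ((W ⧸ cs.starSubgroup s) × Bool) :=
  cs.lift ⟨cs.wallPerm s, cs.wallPerm_isLiftable hra s⟩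

variable (hra : M.IsRightAngled)

theorem wallRep_simple (s t : B) (x : (W ⧸ cs.starSubgroup s) × Bool) :
    cs.wallRep hra s (cs.simple t) x = cs.wallFun s t x := by
  rw [wallRep, lift_apply_simple]
  rfl

theorem wallRep_fst (s : B) (w : W) (x : (W ⧸ cs.starSubgroup s) × Bool) :
    (cs.wallRep hra s w x).1 = w • x.1 := by
  induction w using cs.simple_induction_left with
  | one => simp
  | mul_simple_left w i ih =>
    rw [map_mul, Equiv.Perm.mul_apply, wallRep_simple, wallFun, mul_smul, ih]

theorem wallRep_not (s : B) (w : W) (q : W ⧸ cs.starSubgroup s) (ε : Bool) :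
    cs.wallRep hra s w (q, !ε) =
      ((cs.wallRep hra s w (q, ε)).1, !(cs.wallRep hra s w (q, ε)).2) := by
  induction w using cs.simple_induction_left with
  | one => simp
  | mul_simple_left w i ih =>
    simp only [map_mul, Equiv.Perm.mul_apply, wallRep_simple, ih, wallFun_not]

/-- The half-space of `W` bounded by the base wall of type `s` and containing `1`. -/
def posHalf (s : B) : Set W :=
  {x | (cs.wallRep hra s x⁻¹ (cs.baseWall s, false)).2 = false}

theorem one_mem_posHalf (s : B) : (1 : W) ∈ cs.posHalf hra s := by
  simp only [posHalf, Set.mem_ofPred_eq, inv_one, map_one, Equiv.Perm.one_apply]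

theorem simple_mul_mem_posHalf {s : B} {x : W} :
    cs.simple s * x ∈ cs.posHalf hra s ↔ x ∉ cs.posHalf hra s := by
  simp only [posHalf, Set.mem_ofPred_eq, mul_inv_rev, inv_simple, map_mul, Equiv.Perm.mul_apply,
    wallRep_simple, wallFun_baseWall, wallRep_not]
  simp

theorem simple_notMem_posHalf (s : B) : cs.simple s ∉ cs.posHalf hra s := by
  have := cs.simple_mul_mem_posHalf hra (s := s) (x := 1)
  rw [mul_one] at this
  rw [this, not_not]
  exact cs.one_mem_posHalf hra s

theorem mul_simple_mem_posHalf_iff {s u : B} {x : W} (h : ¬ (u = s ∧ x ∈ cs.starSubgroup s)) :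
    x * cs.simple u ∈ cs.posHalf hra s ↔ x ∈ cs.posHalf hra s := by
  have h' : ¬ (u = s ∧ x⁻¹ • cs.baseWall s = cs.baseWall s) := by
    rwa [baseWall, MulAction.Quotient.smul_coe, QuotientGroup.eq, smul_eq_mul, mul_one, mul_one,
      inv_inv]
  simp only [posHalf, Set.mem_ofPred_eq, mul_inv_rev, inv_simple, map_mul, Equiv.Perm.mul_apply,
    wallRep_simple, wallFun]
  rw [if_neg]
  rwa [wallRep_fst]

theorem mem_posHalf_mul_left {s : B} {p : W} (hp : p ∈ cs.starSubgroup s)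
    (hp' : p ∈ cs.posHalf hra s) (x : W) : p * x ∈ cs.posHalf hra s ↔ x ∈ cs.posHalf hra s := by
  have h : cs.wallRep hra s p⁻¹ (cs.baseWall s, false) = (cs.baseWall s, false) := by
    refine Prod.ext ?_ hp'
    rw [wallRep_fst, baseWall, MulAction.Quotient.smul_coe, QuotientGroup.eq]
    simpa using hp
  simp only [posHalf, Set.mem_ofPred_eq, mul_inv_rev, map_mul, Equiv.Perm.mul_apply, h]

theorem mem_starSubgroup_of_stabilizes {s : B} {p : W}
    (h : ∀ x, p * x ∈ cs.posHalf hra s ↔ x ∈ cs.posHalf hra s) : p ∈ cs.starSubgroup s := by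
  by_contra hp
  have h1 := cs.mul_simple_mem_posHalf_iff hra (u := s) (fun h' ↦ hp h'.2)
  have h2 := (h 1).2 (cs.one_mem_posHalf hra s)
  rw [mul_one] at h2
  exact cs.simple_notMem_posHalf hra s ((h _).1 (h1.2 h2))

/-- A function on `W` which is constant along the edges of the complement of a half-space
is constant on this complement. -/
theorem iff_of_notMem_posHalf {s : B} {Q : W → Prop}
    (hQ : ∀ y u, y ∉ cs.posHalf hra s → y * cs.simple u ∉ cs.posHalf hra s →
      (Q (y * cs.simple u) ↔ Q y)) {x : W} (hx : x ∉ cs.posHalf hra s) :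
    Q x ↔ Q (cs.simple s) := by
  suffices h : ∀ x, (x ∉ cs.posHalf hra s → (Q x ↔ Q (cs.simple s))) ∧
      (x ∈ cs.posHalf hra s → (Q (cs.simple s * x) ↔ Q (cs.simple s))) from (h x).1 hx
  intro x
  induction x using cs.simple_induction_right with
  | one => simp [one_mem_posHalf]
  | mul_simple_right x u ih =>
    by_cases hc : u = s ∧ x ∈ cs.starSubgroup s
    · obtain ⟨rfl, hxs⟩ := hc
      have he := (cs.commute_of_mem_starSubgroup hxs).eq
      have he' : cs.simple u * (x * cs.simple u) = x := by
        rw [← he, simple_mul_simple_cancel_left]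
      rw [he', ← he, simple_mul_mem_posHalf, not_not]
      exact ⟨ih.2, ih.1⟩
    · rw [cs.mul_simple_mem_posHalf_iff hra hc]
      refine ⟨fun h ↦ ?_, fun h ↦ ?_⟩
      · rw [hQ x u h (by rwa [cs.mul_simple_mem_posHalf_iff hra hc])]
        exact ih.1 h
      · rw [← mul_assoc, hQ _ u (by rwa [simple_mul_mem_posHalf, not_not])
          (by rwa [mul_assoc, simple_mul_mem_posHalf, not_not,
            cs.mul_simple_mem_posHalf_iff hra hc])]
        exact ih.2 h

theorem iff_of_mem_posHalf {s : B} {Q : W → Prop}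
    (hQ : ∀ y u, y ∈ cs.posHalf hra s → y * cs.simple u ∈ cs.posHalf hra s →
      (Q (y * cs.simple u) ↔ Q y)) {x : W} (hx : x ∈ cs.posHalf hra s) : Q x ↔ Q 1 := by
  have h := cs.iff_of_notMem_posHalf hra (s := s) (Q := fun y ↦ Q (cs.simple s * y))
    (fun y u h1 h2 ↦ by
      rw [← mul_assoc]
      exact hQ _ u (by rwa [simple_mul_mem_posHalf]) (by rwa [mul_assoc, simple_mul_mem_posHalf]))
    (x := cs.simple s * x) (by rwa [simple_mul_mem_posHalf, not_not])
  simpa using h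

/-- The half-space opposite to `posHalf`. -/
def negHalf (s : B) : Set W := (cs.posHalf hra s)ᶜ

theorem simple_mem_negHalf (s : B) : cs.simple s ∈ cs.negHalf hra s :=
  cs.simple_notMem_posHalf hra s

theorem one_notMem_negHalf (s : B) : (1 : W) ∉ cs.negHalf hra s :=
  fun h ↦ h (cs.one_mem_posHalf hra s)

theorem negHalf_compl (s : B) : (cs.negHalf hra s)ᶜ = cs.posHalf hra s := compl_compl _

theorem simple_smul_negHalf (s : B) : cs.simple s • cs.negHalf hra s = (cs.negHalf hra s)ᶜ := by
  ext x
  rw [Set.mem_smul_set_iff_inv_smul_mem, inv_simple, smul_eq_mul, negHalf, Set.mem_compl_iff,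
    Set.mem_compl_iff, simple_mul_mem_posHalf, Set.mem_compl_iff]

theorem simple_smul_posHalf (s : B) : cs.simple s • cs.posHalf hra s = cs.negHalf hra s := by
  rw [← negHalf_compl, ← simple_smul_negHalf, ← mul_smul, simple_mul_simple_self, one_smul]

/-- Half-spaces of non-commuting simple reflections are nested. -/
theorem negHalf_subset_posHalf {s t : B} (h : ¬ Commute (cs.simple s) (cs.simple t)) :
    cs.negHalf hra s ⊆ cs.posHalf hra t := by
  have hst : ∀ {s t : B}, ¬ Commute (cs.simple s) (cs.simple t) →
      ∀ p ∈ cs.starSubgroup s, p ∈ cs.posHalf hra t := by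
    intro s t h p hp
    induction hp using Subgroup.closure_induction_right with
    | one => exact cs.one_mem_posHalf hra t
    | mul_right x _ y hy ih =>
      obtain ⟨u, hu, rfl⟩ := hy
      rw [mul_simple_mem_posHalf_iff]
      · exact ih
      · rintro ⟨rfl, -⟩
        exact h hu
    | mul_inv_cancel x _ y hy ih =>
      obtain ⟨u, hu, rfl⟩ := hy
      rw [inv_simple, mul_simple_mem_posHalf_iff]
      · exact ih
      · rintro ⟨rfl, -⟩
        exact h hu
  intro x hx
  rw [cs.iff_of_notMem_posHalf hra (s := s) (Q := (· ∈ cs.posHalf hra t)) _ hx]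
  · exact hst h _ (cs.simple_mem_starSubgroup (Commute.refl _))
  · intro y u hy _
    refine cs.mul_simple_mem_posHalf_iff hra ?_
    rintro ⟨-, hyt⟩
    exact hy (hst (fun h' ↦ h h'.symm) y hyt)

theorem mem_smul_set_iff' {w x : W} {D : Set W} : x ∈ w • D ↔ w⁻¹ * x ∈ D :=
  Set.mem_smul_set_iff_inv_smul_mem

theorem smul_negHalf_of_stabilizes {s : B} {p : W} (hp : p ∈ cs.starSubgroup s)
    (hp' : p ∈ cs.posHalf hra s) : p • cs.negHalf hra s = cs.negHalf hra s := by
  ext x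
  rw [Set.mem_smul_set_iff_inv_smul_mem, smul_eq_mul, negHalf, Set.mem_compl_iff,
    Set.mem_compl_iff, ← cs.mem_posHalf_mul_left hra hp hp', mul_inv_cancel_left]

theorem smul_negHalf_of_mem_starSubgroup {s : B} {p : W} (hp : p ∈ cs.starSubgroup s) :
    p • cs.negHalf hra s = cs.negHalf hra s ∨ p • cs.negHalf hra s = (cs.negHalf hra s)ᶜ := by
  by_cases hp' : p ∈ cs.posHalf hra s
  · exact .inl (cs.smul_negHalf_of_stabilizes hra hp hp')
  · right
    have h := cs.smul_negHalf_of_stabilizes hra (p := cs.simple s * p)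
      (mul_mem (cs.simple_mem_starSubgroup (Commute.refl _)) hp)
      (by rwa [simple_mul_mem_posHalf])
    rw [← simple_smul_negHalf]
    conv_rhs => rw [← h, ← mul_smul, simple_mul_simple_cancel_left]

/-- Two subsets are nested if one of the four intersections of these sets and their complements
is empty. -/
def Nested (D E : Set W) : Prop := Disjoint D E ∨ D ⊆ E ∨ E ⊆ D ∨ Dᶜ ⊆ E

/-- Half-spaces of the same type are nested. -/
theorem nested_negHalf (s : B) (w : W) : Nested (cs.negHalf hra s) (w • cs.negHalf hra s) := by
  by_cases hw : w ∈ cs.starSubgroup s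
  · rcases cs.smul_negHalf_of_mem_starSubgroup hra hw with h | h <;> rw [h]
    · exact .inr (.inl subset_rfl)
    · exact .inl disjoint_compl_right
  have hconst : ∀ p ∈ cs.starSubgroup s,
      (w * p ∈ cs.posHalf hra s ↔ w ∈ cs.posHalf hra s) := by
    have hstep : ∀ p ∈ cs.starSubgroup s, ∀ u,
        (w * (p * cs.simple u) ∈ cs.posHalf hra s ↔ w * p ∈ cs.posHalf hra s) := by
      intro p hp u
      rw [← mul_assoc]
      refine cs.mul_simple_mem_posHalf_iff hra ?_
      rintro ⟨-, h⟩
      exact hw ((Subgroup.mul_mem_cancel_right _ hp).1 h)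
    intro p hp
    induction hp using Subgroup.closure_induction_right with
    | one => rw [mul_one]
    | mul_right x hx y hy ih =>
      obtain ⟨u, hu, rfl⟩ := hy
      rw [hstep x hx u, ih]
    | mul_inv_cancel x hx y hy ih =>
      obtain ⟨u, hu, rfl⟩ := hy
      rw [inv_simple, hstep x hx u, ih]
  have hcross : ∀ y u, (w⁻¹ * y ∈ cs.starSubgroup s → False) →
      (w⁻¹ * (y * cs.simple u) ∈ cs.posHalf hra s ↔ w⁻¹ * y ∈ cs.posHalf hra s) := by
    intro y u h
    rw [← mul_assoc]
    exact cs.mul_simple_mem_posHalf_iff hra fun h' ↦ h h'.2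
  by_cases hwH : w ∈ cs.posHalf hra s
  · have key := fun x hx ↦ cs.iff_of_notMem_posHalf hra (s := s)
      (Q := fun y ↦ w⁻¹ * y ∈ cs.posHalf hra s)
      (fun y u hy _ ↦ hcross y u fun h ↦ hy (by simpa [hwH] using hconst _ h)) (x := x) hx
    by_cases h1 : w⁻¹ * cs.simple s ∈ cs.posHalf hra s
    · refine .inl (Set.disjoint_left.2 fun x hx hx' ↦ ?_)
      rw [mem_smul_set_iff'] at hx'
      exact hx' ((key x hx).2 h1)
    · refine .inr (.inl fun x hx ↦ ?_)
      rw [mem_smul_set_iff']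
      exact fun h ↦ h1 ((key x hx).1 h)
  · have key := fun x hx ↦ cs.iff_of_mem_posHalf hra (s := s)
      (Q := fun y ↦ w⁻¹ * y ∈ cs.posHalf hra s)
      (fun y u hy _ ↦ hcross y u fun h ↦ hwH (by simpa [hy] using hconst _ h)) (x := x) hx
    by_cases h1 : w⁻¹ * 1 ∈ cs.posHalf hra s
    · refine .inr (.inr (.inl fun x hx ↦ ?_))
      rw [mem_smul_set_iff'] at hx
      exact fun hx' ↦ hx ((key x hx').2 h1)
    · refine .inr (.inr (.inr fun x hx ↦ ?_))
      rw [mem_smul_set_iff']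
      rw [negHalf_compl] at hx
      exact fun h ↦ h1 ((key x hx).1 h)

theorem Nested.smul {D E : Set W} (h : Nested D E) (w : W) : Nested (w • D) (w • E) := by
  rcases h with h | h | h | h
  · exact .inl (Set.disjoint_smul_set.2 h)
  · exact .inr (.inl (Set.smul_set_mono h))
  · exact .inr (.inr (.inl (Set.smul_set_mono h)))
  · exact .inr (.inr (.inr (by rw [← Set.smul_set_compl]; exact Set.smul_set_mono h)))

theorem nested_smul_negHalf (s : B) (v w : W) :
    Nested (v • cs.negHalf hra s) (w • cs.negHalf hra s) := by
  simpa [← mul_smul] using (cs.nested_negHalf hra s (v⁻¹ * w)).smul v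

/-- A half-space is determined by any edge of the Cayley graph entering it. -/
theorem smul_negHalf_eq_of_crossing {s u : B} {w x : W} (h1 : x ∉ w • cs.negHalf hra s)
    (h2 : x * cs.simple u ∈ w • cs.negHalf hra s) :
    w • cs.negHalf hra s = x • cs.negHalf hra u := by
  rw [mem_smul_set_iff', ← mul_assoc] at h2
  rw [mem_smul_set_iff', negHalf, Set.mem_compl_iff, not_not] at h1
  by_cases hc : u = s ∧ w⁻¹ * x ∈ cs.starSubgroup s
  · obtain ⟨rfl, hp⟩ := hc
    conv_lhs => rw [← cs.smul_negHalf_of_stabilizes hra hp h1, ← mul_smul, mul_inv_cancel_left]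
  · exact absurd ((cs.mul_simple_mem_posHalf_iff hra hc).2 h1) h2

/-- The translates of the half-spaces bounded by base walls. -/
def IsHalfSpace (D : Set W) : Prop :=
  ∃ (w : W) (s : B), D = w • cs.negHalf hra s

theorem isHalfSpace_negHalf (s : B) : cs.IsHalfSpace hra (cs.negHalf hra s) :=
  ⟨1, s, (one_smul _ _).symm⟩

variable {hra} in
theorem IsHalfSpace.smul {D : Set W} (h : cs.IsHalfSpace hra D) (v : W) :
    cs.IsHalfSpace hra (v • D) := by
  obtain ⟨w, s, rfl⟩ := h
  exact ⟨v * w, s, (mul_smul _ _ _).symm⟩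

/-- Only finitely many half-spaces separate two given elements. -/
theorem finite_separating (x y : W) : {D | cs.IsHalfSpace hra D ∧ x ∈ D ∧ y ∉ D}.Finite := by
  obtain ⟨v, rfl⟩ : ∃ v, y = x * v := ⟨x⁻¹ * y, by group⟩
  induction v using cs.simple_induction_right with
  | one => exact Set.finite_empty.subset fun D h ↦ h.2.2 (by simpa using h.2.1)
  | mul_simple_right v u ih =>
    refine (ih.insert ((x * (v * cs.simple u)) • cs.negHalf hra u)).subset ?_
    rintro D ⟨hD, hx, hy⟩
    by_cases hv : x * v ∈ D
    · left
      obtain ⟨w, s, rfl⟩ := hD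
      refine cs.smul_negHalf_eq_of_crossing hra hy ?_
      rwa [mul_assoc, simple_mul_simple_cancel_right]
    · exact .inr ⟨hD, hx, hv⟩

theorem length_simple_mul_lt {t : B} {x : W} (h : x ∉ cs.posHalf hra t) :
    cs.length (cs.simple t * x) < cs.length x := by
  obtain ⟨l, hl, rfl⟩ := cs.exists_isReduced x
  rw [hl.eq]
  clear hl
  induction l using List.reverseRecOn with
  | nil => exact absurd (cs.one_mem_posHalf hra t) (by simpa using h)
  | append_singleton l u ih =>
    rw [wordProd_append, wordProd_singleton] at h ⊢
    rw [List.length_append, List.length_singleton]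
    by_cases hl : cs.wordProd l ∈ cs.posHalf hra t
    · by_cases hc : u = t ∧ cs.wordProd l ∈ cs.starSubgroup t
      · obtain ⟨rfl, hp⟩ := hc
        rw [← mul_assoc, (cs.commute_of_mem_starSubgroup hp).eq, simple_mul_simple_cancel_right]
        exact Nat.lt_succ_of_le (cs.length_wordProd_le l)
      · exact absurd ((cs.mul_simple_mem_posHalf_iff hra hc).2 hl) h
    · have h1 := cs.length_mul_le (cs.simple t * cs.wordProd l) (cs.simple u)
      rw [length_simple, mul_assoc] at h1
      have h2 := ih hl
      omega

theorem eq_one_of_forall_mem_posHalf {p : W} (h : ∀ t, p ∈ cs.posHalf hra t) : p = 1 := by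
  by_contra hp
  obtain ⟨t, ht⟩ := cs.exists_leftDescent_of_ne_one hp
  have h1 := cs.length_simple_mul_lt hra (t := t) (x := cs.simple t * p)
    (by rw [simple_mul_mem_posHalf, not_not]; exact h t)
  rw [simple_mul_simple_cancel_left] at h1
  exact absurd ht h1.not_gt

theorem mem_posHalf_of_smul_negHalf_eq {s : B} {p : W}
    (h : p • cs.negHalf hra s = cs.negHalf hra s) : p ∈ cs.posHalf hra s := by
  by_contra hp
  have h1 : p ∈ p • cs.negHalf hra s := by rw [h]; exact hp
  rw [mem_smul_set_iff', inv_mul_cancel] at h1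
  exact cs.one_notMem_negHalf hra s h1

theorem mem_starSubgroup_of_smul_negHalf_eq {s : B} {p : W}
    (h : p • cs.negHalf hra s = cs.negHalf hra s) : p ∈ cs.starSubgroup s := by
  refine cs.mem_starSubgroup_of_stabilizes hra fun x ↦ not_iff_not.1 ?_
  change p * x ∈ cs.negHalf hra s ↔ x ∈ cs.negHalf hra s
  conv_lhs => rw [← h, mem_smul_set_iff', inv_mul_cancel_left]

/-- The half-spaces between `D` and `E` have trivial common stabilizer. -/
def RigidInterval (D E : Set W) : Prop :=
  ∀ q : W, (∀ X, cs.IsHalfSpace hra X → D ⊆ X → X ⊆ E → q • X = X) → q = 1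

variable {cs hra} in
theorem RigidInterval.mono {D D' E : Set W} (h : cs.RigidInterval hra D E) (hD : D' ⊆ D) :
    cs.RigidInterval hra D' E :=
  fun q hq ↦ h q fun X hX h1 h2 ↦ hq X hX (hD.trans h1) h2

variable {cs hra} in
theorem RigidInterval.smul {D E : Set W} (h : cs.RigidInterval hra D E) (v : W) :
    cs.RigidInterval hra (v • D) (v • E) := by
  intro q hq
  have h1 : v⁻¹ * q * v = 1 := h _ fun X hX h1 h2 ↦ by
    have := hq (v • X) (hX.smul cs v) (Set.smul_set_mono h1) (Set.smul_set_mono h2)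
    rw [mul_smul, mul_smul, this, inv_smul_smul]
  have h2 : q = v * (v⁻¹ * q * v) * v⁻¹ := by group
  rw [h2, h1, mul_one, mul_inv_cancel]

/-- The graph on the simple reflections whose edges are the non-commuting pairs. -/
def noncommGraph : SimpleGraph B where
  Adj s t := ¬ Commute (cs.simple s) (cs.simple t)
  symm := ⟨fun _ _ h h' ↦ h h'.symm⟩
  loopless := ⟨fun _ h ↦ h (Commute.refl _)⟩

/-- The product of the simple reflections along a walk, without the one at its end point. -/
def walkProd : ∀ {s t : B}, cs.noncommGraph.Walk s t → W
  | s, _, .cons _ p => cs.simple s * walkProd p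
  | _, _, .nil => 1

theorem simple_smul_negHalf_subset {s t : B} (h : cs.noncommGraph.Adj s t) :
    cs.simple s • cs.negHalf hra t ⊆ cs.negHalf hra s := by
  rw [← simple_smul_posHalf cs hra s]
  exact Set.smul_set_mono (cs.negHalf_subset_posHalf hra fun h' ↦ h h'.symm)

theorem walkProd_smul_subset {s t : B} (p : cs.noncommGraph.Walk s t) :
    cs.walkProd p • cs.negHalf hra t ⊆ cs.negHalf hra s := by
  induction p with
  | nil => rw [walkProd, one_smul]
  | cons h p ih =>
    rw [walkProd, mul_smul]
    exact (Set.smul_set_mono ih).trans (cs.simple_smul_negHalf_subset hra h)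

theorem walkProd_smul_ne {s : B} (p : cs.noncommGraph.Walk s s) (hp : ¬ p.Nil) :
    cs.walkProd p • cs.negHalf hra s ≠ cs.negHalf hra s := by
  cases p with
  | nil => simp at hp
  | cons h p =>
    intro he
    have h1 := cs.simple_mem_negHalf hra s
    rw [← he, walkProd, mul_smul, mem_smul_set_iff', inv_mul_cancel] at h1
    exact cs.one_notMem_negHalf hra _ (cs.walkProd_smul_subset hra p h1)

theorem smul_negHalf_eq_of_mem_support {s t : B} (p : cs.noncommGraph.Walk s t) {q : W}
    (hq : ∀ X, cs.IsHalfSpace hra X → cs.walkProd p • cs.negHalf hra t ⊆ X →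
      X ⊆ cs.negHalf hra s → q • X = X) {v : B} (hv : v ∈ p.support) :
    q • cs.negHalf hra v = cs.negHalf hra v := by
  induction p with
  | nil =>
    obtain rfl : v = _ := by simpa using hv
    exact hq _ (cs.isHalfSpace_negHalf hra _) (by rw [walkProd, one_smul]) subset_rfl
  | @cons s s' t h p ih =>
    have hs := hq _ (cs.isHalfSpace_negHalf hra _) (cs.walkProd_smul_subset hra _) subset_rfl
    rw [SimpleGraph.Walk.support_cons, List.mem_cons] at hv
    rcases hv with rfl | hv
    · exact hs
    · refine ih (fun X hX h1 h2 ↦ ?_) hv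
      have hc := cs.commute_of_mem_starSubgroup (cs.mem_starSubgroup_of_smul_negHalf_eq hra hs)
      have h3 := hq (cs.simple s • X) (hX.smul cs _)
        (by rw [walkProd, mul_smul]; exact Set.smul_set_mono h1)
        ((Set.smul_set_mono h2).trans (cs.simple_smul_negHalf_subset hra h))
      rw [← mul_smul, ← hc.eq, mul_smul] at h3
      exact MulAction.injective _ h3

variable {cs} in
theorem IsIrreducible.connected (hirr : cs.IsIrreducible) (s t : B) :
    cs.noncommGraph.Reachable s t := by
  by_contra ht
  refine hirr ⟨{u | cs.noncommGraph.Reachable s u}, ⟨s, .refl _⟩, ⟨t, ht⟩, fun i hi j hj ↦ ?_⟩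
  by_contra hij
  exact hj (SimpleGraph.Reachable.trans hi (SimpleGraph.Adj.reachable hij))

variable {cs} in
/-- An element translating a half-space into itself with a rigid interval in between. -/
theorem IsIrreducible.exists_rigid [Finite B] (hirr : cs.IsIrreducible) {s a : B} (hsa : s ≠ a) :
    ∃ h : W, h • cs.negHalf hra s ⊆ cs.negHalf hra s ∧
      h • cs.negHalf hra s ≠ cs.negHalf hra s ∧
      cs.RigidInterval hra (h • cs.negHalf hra s) (cs.negHalf hra s) := by
  classical
  have := Fintype.ofFinite B
  obtain ⟨p, hp⟩ : ∃ p : cs.noncommGraph.Walk s s, ∀ v, v ∈ p.support := by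
    suffices h : ∀ F : Finset B, ∃ p : cs.noncommGraph.Walk s s, ∀ v ∈ F, v ∈ p.support by
      obtain ⟨p, hp⟩ := h Finset.univ
      exact ⟨p, fun v ↦ hp v (Finset.mem_univ v)⟩
    intro F
    induction F using Finset.induction_on with
    | empty => exact ⟨.nil, by simp⟩
    | insert v F _ ih =>
      obtain ⟨p, hp⟩ := ih
      obtain ⟨r⟩ := hirr.connected s v
      refine ⟨p.append (r.append r.reverse), fun u hu ↦ ?_⟩
      rcases Finset.mem_insert.1 hu with rfl | hu
      · simp
      · simp [hp u hu]
  refine ⟨cs.walkProd p, cs.walkProd_smul_subset hra p, cs.walkProd_smul_ne hra p ?_, ?_⟩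
  · intro hnil
    have := hp a
    rw [SimpleGraph.Walk.nil_iff_support_eq.1 hnil, List.mem_singleton] at this
    exact hsa this.symm
  · intro q hq
    exact cs.eq_one_of_forall_mem_posHalf hra fun t ↦ cs.mem_posHalf_of_smul_negHalf_eq hra
      (cs.smul_negHalf_eq_of_mem_support hra p hq (hp t))

/-- The centralizer of an element translating a half-space into itself with a rigid interval
in between is virtually generated by this element. -/
theorem exists_finite_transversal {s : B} {g w : W}
    (hsub : g • w • cs.negHalf hra s ⊆ w • cs.negHalf hra s)
    (hne : g • w • cs.negHalf hra s ≠ w • cs.negHalf hra s)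
    (hrig : cs.RigidInterval hra (g • w • cs.negHalf hra s) (w • cs.negHalf hra s)) :
    Function.Injective (fun n : ℤ ↦ g ^ n) ∧
      ∃ Z : Set W, Z.Finite ∧ ∀ z, Commute z g → ∃ k : ℤ, g ^ k * z ∈ Z := by
  have hnest : ∀ u v : W, Nested (u • w • cs.negHalf hra s) (v • w • cs.negHalf hra s) :=
    fun u v ↦ by simpa only [mul_smul] using cs.nested_smul_negHalf hra s (u * w) (v * w)
  have hhalf : ∀ u : W, cs.IsHalfSpace hra (u • w • cs.negHalf hra s) := fun u ↦
    ((cs.isHalfSpace_negHalf hra s).smul cs w).smul cs u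
  set E := w • cs.negHalf hra s with hE
  have hD : StrictAnti fun n : ℤ ↦ g ^ n • E := by
    refine strictAnti_int_of_succ_lt fun n ↦ ?_
    rw [zpow_add_one, mul_smul]
    refine (Set.smul_set_mono hsub).ssubset_of_ne fun h ↦ hne ?_
    exact MulAction.injective _ h
  obtain ⟨x, hxE, hxg⟩ := Set.exists_of_ssubset (hsub.ssubset_of_ne hne)
  have hlevel : ∀ {y : W}, y ∈ E → y ∉ g • E → ∀ i m : ℤ, g ^ i * y ∈ g ^ m • E ↔ m ≤ i := by
    intro y hy hy' i m
    have h : g ^ i * y ∈ g ^ m • E ↔ y ∈ g ^ (m - i) • E := by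
      rw [mem_smul_set_iff' (w := g ^ m), mem_smul_set_iff' (w := g ^ (m - i)), ← mul_assoc,
        ← zpow_neg, ← zpow_neg, ← zpow_add, neg_sub, sub_eq_neg_add]
    rw [h]
    constructor
    · intro h1
      by_contra! h2
      refine hy' ?_
      simpa using hD.antitone (show 1 ≤ m - i by omega) h1
    · intro h1
      exact hD.antitone (show m - i ≤ 0 by omega) (by simpa using hy)
  have hx : ∀ m : ℤ, x ∈ g ^ m • E ↔ m ≤ 0 := fun m ↦ by simpa using hlevel hxE hxg 0 m
  have hexists : ∀ y : W, ∃ k : ℤ, y ∈ g ^ k • E ∧ y ∉ g ^ (k + 1) • E := by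
    intro y
    have h1 := ((cs.finite_separating hra y x).preimage hD.injective.injOn).bddAbove
    have h2 : ∃ n : ℤ, y ∈ g ^ n • E := by
      by_contra! h
      refine Set.Iic_infinite (0 : ℤ)
        (((cs.finite_separating hra x y).preimage hD.injective.injOn).subset fun n hn ↦ ?_)
      exact ⟨hhalf _, (hx n).2 hn, h n⟩
    obtain ⟨b, hb⟩ := h1
    obtain ⟨k, hk, hk'⟩ := Int.exists_greatest_of_bdd (P := fun n ↦ y ∈ g ^ n • E)
      ⟨max b 0, fun n hn ↦ by
        rcases le_or_gt n 0 with h | h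
        · exact le_max_of_le_right h
        · exact le_max_of_le_left (hb ⟨hhalf _, hn, fun h' ↦ h.not_ge ((hx n).1 h')⟩)⟩ h2
    exact ⟨k, hk, fun h ↦ by have := hk' _ h; omega⟩
  refine ⟨fun m n h ↦ hD.injective (congrArg (· • E) h),
    {z | Commute z g ∧ z * x ∈ E ∧ z * x ∉ g • E}, ?_, fun z hz ↦ ?_⟩
  swap
  · obtain ⟨k, hk, hk'⟩ := hexists (z * x)
    refine ⟨-k, ((Commute.refl g).zpow_left _).mul_left hz, ?_, fun h ↦ hk' ?_⟩
    · rwa [mem_smul_set_iff', ← zpow_neg, ← mul_assoc] at hk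
    · rw [mem_smul_set_iff'] at h ⊢
      convert h using 1
      rw [zpow_neg, zpow_add_one]
      group
  have hz : ∀ z, Commute z g → z * x ∈ E → z * x ∉ g • E → ∀ X, g • E ⊆ X → X ⊆ E →
      g ^ (2 : ℤ) * x ∈ z • X ∧ g ^ (-2 : ℤ) * x ∉ z • X := by
    intro z hzg h0 h1 X hX hX'
    have hP : ∀ i : ℤ, g ^ i * (z * x) ∈ z • E ↔ 0 ≤ i := by
      intro i
      rw [← mul_assoc, ← (hzg.zpow_right i).eq, mem_smul_set_iff', mul_assoc, inv_mul_cancel_left]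
      simpa using hlevel hxE hxg i 0
    have hP' := hlevel h0 h1
    have hlow : g ^ (1 : ℤ) • E ⊆ z • E := by
      rcases hnest (g ^ (1 : ℤ)) z with h | h | h | h
      · exact absurd ((hP 1).2 (by norm_num)) (Set.disjoint_left.1 h ((hP' 1 1).2 le_rfl))
      · exact h
      · exact absurd ((hP' 0 1).1 (h ((hP 0).2 le_rfl))) (by norm_num)
      · exact absurd ((hP (-1)).1 (h fun h' ↦ absurd ((hP' (-1) 1).1 h') (by norm_num)))
          (by norm_num)
    have hupp : z • E ⊆ g ^ (-1 : ℤ) • E := by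
      rcases hnest (g ^ (-1 : ℤ)) z with h | h | h | h
      · exact absurd ((hP 0).2 le_rfl) (Set.disjoint_left.1 h ((hP' 0 (-1)).2 (by norm_num)))
      · exact absurd ((hP (-1)).1 (h ((hP' (-1) (-1)).2 le_rfl))) (by norm_num)
      · exact h
      · exact absurd ((hP (-2)).1 (h fun h' ↦ absurd ((hP' (-2) (-1)).1 h') (by norm_num)))
          (by norm_num)
    constructor
    · refine Set.smul_set_mono hX ?_
      rw [← mul_smul, hzg.eq, mul_smul]
      refine Set.smul_set_mono hlow ?_
      rw [← mul_smul, ← zpow_one_add]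
      exact (hlevel hxE hxg 2 _).2 (by norm_num)
    · intro h
      exact absurd ((hlevel hxE hxg (-2) _).1 (hupp (Set.smul_set_mono hX' h))) (by norm_num)
  have hI : Finite {X | cs.IsHalfSpace hra X ∧ g • E ⊆ X ∧ X ⊆ E} := by
    refine (cs.finite_separating hra (g ^ (1 : ℤ) * x) (g ^ (-1 : ℤ) * x)).subset ?_
    rintro X ⟨h, h1, h2⟩
    refine ⟨h, h1 ?_, fun h' ↦ ?_⟩
    · simpa using (hlevel hxE hxg 1 1).2 le_rfl
    · exact absurd ((hlevel hxE hxg (-1) 0).1 (by simpa using h2 h')) (by norm_num)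
  have hS : Finite {X | cs.IsHalfSpace hra X ∧ g ^ (2 : ℤ) * x ∈ X ∧ g ^ (-2 : ℤ) * x ∉ X} :=
    cs.finite_separating hra _ _
  refine Finite.of_injective (β := {X | cs.IsHalfSpace hra X ∧ g • E ⊆ X ∧ X ⊆ E} →
    {X | cs.IsHalfSpace hra X ∧ g ^ (2 : ℤ) * x ∈ X ∧ g ^ (-2 : ℤ) * x ∉ X})
    (fun z X ↦ ⟨z.1 • X.1, X.2.1.smul cs _, hz _ z.2.1 z.2.2.1 z.2.2.2 _ X.2.2.1 X.2.2.2⟩) ?_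
  intro z z' h
  have h1 : z'.1⁻¹ * z.1 = 1 := hrig _ fun X hX h1 h2 ↦ by
    have := congrArg Subtype.val (congrFun h ⟨X, hX, h1, h2⟩)
    change z.1 • X = z'.1 • X at this
    rw [mul_smul, this, inv_smul_smul]
  exact Subtype.ext (inv_mul_eq_one.1 h1).symm

theorem mem_posHalf_of_mem_closure {s : B} {y : W}
    (hy : y ∈ Subgroup.closure (cs.simple '' {s}ᶜ)) : y ∈ cs.posHalf hra s := by
  induction hy using Subgroup.closure_induction_right with
  | one => exact cs.one_mem_posHalf hra s
  | mul_right x _ y hy ih =>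
    obtain ⟨u, hu, rfl⟩ := hy
    rwa [mul_simple_mem_posHalf_iff cs hra fun h ↦ hu h.1]
  | mul_inv_cancel x _ y hy ih =>
    obtain ⟨u, hu, rfl⟩ := hy
    rwa [inv_simple, mul_simple_mem_posHalf_iff cs hra fun h ↦ hu h.1]

theorem disjoint_smul_negHalf {s : B} {y : W}
    (hy : y ∈ Subgroup.closure (cs.simple '' {s}ᶜ)) (hys : y ∉ cs.starSubgroup s) :
    Disjoint (cs.negHalf hra s) (y • cs.negHalf hra s) := by
  have h1 := cs.mem_posHalf_of_mem_closure hra hy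
  have h2 := cs.mem_posHalf_of_mem_closure hra (inv_mem hy)
  rcases cs.nested_negHalf hra s y with h | h | h | h
  · exact h
  · have h3 := h (cs.simple_mem_negHalf hra s)
    rw [mem_smul_set_iff'] at h3
    exact absurd ((cs.mul_simple_mem_posHalf_iff hra fun h' ↦ hys (inv_mem_iff.1 h'.2)).2 h2) h3
  · have h3 := h (Set.smul_mem_smul_set (a := y) (cs.simple_mem_negHalf hra s))
    exact absurd ((cs.mul_simple_mem_posHalf_iff hra fun h' ↦ hys h'.2).2 h1) h3
  · have h3 := h (cs.one_notMem_negHalf hra s)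
    rw [mem_smul_set_iff', mul_one] at h3
    exact absurd h2 h3

open Classical in
theorem parity_isLiftable (hra : M.IsRightAngled) (a : B) :
    M.IsLiftable fun i ↦ (if i = a then -1 else 1 : ℤˣ) := by
  intro i j
  rcases eq_or_ne i j with rfl | hij
  · rw [M.diagonal, pow_one, Int.units_mul_self]
  · rcases hra i j hij with h | h <;> rw [h]
    · exact Int.units_sq _
    · exact pow_zero _

/-- The parity of the number of occurrences of `a` in a word. -/
noncomputable def parityHom (a : B) : W →* ℤˣ := cs.lift ⟨_, parity_isLiftable hra a⟩

theorem parityHom_simple_self (a : B) : cs.parityHom hra a (cs.simple a) = -1 := by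
  rw [parityHom, lift_apply_simple]
  exact if_pos rfl

theorem parityHom_simple_of_ne {a b : B} (h : b ≠ a) : cs.parityHom hra a (cs.simple b) = 1 := by
  rw [parityHom, lift_apply_simple]
  exact if_neg h

theorem parityHom_of_mem_starSubgroup {s a : B} (h : ¬ Commute (cs.simple s) (cs.simple a))
    {p : W} (hp : p ∈ cs.starSubgroup s) : cs.parityHom hra a p = 1 := by
  suffices h : cs.starSubgroup s ≤ (cs.parityHom hra a).ker from h hp
  rw [starSubgroup, Subgroup.closure_le]
  rintro _ ⟨t, ht, rfl⟩
  refine cs.parityHom_simple_of_ne hra ?_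
  rintro rfl
  exact h ht

theorem disjoint_simple_smul_negHalf {s a : B} (h : ¬ Commute (cs.simple s) (cs.simple a)) :
    Disjoint (cs.negHalf hra s) (cs.simple a • cs.negHalf hra s) := by
  refine cs.disjoint_smul_negHalf hra (Subgroup.subset_closure ⟨a, ?_, rfl⟩) fun h' ↦ ?_
  · rintro rfl
    exact h (Commute.refl _)
  · have := cs.parityHom_of_mem_starSubgroup hra h h'
    rw [parityHom_simple_self] at this
    exact absurd this (by decide)

theorem disjoint_simple_smul_simple_smul_negHalf {s a b : B} (hab : a ≠ b)
    (ha : ¬ Commute (cs.simple s) (cs.simple a)) (hb : ¬ Commute (cs.simple s) (cs.simple b)) :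
    Disjoint (cs.simple a • cs.negHalf hra s) (cs.simple b • cs.negHalf hra s) := by
  have h1 : Disjoint (cs.negHalf hra s) ((cs.simple a * cs.simple b) • cs.negHalf hra s) := by
    refine cs.disjoint_smul_negHalf hra
      (mul_mem (Subgroup.subset_closure ⟨a, ?_, rfl⟩) (Subgroup.subset_closure ⟨b, ?_, rfl⟩))
      fun h' ↦ ?_
    · rintro rfl
      exact ha (Commute.refl _)
    · rintro rfl
      exact hb (Commute.refl _)
    · have := cs.parityHom_of_mem_starSubgroup hra ha h'
      rw [map_mul, parityHom_simple_self, parityHom_simple_of_ne cs hra hab.symm] at this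
      exact absurd this (by decide)
  have h2 := Set.disjoint_smul_set (a := cs.simple a) |>.2 h1
  rwa [← mul_smul, simple_mul_simple_cancel_left] at h2

theorem simple_mul_simple_smul_negHalf_subset {s a : B}
    (h : ¬ Commute (cs.simple s) (cs.simple a)) :
    (cs.simple s * cs.simple a) • cs.negHalf hra s ⊆ cs.negHalf hra s := by
  have h1 := (cs.disjoint_simple_smul_negHalf hra h).symm.subset_compl_right
  rw [negHalf_compl] at h1
  rw [mul_smul]
  conv_rhs => rw [← simple_smul_posHalf]
  exact Set.smul_set_mono h1

theorem pow_smul_subset {g : W} {E : Set W} (h : g • E ⊆ E) {n : ℕ} (hn : 0 < n) :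
    g ^ n • E ⊆ g • E := by
  induction n, hn using Nat.le_induction with
  | base => exact (pow_one g).symm ▸ subset_rfl
  | succ n _ ih =>
    rw [pow_succ, mul_smul]
    exact (Set.smul_set_mono h).trans ih

theorem exists_mem_disjoint_smul (T : Subgroup W) [T.Normal] [T.FiniteIndex] {s a b : B}
    (hab : a ≠ b) (ha : ¬ Commute (cs.simple s) (cs.simple a))
    (hb : ¬ Commute (cs.simple s) (cs.simple b)) :
    ∃ τ ∈ T, Disjoint (cs.negHalf hra s) (τ • cs.negHalf hra s) := by
  obtain ⟨n, hn, -, hnT⟩ := Subgroup.exists_pow_mem_of_index_ne_zero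
    (Subgroup.FiniteIndex.index_ne_zero (H := T)) (cs.simple s * cs.simple a)
  refine ⟨_, Subgroup.Normal.conj_mem ‹_› _ hnT (cs.simple s * cs.simple b)⁻¹, ?_⟩
  have hsa := cs.simple_mul_simple_smul_negHalf_subset hra ha
  have hsb := cs.simple_mul_simple_smul_negHalf_subset hra hb
  have h1 : Disjoint ((cs.simple s * cs.simple b) • cs.negHalf hra s)
      ((cs.simple s * cs.simple a) ^ n • (cs.simple s * cs.simple b) • cs.negHalf hra s) := by
    refine Disjoint.mono_right ((Set.smul_set_mono hsb).trans (pow_smul_subset hsa hn)) ?_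
    rw [mul_smul, mul_smul]
    exact Set.disjoint_smul_set.2
      (cs.disjoint_simple_smul_simple_smul_negHalf hra hab.symm hb ha)
  have h2 := Set.disjoint_smul_set (a := (cs.simple s * cs.simple b)⁻¹) |>.2 h1
  rw [inv_smul_smul] at h2
  rwa [inv_inv, mul_smul, mul_smul]

theorem isVirtuallyFreeAbelian_of_forall_eq (cs : CoxeterSystem M W) [Infinite W] {s a : B}
    (h : ∀ i, i = s ∨ i = a) :
    IsVirtuallyFreeAbelian W := by
  set r := cs.simple s * cs.simple a with hr
  have hcases : ∀ w : W, w ∈ (zpowersHom W r).range ∨ cs.simple s * w ∈ (zpowersHom W r).range := by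
    have hrmem : r ∈ (zpowersHom W r).range := ⟨Multiplicative.ofAdd 1, by simp⟩
    intro w
    induction w using cs.simple_induction_left with
    | one => exact .inl (one_mem _)
    | mul_simple_left w i ih =>
      rcases h i with rfl | rfl
      · rw [simple_mul_simple_cancel_left]
        exact ih.symm
      · rcases ih with ih | ih
        · right
          rw [← mul_assoc]
          exact mul_mem hrmem ih
        · left
          have := mul_mem (inv_mem hrmem) ih
          rwa [hr, mul_inv_rev, inv_simple, inv_simple, mul_assoc,
            simple_mul_simple_cancel_left] at this
  have hfin : (zpowersHom W r).range.FiniteIndex := by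
    have : Finite (W ⧸ (zpowersHom W r).range) := by
      refine Finite.of_surjective
        (fun b : Bool ↦ ((if b then 1 else cs.simple s : W) : W ⧸ (zpowersHom W r).range)) ?_
      intro q
      obtain ⟨w, rfl⟩ := QuotientGroup.mk_surjective q
      rcases hcases w with h | h
      · exact ⟨true, by simpa [QuotientGroup.eq] using h⟩
      · exact ⟨false, by simpa [QuotientGroup.eq] using h⟩
    exact Subgroup.finiteIndex_of_finite_quotient
  have hinj : Function.Injective (zpowersHom W r) := by
    refine injective_zpow_iff_not_isOfFinOrder.2 fun hfo ↦ ?_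
    have : Finite (zpowersHom W r).range := by
      have h1 : (zpowersHom W r).range = Subgroup.zpowers r := by
        ext
        rfl
      rw [h1]
      exact finite_zpowers.2 hfo
    have := (Subgroup.finite_iff_finite_and_finiteIndex (zpowersHom W r).range).2 ⟨this, hfin⟩
    exact not_finite W
  refine ⟨_, hfin, Unit, ⟨(MonoidHom.ofInjective hinj).symm.trans
    (AddEquiv.toMultiplicative (Finsupp.uniqueLinearEquiv ℤ ℤ ()).symm.toAddEquiv)⟩⟩

variable {cs} in
theorem IsIrreducible.exists_two_noncommuting [Infinite W] (hirr : cs.IsIrreducible)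
    (hnaff : ¬ IsVirtuallyFreeAbelian W) :
    ∃ s a b : B, a ≠ b ∧ ¬ Commute (cs.simple s) (cs.simple a) ∧
      ¬ Commute (cs.simple s) (cs.simple b) := by
  by_contra! hno
  have hpair : ∀ s a : B, ¬ ∀ i, i = s ∨ i = a :=
    fun s a h ↦ hnaff (cs.isVirtuallyFreeAbelian_of_forall_eq h)
  have : Nonempty B := by
    by_contra hB
    rw [not_nonempty_iff] at hB
    have : Subsingleton W := by
      refine subsingleton_of_forall_eq 1 fun w ↦ ?_
      induction w using cs.simple_induction_left with
      | one => rfl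
      | mul_simple_left w i ih => exact isEmptyElim i
    exact not_finite W
  obtain ⟨s⟩ := this
  obtain ⟨a, ha⟩ : ∃ a, ∀ i, (i = s ∨ i = a) → ∀ j, ¬ (j = s ∨ j = a) →
      Commute (cs.simple i) (cs.simple j) := by
    by_cases h : ∃ a, ¬ Commute (cs.simple s) (cs.simple a)
    · obtain ⟨a, ha⟩ := h
      refine ⟨a, ?_⟩
      rintro i (rfl | rfl) j hj
      · exact hno _ _ _ (fun h ↦ hj (.inr h.symm)) ha
      · exact hno _ _ _ (fun h ↦ hj (.inl h.symm)) fun h ↦ ha h.symm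
    · push Not at h
      exact ⟨s, by rintro i (rfl | rfl) j _ <;> exact h _⟩
  have hj := hpair s a
  push Not at hj
  obtain ⟨j, hj⟩ := hj
  exact hirr ⟨{i | i = s ∨ i = a}, ⟨s, .inl rfl⟩, ⟨j, by simpa using hj⟩, ha⟩

theorem mem_algA_one {G : Type*} [Group G] {T : Subgroup G} {g : T}
    (hg : Function.Injective fun n : ℤ ↦ (g : G) ^ n) {Z : Set G} (hZ : Z.Finite)
    (hcov : ∀ z : G, Commute z g → ∃ k : ℤ, (g : G) ^ k * z ∈ Z) : g ∈ algA T 1 := by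
  set c : Subgroup.centralizer ({g} : Set T) := ⟨g, Subgroup.mem_centralizer_singleton_iff.2 rfl⟩
  have hinj : Function.Injective (zpowersHom _ c) := fun m n h ↦ by
    have := congrArg (fun x : Subgroup.centralizer ({g} : Set T) ↦ ((x : T) : G)) h
    simp only [zpowersHom_apply, SubgroupClass.coe_zpow] at this
    exact hg this
  refine ⟨(zpowersHom _ c).range, ?_, 1, le_rfl, ⟨(MonoidHom.ofInjective hinj).symm.trans
    (AddEquiv.toMultiplicative (LinearEquiv.funUnique (Fin 1) ℤ ℤ).symm.toAddEquiv)⟩⟩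
  have hfin : Finite ((fun x : Subgroup.centralizer ({g} : Set T) ↦ ((x : T) : G)) ⁻¹' Z) :=
    hZ.preimage (Subtype.val_injective.comp Subtype.val_injective).injOn
  have : Finite (Subgroup.centralizer ({g} : Set T) ⧸ (zpowersHom _ c).range) := by
    refine Finite.of_surjective (fun x : (fun x : Subgroup.centralizer ({g} : Set T) ↦
      ((x : T) : G)) ⁻¹' Z ↦ (x.1 : Subgroup.centralizer ({g} : Set T) ⧸ _)) fun q ↦ ?_
    obtain ⟨z, rfl⟩ := QuotientGroup.mk_surjective q
    have hz : Commute (z : T) g := Subgroup.mem_centralizer_singleton_iff.1 z.2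
    have hzc : Commute z c := Subtype.ext hz.eq
    obtain ⟨k, hk⟩ := hcov z (congrArg Subtype.val hz.eq)
    refine ⟨⟨c ^ k * z, show (_ : G) ∈ Z by simpa [c] using hk⟩, ?_⟩
    change ((c ^ k * z : Subgroup.centralizer ({g} : Set T)) : _ ⧸ (zpowersHom _ c).range) = _
    rw [QuotientGroup.eq, ← (hzc.zpow_right k).eq]
    exact ⟨Multiplicative.ofAdd (-k), by simp⟩
  exact Subgroup.finiteIndex_of_finite_quotient

theorem exists_disjoint_of_nested {α : Type*} {D D' U U' : Set α} (hD : Disjoint D D')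
    (hU : Disjoint U U') (h : Nested D U) :
    Disjoint D U ∨ Disjoint D U' ∨ Disjoint D' U ∨ Disjoint D' U' := by
  rcases h with h | h | h | h
  · exact .inl h
  · exact .inr (.inl (hU.mono_left h))
  · exact .inr (.inr (.inl (hD.symm.mono_right h)))
  · exact .inr (.inr (.inr (hU.mono_left (hD.symm.subset_compl_right.trans h))))

variable {cs} in
theorem IsIrreducible.algCovers_one [Finite B] [Infinite W] (hra : M.IsRightAngled)
    (hirr : cs.IsIrreducible)
    (hnaff : ¬ IsVirtuallyFreeAbelian W) (T : Subgroup W) [T.Normal] [T.FiniteIndex] :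
    algCovers T 1 := by
  classical
  obtain ⟨s, a, b, hab, ha, hb⟩ := hirr.exists_two_noncommuting hnaff
  obtain ⟨τ, hτ, hτA⟩ := cs.exists_mem_disjoint_smul hra T hab ha hb
  obtain ⟨h₀, hsub, hne, hrig⟩ := hirr.exists_rigid hra (s := s) (a := a) (by
    rintro rfl
    exact ha (Commute.refl _))
  obtain ⟨n, hn, -, hnT⟩ := Subgroup.exists_pow_mem_of_index_ne_zero
    (Subgroup.FiniteIndex.index_ne_zero (H := T)) h₀
  have hh := pow_smul_subset hsub hn
  have hqT : cs.simple s * τ * cs.simple s ∈ T := by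
    simpa using Subgroup.Normal.conj_mem ‹_› _ hτ (cs.simple s)
  set q := cs.simple s * τ * cs.simple s with hq_def
  have hq : q • (cs.negHalf hra s)ᶜ ⊆ cs.negHalf hra s := by
    rw [hq_def, mul_smul, mul_smul, negHalf_compl, simple_smul_posHalf]
    conv_rhs => rw [← simple_smul_posHalf, ← negHalf_compl]
    exact Set.smul_set_mono hτA.symm.subset_compl_right
  set h := h₀ ^ n
  set f : T × T → T := fun p ↦ (p.2 * ⟨h, hnT⟩ * ⟨q, hqT⟩ * p.1⁻¹)⁻¹ with hf
  set P : Finset T := {1, ⟨τ, hτ⟩} with hP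
  refine ⟨(P ×ˢ P).image f, Set.eq_univ_of_forall fun t ↦ ?_⟩
  obtain ⟨u, hu, v, hv, huv⟩ : ∃ u ∈ P, ∃ v ∈ P,
      Disjoint ((t : W) • (v : W) • cs.negHalf hra s) ((u : W) • cs.negHalf hra s) := by
    have h1 : Disjoint ((t : W) • cs.negHalf hra s) ((t : W) • τ • cs.negHalf hra s) :=
      Set.disjoint_smul_set.2 hτA
    have h2 : Nested ((t : W) • cs.negHalf hra s) (cs.negHalf hra s) := by
      simpa using cs.nested_smul_negHalf hra s t 1
    rcases exists_disjoint_of_nested h1 hτA h2 with h' | h' | h' | h'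
    · exact ⟨1, by simp [hP], 1, by simp [hP], by simpa using h'⟩
    · exact ⟨⟨τ, hτ⟩, by simp [hP], 1, by simp [hP], by simpa using h'⟩
    · exact ⟨1, by simp [hP], ⟨τ, hτ⟩, by simp [hP], by simpa using h'⟩
    · exact ⟨⟨τ, hτ⟩, by simp [hP], ⟨τ, hτ⟩, by simp [hP], h'⟩
  refine Set.mem_iUnion₂.2 ⟨f (u, v), Finset.mem_image_of_mem _ (by simp [hu, hv]), ?_⟩
  rw [Set.mem_smul_set_iff_inv_smul_mem, smul_eq_mul]
  have hg : (((f (u, v))⁻¹ * t : T) : W) • (v : W) • cs.negHalf hra s ⊆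
      (v : W) • h₀ • cs.negHalf hra s := by
    have h1 : (u : W)⁻¹ • (t : W) • (v : W) • cs.negHalf hra s ⊆ (cs.negHalf hra s)ᶜ := by
      rw [← Set.subset_smul_set_iff, Set.smul_set_compl]
      exact huv.subset_compl_right
    have h2 := (Set.smul_set_mono (a := q) h1).trans hq
    have h3 := (Set.smul_set_mono (a := h) h2).trans hh
    have h4 := Set.smul_set_mono (a := (v : W)) h3
    simpa [hf, mul_smul] using h4
  have hsub' : (v : W) • h₀ • cs.negHalf hra s ⊆ (v : W) • cs.negHalf hra s :=
    Set.smul_set_mono hsub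
  obtain ⟨hinj, Z, hZ, hcov⟩ := cs.exists_finite_transversal hra (hg.trans hsub')
    (fun he ↦ hne (MulAction.injective (v : W) (hsub'.antisymm (he ▸ hg))))
    ((hrig.smul v).mono hg)
  exact mem_algA_one hinj hZ hcov

end CoxeterSystem

/-- If `T` is a proper normal subgroup of finite index of an infinite, irreducible,
non-affine right-angled Coxeter group `W`, then `r(T) ≤ 1`: `T` is the union of
finitely many left translates of `A₁(T)`. -/
theorem stmt_14 {B W : Type*} [Fintype B] [Group W] {M : CoxeterMatrix B}
    (cs : CoxeterSystem M W) (hra : M.IsRightAngled) [Infinite W]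
    (hirr : cs.IsIrreducible) (hnaff : ¬ IsVirtuallyFreeAbelian W)
    (T : Subgroup W) [T.Normal] (hTproper : T ≠ ⊤) (hTindex : T.FiniteIndex) :
    algr T ≤ 1 :=
  sInf_le ⟨1, by simp, hirr.algCovers_one hra hnaff T⟩
end

section
/- Let W be an infinite, irreducible, non-affine right-angled Coxeter group with finite generating set S. Then rank(W) = 1. -/
open scoped Pointwise

namespace CoxeterSystem

variable {B : Type*} {W : Type*} [Group W] {M : CoxeterMatrix B} (cs : CoxeterSystem M W)

lemma commute_of_isRightAngled_of_ne_zero (hra : M.IsRightAngled) {a b : B} (h : M a b ≠ 0) :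
    Commute (cs.simple a) (cs.simple b) := by
  by_cases hab : a = b
  · rw [hab]
  · have h2 := cs.simple_mul_simple_pow a b
    rw [(hra a b hab).resolve_right h, pow_two] at h2
    have h3 := mul_eq_one_iff_eq_inv.mp h2
    rwa [mul_inv_rev, cs.inv_simple, cs.inv_simple] at h3

lemma isLiftable_of_commute (hra : M.IsRightAngled) {G : Type*} [Group G] {f : B → G}
    (hf : ∀ b, f b * f b = 1) (hc : ∀ a b, M a b ≠ 0 → Commute (f a) (f b)) :
    M.IsLiftable f := by
  intro a b
  by_cases hab : a = b
  · subst hab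
    rw [hf, one_pow]
  · rcases hra a b hab with h | h
    · have := hc a b (by simp [h])
      rw [h, this.mul_pow, pow_two, pow_two, hf, hf, one_mul]
    · rw [h, pow_zero]

lemma simple_injective_of_isRightAngled (hra : M.IsRightAngled) :
    Function.Injective cs.simple := by
  classical
  intro a b hab
  by_contra hne
  have hl : M.IsLiftable fun i => if i = a then (-1 : ℤˣ) else 1 :=
    isLiftable_of_commute hra (fun i => by split <;> rfl) fun _ _ _ => Commute.all _ _
  have h := congrArg (cs.lift ⟨_, hl⟩) hab
  rw [lift_apply_simple, lift_apply_simple, if_pos rfl, if_neg (fun e => hne e.symm)] at h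
  exact absurd h (by decide)

open Classical in
/-- The affine action of the simple reflection `i` on functions `W → ZMod 2`: conjugation by
the reflection, followed by adding its indicator function. -/
noncomputable def sideFlip (i : B) : Equiv.Perm (W → ZMod 2) :=
  Function.Involutive.toPerm
    (fun f t => f (cs.simple i * t * cs.simple i) + if t = cs.simple i then 1 else 0) (by
      intro f
      funext t
      have h : cs.simple i * t * cs.simple i = cs.simple i ↔ t = cs.simple i := by
        constructor
        · intro h
          have := congrArg (fun x => cs.simple i * x * cs.simple i) h
          simpa [mul_assoc] using this
        · rintro rfl
          simp
      have h2 : cs.simple i * (cs.simple i * t * cs.simple i) * cs.simple i = t := by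
        simp [mul_assoc]
      simp only [h, h2, add_assoc, CharTwo.add_self_eq_zero, add_zero])

open Classical in
lemma sideFlip_apply (i : B) (f : W → ZMod 2) (t : W) :
    cs.sideFlip i f t = f (cs.simple i * t * cs.simple i) + if t = cs.simple i then 1 else 0 :=
  rfl

lemma sideFlip_isLiftable (hra : M.IsRightAngled) : M.IsLiftable cs.sideFlip := by
  classical
  refine isLiftable_of_commute hra (fun b => ?_) (fun a b hab => ?_)
  · ext1 f
    exact Function.Involutive.toPerm_involutive _ f
  · have hc := cs.commute_of_isRightAngled_of_ne_zero hra hab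
    have key : ∀ a b : B, Commute (cs.simple a) (cs.simple b) → ∀ t : W,
        cs.simple a * t * cs.simple a = cs.simple b ↔ t = cs.simple b := by
      intro a b h t
      constructor
      · intro h1
        have h2 := congrArg (fun x => cs.simple a * x * cs.simple a) h1
        simp only [mul_assoc, simple_mul_simple_self, mul_one,
          simple_mul_simple_cancel_left] at h2
        rw [h2, ← h.eq, simple_mul_simple_cancel_left]
      · rintro rfl
        rw [h.eq, simple_mul_simple_cancel_right]
    ext f t
    simp only [Equiv.Perm.mul_apply, sideFlip_apply]
    have e : cs.simple b * (cs.simple a * t * cs.simple a) * cs.simple b =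
        cs.simple a * (cs.simple b * t * cs.simple b) * cs.simple a := by
      calc _ = (cs.simple b * cs.simple a) * t * (cs.simple a * cs.simple b) := by group
        _ = (cs.simple a * cs.simple b) * t * (cs.simple b * cs.simple a) := by rw [hc.eq]
        _ = _ := by group
    rw [e, if_congr (key a b hc t) rfl rfl, if_congr (key b a hc.symm t) rfl rfl, add_right_comm]

variable (hra : M.IsRightAngled)

/-- The function recording by which reflections `t` the elements `1` and `g` are separated. -/
noncomputable def side (g t : W) : ZMod 2 :=
  cs.lift ⟨cs.sideFlip, cs.sideFlip_isLiftable hra⟩ g 0 t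

lemma lift_sideFlip_apply (g : W) (f : W → ZMod 2) (t : W) :
    cs.lift ⟨cs.sideFlip, cs.sideFlip_isLiftable hra⟩ g f t =
      f (g⁻¹ * t * g) + cs.side hra g t := by
  induction g using cs.simple_induction_left generalizing f t with
  | one => simp [side]
  | mul_simple_left g i ih =>
    rw [side, map_mul, Equiv.Perm.mul_apply, Equiv.Perm.mul_apply, lift_apply_simple,
      sideFlip_apply, sideFlip_apply, ih, ih]
    simp [mul_assoc, add_assoc]

lemma side_mul (g h t : W) :
    cs.side hra (g * h) t = cs.side hra h (g⁻¹ * t * g) + cs.side hra g t := by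
  rw [side, map_mul, Equiv.Perm.mul_apply, lift_sideFlip_apply]
  rfl

@[simp] lemma side_one (t : W) : cs.side hra 1 t = 0 := by simp [side]

open Classical in
lemma side_simple (i : B) (t : W) :
    cs.side hra (cs.simple i) t = if t = cs.simple i then 1 else 0 := by
  rw [side, lift_apply_simple, sideFlip_apply]
  simp

lemma side_inv (g t : W) : cs.side hra g⁻¹ t = cs.side hra g (g * t * g⁻¹) := by
  have h := cs.side_mul hra g g⁻¹ (g * t * g⁻¹)
  rw [mul_inv_cancel, side_one, show g⁻¹ * (g * t * g⁻¹) * g = t by group] at h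
  exact CharTwo.add_eq_zero.mp h.symm

open Classical in
lemma side_mul_simple (g : W) (i : B) (t : W) :
    cs.side hra (g * cs.simple i) t =
      cs.side hra g t + if t = g * cs.simple i * g⁻¹ then 1 else 0 := by
  rw [side_mul, side_simple, add_comm]
  congr 2
  rw [eq_iff_iff]
  constructor
  · intro h
    rw [← h]
    group
  · rintro rfl
    group

lemma side_simple_mul (i : B) (g t : W) (h : t ≠ cs.simple i) :
    cs.side hra (cs.simple i * g) t = cs.side hra g (cs.simple i * t * cs.simple i) := by
  rw [side_mul, side_simple, if_neg h, add_zero, inv_simple]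

lemma side_simple_mul_self (i : B) (g : W) :
    cs.side hra (cs.simple i * g) (cs.simple i) = cs.side hra g (cs.simple i) + 1 := by
  rw [side_mul, side_simple, if_pos rfl, inv_simple, simple_mul_simple_self, one_mul]

lemma mem_leftInvSeq_of_side_ne_zero (ω : List B) (t : W)
    (h : cs.side hra (cs.wordProd ω) t ≠ 0) : t ∈ cs.leftInvSeq ω := by
  induction ω generalizing t with
  | nil => simp at h
  | cons i ω ih =>
    rw [wordProd_cons] at h
    by_cases hi : t = cs.simple i
    · simp [leftInvSeq, hi]
    · rw [side_simple_mul _ _ _ _ _ hi] at h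
      simp only [leftInvSeq, List.mem_cons, List.mem_map]
      refine Or.inr ⟨_, ih _ h, ?_⟩
      simp [mul_assoc]

lemma finite_side_ne_zero (g : W) : {t | cs.side hra g t ≠ 0}.Finite := by
  obtain ⟨ω, rfl⟩ := cs.wordProd_surjective g
  exact (List.finite_toSet (cs.leftInvSeq ω)).subset
    fun t ht => cs.mem_leftInvSeq_of_side_ne_zero hra ω t ht

lemma finite_side_ne (g h : W) : {t | cs.side hra g t ≠ cs.side hra h t}.Finite := by
  refine ((cs.finite_side_ne_zero hra g).union (cs.finite_side_ne_zero hra h)).subset ?_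
  intro t ht
  by_contra hc
  simp only [Set.mem_union, Set.mem_ofPred_eq, not_or, not_not] at hc
  exact ht (hc.1.trans hc.2.symm)

lemma isLeftInversion_of_side_ne_zero {g t : W} (h : cs.side hra g t ≠ 0) :
    cs.IsLeftInversion g t := by
  obtain ⟨ω, hω, rfl⟩ := cs.exists_isReduced g
  exact cs.isLeftInversion_of_mem_leftInvSeq hω (cs.mem_leftInvSeq_of_side_ne_zero hra ω t h)

lemma exists_side_simple_eq_one {g : W} (hg : g ≠ 1) :
    ∃ i, cs.side hra g (cs.simple i) = 1 := by
  obtain ⟨i, hi⟩ := cs.exists_leftDescent_of_ne_one hg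
  refine ⟨i, ?_⟩
  by_contra hne
  have h1 : cs.side hra (cs.simple i * g) (cs.simple i) ≠ 0 := by
    rw [side_simple_mul_self]
    generalize cs.side hra g (cs.simple i) = z at *
    revert hne
    decide +revert
  have h2 := (cs.isLeftInversion_of_side_ne_zero hra h1).2
  rw [simple_mul_simple_cancel_left] at h2
  exact lt_asymm h2 hi

end CoxeterSystem

namespace CoxeterSystem

variable {B : Type*} {W : Type*} [Group W] {M : CoxeterMatrix B} (cs : CoxeterSystem M W)
  (hra : M.IsRightAngled)

/-- Two generators `a`, `b` whose product has infinite order act on `ℤ` as the reflections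
`x ↦ -x` and `x ↦ 1 - x`, with all other generators acting trivially. -/
lemma exists_hom_perm_int (hra : M.IsRightAngled) {a b : B} (hab : M a b = 0) :
    ∃ φ : W →* Equiv.Perm ℤ, φ (cs.simple a) = Equiv.subLeft 0 ∧
      φ (cs.simple b) = Equiv.subLeft 1 ∧ ∀ i, i ≠ a → i ≠ b → φ (cs.simple i) = 1 := by
  classical
  have hne : b ≠ a := by
    rintro rfl
    simp at hab
  let f : B → Equiv.Perm ℤ := fun i =>
    if i = a then Equiv.subLeft 0 else if i = b then Equiv.subLeft 1 else 1
  have hf : M.IsLiftable f := by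
    refine isLiftable_of_commute hra (fun i => ?_) (fun i j hij => ?_)
    · ext x
      simp only [f]
      split_ifs <;> simp
    · have hba : M b a = 0 := by rw [M.symmetric, hab]
      simp only [f]
      split_ifs <;> simp_all
  refine ⟨cs.lift ⟨f, hf⟩, ?_, ?_, fun i hi hj => ?_⟩
  · rw [lift_apply_simple]
    simp [f]
  · rw [lift_apply_simple]
    simp [f, hne]
  · rw [lift_apply_simple]
    simp [f, hi, hj]

/-- The alternating product `a b a ⋯` of `n` simple reflections. -/
def alternatingProd (a b : B) : ℕ → W
  | 0 => 1
  | n + 1 => cs.simple a * alternatingProd b a n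

lemma le_of_side_alternatingProd_ne_zero {a b : B} {φ : W →* Equiv.Perm ℤ}
    (ha : φ (cs.simple a) = Equiv.subLeft 0) (hb : φ (cs.simple b) = Equiv.subLeft 1) (n : ℕ) :
    (∀ (t : W) (c : ℤ), φ t = Equiv.subLeft c →
      cs.side hra (cs.alternatingProd a b n) t ≠ 0 → c ≤ 0) ∧
    (∀ (t : W) (c : ℤ), φ t = Equiv.subLeft c →
      cs.side hra (cs.alternatingProd b a n) t ≠ 0 → 1 ≤ c) := by
  induction n with
  | zero => simp [alternatingProd]
  | succ n ih =>
    constructor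
    · intro t c hc h
      by_cases ht : t = cs.simple a
      · rw [ht, ha] at hc
        have := congrArg (fun e : Equiv.Perm ℤ => e 0) hc
        simp at this
        omega
      · rw [alternatingProd, side_simple_mul _ _ _ _ _ ht] at h
        have := ih.2 _ (-c) (by
          rw [map_mul, map_mul, ha, hc]
          ext x
          simp
          ring) h
        omega
    · intro t c hc h
      by_cases ht : t = cs.simple b
      · rw [ht, hb] at hc
        have := congrArg (fun e : Equiv.Perm ℤ => e 0) hc
        simp at this
        omega
      · rw [alternatingProd, side_simple_mul _ _ _ _ _ ht] at h
        have := ih.1 _ (2 - c) (by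
          rw [map_mul, map_mul, hb, hc]
          ext x
          simp
          ring) h
        omega

lemma exists_alternatingProd_succ {c d : B} {g : W} {n : ℕ}
    (hd : cs.side hra (cs.alternatingProd d c n) (cs.simple c) = 0)
    (hg : cs.side hra g (cs.simple c) ≠ 0)
    (ih : ∃ h, g = cs.alternatingProd d c n * h ∧ cs.length h + n ≤ cs.length g) :
    ∃ h, g = cs.alternatingProd c d (n + 1) * h ∧ cs.length h + (n + 1) ≤ cs.length g := by
  obtain ⟨h, hgh, hl⟩ := ih
  rw [hgh, side_mul, hd, add_zero] at hg
  have hlt := (cs.isLeftInversion_of_side_ne_zero hra hg).2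
  refine ⟨(cs.alternatingProd d c n)⁻¹ * cs.simple c * cs.alternatingProd d c n * h, ?_,
    by omega⟩
  rw [alternatingProd]
  conv_lhs => rw [hgh]
  simp [mul_assoc]

/-- An element cannot have two non-commuting left descents. -/
lemma side_simple_eq_zero_of_not_commute {a b : B}
    (hab : ¬ Commute (cs.simple a) (cs.simple b)) {g : W}
    (ha : cs.side hra g (cs.simple a) ≠ 0) : cs.side hra g (cs.simple b) = 0 := by
  by_contra hb
  have hM : M a b = 0 := by
    by_contra h
    exact hab (cs.commute_of_isRightAngled_of_ne_zero hra h)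
  obtain ⟨φ, h0, h1, -⟩ := cs.exists_hom_perm_int hra hM
  have key : ∀ n, (∃ h, g = cs.alternatingProd a b n * h ∧ cs.length h + n ≤ cs.length g) ∧
      (∃ h, g = cs.alternatingProd b a n * h ∧ cs.length h + n ≤ cs.length g) := by
    intro n
    induction n with
    | zero => exact ⟨⟨g, by simp [alternatingProd]⟩, ⟨g, by simp [alternatingProd]⟩⟩
    | succ n ih =>
      refine ⟨cs.exists_alternatingProd_succ hra ?_ ha ih.2,
        cs.exists_alternatingProd_succ hra ?_ hb ih.1⟩
      · by_contra hne
        have := (cs.le_of_side_alternatingProd_ne_zero hra h0 h1 n).2 _ 0 h0 hne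
        omega
      · by_contra hne
        have := (cs.le_of_side_alternatingProd_ne_zero hra h0 h1 n).1 _ 1 h1 hne
        omega
  obtain ⟨h, -, hl⟩ := (key (cs.length g + 1)).1
  omega

/-- The walls of the reflections `r` and `t` cross: all four quadrants they bound are
nonempty. -/
def Crosses (r t : W) : Prop :=
  ∀ i j : ZMod 2, ∃ y, cs.side hra y r = i ∧ cs.side hra y t = j

lemma Crosses.conj {r t : W} (h : cs.Crosses hra r t) (g : W) :
    cs.Crosses hra (g * r * g⁻¹) (g * t * g⁻¹) := by
  intro i j
  obtain ⟨y, h1, h2⟩ := h (i - cs.side hra g (g * r * g⁻¹)) (j - cs.side hra g (g * t * g⁻¹))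
  refine ⟨g * y, ?_, ?_⟩
  · rw [side_mul, show g⁻¹ * (g * r * g⁻¹) * g = r by group, h1, sub_add_cancel]
  · rw [side_mul, show g⁻¹ * (g * t * g⁻¹) * g = t by group, h2, sub_add_cancel]

lemma zmod_two_eq_zero_or_one (i : ZMod 2) : i = 0 ∨ i = 1 := by
  decide +revert

lemma commute_of_crosses_simple (x : W) (u a : B)
    (h : cs.Crosses hra (x * cs.simple u * x⁻¹) (cs.simple a)) :
    Commute (x * cs.simple u * x⁻¹) (cs.simple a) := by
  induction hn : cs.length x using Nat.strong_induction_on generalizing x a with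
  | _ n ih =>
  subst hn
  have hQ : ∀ v, ¬ Commute (cs.simple v) (cs.simple a) →
      ¬ cs.Crosses hra (cs.simple v) (cs.simple a) := by
    intro v hv hc
    obtain ⟨y, h1, h2⟩ := hc 1 1
    have := cs.side_simple_eq_zero_of_not_commute hra hv (g := y) (by simp [h1])
    simp [h2] at this
  by_cases hx : x = 1
  · subst hx
    by_contra hne
    simp only [one_mul, inv_one, mul_one] at h hne
    exact hQ u hne h
  obtain ⟨v, hv⟩ := cs.exists_side_simple_eq_one hra hx
  have hlt := (cs.isLeftInversion_of_side_ne_zero hra (g := x) (t := cs.simple v)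
    (by simp [hv])).2
  have hr : cs.simple v * (x * cs.simple u * x⁻¹) * (cs.simple v)⁻¹ =
      (cs.simple v * x) * cs.simple u * (cs.simple v * x)⁻¹ := by group
  have hva : Commute (cs.simple v) (cs.simple a) →
      Commute (x * cs.simple u * x⁻¹) (cs.simple a) := by
    intro hc
    have h1 := h.conj cs hra (cs.simple v)
    rw [hr, show cs.simple v * cs.simple a * (cs.simple v)⁻¹ = cs.simple a by
      rw [hc.eq]; group] at h1
    have h2 := ih _ hlt _ _ h1 rfl
    rw [← hr] at h2
    have h3 := (hc.inv_left.mul_left h2).mul_left hc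
    rwa [show (cs.simple v)⁻¹ * (cs.simple v * (x * cs.simple u * x⁻¹) * (cs.simple v)⁻¹) *
      cs.simple v = x * cs.simple u * x⁻¹ by group] at h3
  by_cases hc : Commute (cs.simple v) (cs.simple a)
  · exact hva hc
  · have hvr : cs.simple v ≠ x * cs.simple u * x⁻¹ := by
      intro e
      rw [← e] at h
      exact hQ v hc h
    have hcr : cs.Crosses hra (x * cs.simple u * x⁻¹) (cs.simple v) := by
      intro i j
      rcases zmod_two_eq_zero_or_one j with rfl | rfl
      · obtain ⟨y, h1, h2⟩ := h i 1
        exact ⟨y, h1, cs.side_simple_eq_zero_of_not_commute hra (fun e => hc e.symm)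
          (by simp [h2])⟩
      · by_cases hi : cs.side hra x (x * cs.simple u * x⁻¹) = i
        · exact ⟨x, hi, hv⟩
        · refine ⟨x * cs.simple u, ?_, ?_⟩
          · rw [side_mul_simple, if_pos rfl]
            revert hi
            generalize cs.side hra x (x * cs.simple u * x⁻¹) = z
            decide +revert
          · rw [side_mul_simple, if_neg hvr, hv, add_zero]
    have h1 := hcr.conj cs hra (cs.simple v)
    rw [hr, mul_inv_cancel_right] at h1
    have h2 := ih _ hlt _ _ h1 rfl
    rw [← hr] at h2
    have h3 : cs.simple v * (x * cs.simple u * x⁻¹) * (cs.simple v)⁻¹ =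
        x * cs.simple u * x⁻¹ := by
      have := h2.eq
      rw [inv_mul_cancel_right] at this
      exact (mul_left_cancel this).symm
    rw [← h3, hr] at h ⊢
    exact ih _ hlt _ _ h rfl

end CoxeterSystem

namespace CoxeterSystem

variable {B : Type*} {W : Type*} [Group W] {M : CoxeterMatrix B} (cs : CoxeterSystem M W)
  (hra : M.IsRightAngled)

lemma commute_of_forall_simple {c : W} (h : ∀ b, Commute c (cs.simple b)) (w : W) :
    Commute c w := by
  induction w using cs.simple_induction_left with
  | one => exact Commute.one_right _
  | mul_simple_left w i ih => exact (h i).mul_right ih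

/-- The translate by `x` of the set of elements having `b` as a left descent. -/
def halfSpace (x : W) (b : B) : Set W := {y | cs.side hra (x⁻¹ * y) (cs.simple b) = 1}

/-- The reflection bounding the half-space `cs.halfSpace hra x b`. -/
def wall (x : W) (b : B) : W := x * cs.simple b * x⁻¹

lemma mem_halfSpace {x y : W} {b : B} :
    y ∈ cs.halfSpace hra x b ↔ cs.side hra (x⁻¹ * y) (cs.simple b) = 1 := Iff.rfl

lemma mem_halfSpace_iff {x y : W} {b : B} :
    y ∈ cs.halfSpace hra x b ↔
      cs.side hra y (cs.wall x b) + cs.side hra x⁻¹ (cs.simple b) = 1 := by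
  rw [mem_halfSpace, side_mul, inv_inv, wall]

lemma smul_halfSpace (g x : W) (b : B) :
    g • cs.halfSpace hra x b = cs.halfSpace hra (g * x) b := by
  ext y
  rw [Set.mem_smul_set_iff_inv_smul_mem, mem_halfSpace, mem_halfSpace, smul_eq_mul, mul_inv_rev,
    mul_assoc]

lemma compl_halfSpace (x : W) (b : B) :
    (cs.halfSpace hra x b)ᶜ = cs.halfSpace hra (x * cs.simple b) b := by
  ext y
  rw [Set.mem_compl_iff, mem_halfSpace, mem_halfSpace, mul_inv_rev, inv_simple, mul_assoc,
    side_simple_mul_self]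
  generalize cs.side hra (x⁻¹ * y) (cs.simple b) = z
  decide +revert

lemma wall_mul_left (g x : W) (b : B) : cs.wall (g * x) b = g * cs.wall x b * g⁻¹ := by
  simp [wall, mul_assoc]

@[simp] lemma wall_mul_simple (x : W) (b : B) : cs.wall (x * cs.simple b) b = cs.wall x b := by
  simp [wall, mul_assoc]

@[simp] lemma wall_one (b : B) : cs.wall (1 : W) b = cs.simple b := by simp [wall]

lemma side_wall_ne {x y z : W} {b : B} (hy : y ∈ cs.halfSpace hra x b)
    (hz : z ∉ cs.halfSpace hra x b) :
    cs.side hra y (cs.wall x b) ≠ cs.side hra z (cs.wall x b) := by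
  rw [mem_halfSpace_iff] at hy hz
  intro h
  rw [h] at hy
  exact hz hy

lemma notMem_halfSpace_self (x : W) (b : B) : x ∉ cs.halfSpace hra x b := by
  simp [mem_halfSpace]

lemma mul_simple_mem_halfSpace (x : W) (b : B) : x * cs.simple b ∈ cs.halfSpace hra x b := by
  classical
  simp [mem_halfSpace, side_simple]

lemma halfSpace_eq_of_wall_eq {x y z : W} {a b : B} (h : cs.wall x a = cs.wall y b)
    (hx : z ∈ cs.halfSpace hra x a) (hy : z ∈ cs.halfSpace hra y b) :
    cs.halfSpace hra x a = cs.halfSpace hra y b := by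
  ext w
  rw [mem_halfSpace_iff, h] at hx ⊢
  rw [mem_halfSpace_iff] at hy ⊢
  rw [add_left_cancel (hx.trans hy.symm)]

lemma wall_eq_of_halfSpace_eq {x y : W} {a b : B}
    (h : cs.halfSpace hra x a = cs.halfSpace hra y b) : cs.wall x a = cs.wall y b := by
  classical
  have h1 := cs.notMem_halfSpace_self hra x a
  have h2 := cs.mul_simple_mem_halfSpace hra x a
  rw [h] at h1 h2
  have h3 := cs.side_wall_ne hra h2 h1
  rw [side_mul_simple] at h3
  by_contra hne
  rw [if_neg (fun e => hne e.symm), add_zero] at h3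
  exact h3 rfl

lemma crosses_wall_iff {r x : W} {b : B} :
    cs.Crosses hra r (cs.wall x b) ↔ ∀ i, (∃ y ∈ cs.halfSpace hra x b, cs.side hra y r = i) ∧
      ∃ y ∉ cs.halfSpace hra x b, cs.side hra y r = i := by
  constructor
  · intro h i
    obtain ⟨y, h1, h2⟩ := h i (1 - cs.side hra x⁻¹ (cs.simple b))
    obtain ⟨z, h3, h4⟩ := h i (- cs.side hra x⁻¹ (cs.simple b))
    refine ⟨⟨y, ?_, h1⟩, ⟨z, ?_, h3⟩⟩
    · rw [mem_halfSpace_iff, h2, sub_add_cancel]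
    · rw [mem_halfSpace_iff, h4, neg_add_cancel]
      decide
  · intro h i j
    obtain ⟨⟨y, h1, h2⟩, ⟨z, h3, h4⟩⟩ := h i
    have := cs.side_wall_ne hra h1 h3
    by_cases hj : cs.side hra y (cs.wall x b) = j
    · exact ⟨y, h2, hj⟩
    · refine ⟨z, h4, ?_⟩
      generalize cs.side hra y (cs.wall x b) = p at *
      generalize cs.side hra z (cs.wall x b) = q at *
      clear * - this hj
      decide +revert

lemma commute_of_crosses {x y : W} {a b : B}
    (h : cs.Crosses hra (cs.wall x a) (cs.wall y b)) :
    Commute (cs.wall x a) (cs.wall y b) := by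
  have h1 := h.conj cs hra y⁻¹
  rw [← wall_mul_left, ← wall_mul_left, inv_mul_cancel, wall_one] at h1
  have h2 := cs.commute_of_crosses_simple hra _ _ _ h1
  change Commute (cs.wall (y⁻¹ * x) a) _ at h2
  rw [wall_mul_left] at h2
  have h3 : cs.wall y b = y * cs.simple b * y⁻¹ := rfl
  have h4 := (h2.map (MulAut.conj y).toMonoidHom)
  simp only [MulEquiv.toMonoidHom_eq_coe, MonoidHom.coe_coe, MulAut.conj_apply] at h4
  rwa [← h3, show y * (y⁻¹ * cs.wall x a * y⁻¹⁻¹) * y⁻¹ = cs.wall x a by group] at h4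

lemma nested_of_not_crosses {x y : W} {a b : B}
    (h : ¬ cs.Crosses hra (cs.wall x a) (cs.wall y b)) :
    cs.halfSpace hra x a ⊆ cs.halfSpace hra y b ∨
    cs.halfSpace hra x a ⊆ (cs.halfSpace hra y b)ᶜ ∨
    (cs.halfSpace hra x a)ᶜ ⊆ cs.halfSpace hra y b ∨
    (cs.halfSpace hra x a)ᶜ ⊆ (cs.halfSpace hra y b)ᶜ := by
  by_contra hcon
  simp only [not_or, Set.not_subset, Set.mem_compl_iff, not_not] at hcon
  obtain ⟨⟨p1, h1, h1'⟩, ⟨p2, h2, h2'⟩, ⟨p3, h3, h3'⟩, ⟨p4, h4, h4'⟩⟩ := hcon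
  apply h
  rw [crosses_wall_iff]
  intro i
  constructor
  · have := cs.side_wall_ne hra h2 h4
    by_cases hj : cs.side hra p2 (cs.wall x a) = i
    · exact ⟨_, h2', hj⟩
    · refine ⟨_, h4', ?_⟩
      generalize cs.side hra p2 (cs.wall x a) = p at *
      generalize cs.side hra p4 (cs.wall x a) = q at *
      clear * - this hj
      decide +revert
  · have := cs.side_wall_ne hra h1 h3
    by_cases hj : cs.side hra p1 (cs.wall x a) = i
    · exact ⟨_, h1', hj⟩
    · refine ⟨_, h3', ?_⟩
      generalize cs.side hra p1 (cs.wall x a) = p at *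
      generalize cs.side hra p3 (cs.wall x a) = q at *
      clear * - this hj
      decide +revert

/-- A family of half-spaces lies between `U` and `V`, and only central elements commute with
all the reflections bounding them. -/
def Separates (E : Finset (W × B)) (U V : Set W) : Prop :=
  (∀ e ∈ E, U ⊆ cs.halfSpace hra e.1 e.2 ∧ cs.halfSpace hra e.1 e.2 ⊆ V) ∧
    ∀ c : W, (∀ e ∈ E, Commute c (cs.wall e.1 e.2)) → ∀ b, Commute c (cs.simple b)

/-- `U` is deep inside `V`: the walls between them have only the center as common
centralizer. -/
def DeepInside (U V : Set W) : Prop :=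
  U ⊂ V ∧ ∃ E : Finset (W × B), cs.Separates hra E U V

variable {cs hra}

lemma DeepInside.mono {U V U' V' : Set W} (h : cs.DeepInside hra U V) (hU : U' ⊆ U)
    (hV : V ⊆ V') : cs.DeepInside hra U' V' := by
  obtain ⟨h1, E, h2, h3⟩ := h
  exact ⟨(hU.trans_ssubset h1).trans_subset hV, E,
    fun e he => ⟨hU.trans (h2 e he).1, (h2 e he).2.trans hV⟩, h3⟩

lemma DeepInside.smul {U V : Set W} (h : cs.DeepInside hra U V) (g : W) :
    cs.DeepInside hra (g • U) (g • V) := by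
  classical
  obtain ⟨h1, E, h2, h3⟩ := h
  refine ⟨?_, E.image (fun e => (g * e.1, e.2)), ?_, ?_⟩
  · rw [Set.ssubset_iff_subset_ne] at h1 ⊢
    exact ⟨Set.smul_set_mono h1.1, fun e => h1.2 ((MulAction.injective g) e)⟩
  · intro e he
    obtain ⟨e', he', rfl⟩ := Finset.mem_image.mp he
    simp only [← smul_halfSpace]
    exact ⟨Set.smul_set_mono (h2 e' he').1, Set.smul_set_mono (h2 e' he').2⟩
  · intro c hc
    have h4 : ∀ b, Commute (g⁻¹ * c * g) (cs.simple b) := by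
      apply h3
      intro e he
      have h5 := hc _ (Finset.mem_image_of_mem _ he)
      simp only [wall_mul_left] at h5
      have h6 := (h5.map (MulAut.conj g⁻¹).toMonoidHom)
      simp only [MulEquiv.toMonoidHom_eq_coe, MonoidHom.coe_coe, MulAut.conj_apply,
        inv_inv] at h6
      rwa [show g⁻¹ * (g * cs.wall e.1 e.2 * g⁻¹) * g = cs.wall e.1 e.2 by group] at h6
    have h7 := cs.commute_of_forall_simple h4
    have h8 : g⁻¹ * c * g = c := by
      have := (h7 g).eq
      rw [show g * (g⁻¹ * c * g) = c * g by group] at this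
      exact mul_right_cancel this
    rwa [h8] at h4

lemma DeepInside.compl {U V : Set W} (h : cs.DeepInside hra U V) :
    cs.DeepInside hra Vᶜ Uᶜ := by
  classical
  obtain ⟨h1, E, h2, h3⟩ := h
  refine ⟨compl_lt_compl_iff_lt.mpr h1, E.image (fun e => (e.1 * cs.simple e.2, e.2)), ?_, ?_⟩
  · intro e he
    obtain ⟨e', he', rfl⟩ := Finset.mem_image.mp he
    simp only [← compl_halfSpace]
    exact ⟨Set.compl_subset_compl.mpr (h2 e' he').2, Set.compl_subset_compl.mpr (h2 e' he').1⟩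
  · intro c hc
    apply h3
    intro e he
    have h5 := hc _ (Finset.mem_image_of_mem _ he)
    simpa using h5

variable (cs hra)

/-- `p` moves the half-space of `c` into the one of `a`, in such a way that an element commuting
with all walls in between commutes with `p` and with all generators in `J`. -/
def Link (a : B) (p : W) (c : B) (J : Set B) : Prop :=
  cs.halfSpace hra p c ⊆ cs.halfSpace hra 1 a ∧ ∃ E : Finset (W × B),
    (∀ e ∈ E, cs.halfSpace hra p c ⊆ cs.halfSpace hra e.1 e.2 ∧
      cs.halfSpace hra e.1 e.2 ⊆ cs.halfSpace hra 1 a) ∧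
    ∀ g : W, (∀ e ∈ E, Commute g (cs.wall e.1 e.2)) →
      (∀ b ∈ J, Commute g (cs.simple b)) ∧ Commute g p

lemma halfSpace_simple_subset {a b : B} (h : ¬ Commute (cs.simple a) (cs.simple b)) :
    cs.halfSpace hra (cs.simple a) b ⊆ cs.halfSpace hra 1 a := by
  intro y hy
  rw [mem_halfSpace, inv_simple] at hy
  have h1 := cs.side_simple_eq_zero_of_not_commute hra (fun e => h e.symm)
    (g := cs.simple a * y) (by simp [hy])
  rw [side_simple_mul_self] at h1
  rw [mem_halfSpace, inv_one, one_mul]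
  generalize cs.side hra y (cs.simple a) = z at *
  clear * - h1
  decide +revert

lemma link_refl (a : B) : cs.Link hra a 1 a ∅ :=
  ⟨subset_rfl, ∅, by simp, by simp⟩

lemma link_step {a b : B} (h : ¬ Commute (cs.simple a) (cs.simple b)) :
    cs.Link hra a (cs.simple a) b {a} := by
  have h1 := cs.halfSpace_simple_subset hra h
  refine ⟨h1, {(1, a)}, ?_, ?_⟩
  · simpa using h1
  · intro g hg
    simpa using hg

variable {cs hra}

lemma Link.trans {a b c : B} {p q : W} {J K : Set B} (h : cs.Link hra a p b J)
    (h' : cs.Link hra b q c K) : cs.Link hra a (p * q) c (J ∪ K) := by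
  classical
  obtain ⟨h1, E, hE, hc⟩ := h
  obtain ⟨h1', E', hE', hc'⟩ := h'
  have hpq : cs.halfSpace hra (p * q) c ⊆ cs.halfSpace hra p b := by
    have := Set.smul_set_mono (a := p) h1'
    rwa [smul_halfSpace, smul_halfSpace, mul_one] at this
  refine ⟨hpq.trans h1, E ∪ E'.image (fun e => (p * e.1, e.2)), ?_, ?_⟩
  · intro e he
    rcases Finset.mem_union.mp he with he | he
    · exact ⟨hpq.trans (hE e he).1, (hE e he).2⟩
    · obtain ⟨e', he', rfl⟩ := Finset.mem_image.mp he
      have h2 := Set.smul_set_mono (a := p) (hE' e' he').1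
      have h3 := Set.smul_set_mono (a := p) (hE' e' he').2
      rw [smul_halfSpace, smul_halfSpace] at h2 h3
      rw [mul_one] at h3
      exact ⟨h2, h3.trans h1⟩
  · intro g hg
    obtain ⟨hJ, hp⟩ := hc g (fun e he => hg e (Finset.mem_union_left _ he))
    have h4 := hc' g (fun e he => by
      have h5 := hg _ (Finset.mem_union_right _ (Finset.mem_image_of_mem _ he))
      simp only [wall_mul_left] at h5
      have h6 := (hp.inv_right.mul_right h5).mul_right hp
      rwa [show p⁻¹ * (p * cs.wall e.1 e.2 * p⁻¹) * p = cs.wall e.1 e.2 by group] at h6)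
    refine ⟨?_, hp.mul_right h4.2⟩
    rintro b (hb | hb)
    · exact hJ b hb
    · exact h4.1 b hb

lemma Link.mono {a c : B} {p : W} {J K : Set B} (h : cs.Link hra a p c J) (hK : K ⊆ J) :
    cs.Link hra a p c K := by
  obtain ⟨h1, E, hE, hc⟩ := h
  exact ⟨h1, E, hE, fun g hg => ⟨fun b hb => (hc g hg).1 b (hK hb), (hc g hg).2⟩⟩

lemma IsIrreducible.reflTransGen (hirr : cs.IsIrreducible) (a b : B) :
    Relation.ReflTransGen (fun i j => ¬ Commute (cs.simple i) (cs.simple j)) a b := by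
  by_contra hb
  refine hirr ⟨{c | Relation.ReflTransGen
    (fun i j => ¬ Commute (cs.simple i) (cs.simple j)) a c}, ⟨a, .refl⟩, ⟨b, hb⟩, ?_⟩
  intro i hi j hj
  by_contra hij
  exact hj (Relation.ReflTransGen.tail hi hij)

lemma IsIrreducible.exists_link (hirr : cs.IsIrreducible) (a b : B) :
    ∃ p, cs.Link hra a p b ∅ := by
  induction hirr.reflTransGen a b with
  | refl => exact ⟨1, cs.link_refl hra a⟩
  | tail _ h ih =>
    obtain ⟨p, hp⟩ := ih
    exact ⟨_, (hp.trans (cs.link_step hra h)).mono (Set.empty_subset _)⟩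

lemma IsIrreducible.exists_link_univ [Finite B] (hirr : cs.IsIrreducible)
    (hnc : ∀ a, ∃ b, ¬ Commute (cs.simple a) (cs.simple b)) (a : B) :
    ∃ p, cs.Link hra a p a Set.univ := by
  classical
  have key : ∀ J : Set B, J.Finite → ∃ p, cs.Link hra a p a J := by
    intro J hJ
    induction J, hJ using Set.Finite.induction_on with
    | empty => exact ⟨1, cs.link_refl hra a⟩
    | @insert b J _ _ ih =>
      obtain ⟨p, hp⟩ := ih
      obtain ⟨c, hc⟩ := hnc b
      obtain ⟨q, hq⟩ := hirr.exists_link (hra := hra) a b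
      obtain ⟨q', hq'⟩ := hirr.exists_link (hra := hra) c a
      refine ⟨_, (((hq.trans (cs.link_step hra hc)).trans hq').trans hp).mono ?_⟩
      rintro x (rfl | hx)
      · simp
      · simp [hx]
  exact key _ Set.finite_univ

lemma Link.deepInside {a : B} {p : W} (h : cs.Link hra a p a Set.univ)
    (hnc : ∀ a, ∃ b, ¬ Commute (cs.simple a) (cs.simple b)) :
    cs.DeepInside hra (cs.halfSpace hra p a) (cs.halfSpace hra 1 a) := by
  obtain ⟨h1, E, hE, hc⟩ := h
  refine ⟨Set.ssubset_iff_subset_ne.mpr ⟨h1, fun heq => ?_⟩, E, hE,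
    fun g hg b => (hc g hg).1 b (Set.mem_univ b)⟩
  obtain ⟨b, hb⟩ := hnc a
  apply hb
  refine (hc _ fun e he => ?_).1 b (Set.mem_univ b)
  have h2 := cs.wall_eq_of_halfSpace_eq hra
    (((hE e he).2.antisymm (heq ▸ (hE e he).1)))
  rw [h2, wall_one]

lemma DeepInside.not_crosses {x y z : W} {a b c : B}
    (h : cs.DeepInside hra (cs.halfSpace hra x a) (cs.halfSpace hra y b))
    (hnc : ∀ a, ∃ b, ¬ Commute (cs.simple a) (cs.simple b)) :
    ¬ cs.Crosses hra (cs.wall z c) (cs.wall x a) ∨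
      ¬ cs.Crosses hra (cs.wall z c) (cs.wall y b) := by
  by_contra hcon
  simp only [not_or, not_not] at hcon
  rw [crosses_wall_iff, crosses_wall_iff] at hcon
  obtain ⟨-, E, hE, hcen⟩ := h
  have hcomm : ∀ e ∈ E, Commute (cs.wall z c) (cs.wall e.1 e.2) := by
    intro e he
    apply cs.commute_of_crosses hra
    rw [crosses_wall_iff]
    intro i
    obtain ⟨w, hw, hw'⟩ := (hcon.1 i).1
    obtain ⟨v, hv, hv'⟩ := (hcon.2 i).2
    exact ⟨⟨w, (hE e he).1 hw, hw'⟩, ⟨v, fun hh => hv ((hE e he).2 hh), hv'⟩⟩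
  have h1 := cs.commute_of_forall_simple (hcen _ hcomm)
  obtain ⟨d, hd⟩ := hnc c
  apply hd
  have h2 : cs.wall z c = cs.simple c := by
    have := (h1 z).eq
    rw [wall, inv_mul_cancel_right] at this
    rw [wall]
    exact (mul_left_cancel this).symm
  rw [← h2]
  exact h1 _

end CoxeterSystem

namespace CoxeterSystem

variable {B : Type*} {W : Type*} [Group W] {M : CoxeterMatrix B} (cs : CoxeterSystem M W)
  (hra : M.IsRightAngled)

lemma finite_setOf_forall_commute (hra : M.IsRightAngled) [Finite B] :
    {c : W | ∀ b, Commute c (cs.simple b)}.Finite := by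
  refine Set.Finite.of_finite_image (f := fun c b => cs.side hra c (cs.simple b))
    (Set.toFinite _) ?_
  intro c hc d hd hcd
  by_contra hne
  obtain ⟨i, hi⟩ := cs.exists_side_simple_eq_one hra (g := c⁻¹ * d)
    (fun h => hne (inv_mul_eq_one.mp h))
  have h1 := (hc i).eq
  have h2 : cs.side hra c (cs.simple i) = cs.side hra d (cs.simple i) := congrFun hcd i
  rw [side_mul, inv_inv, side_inv, h1, mul_inv_cancel_right, h2, CharTwo.add_self_eq_zero] at hi
  exact zero_ne_one hi

lemma exists_notMem_of_strictAnti (f : ℕ → W × B)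
    (hf : StrictAnti fun n => cs.halfSpace hra (f n).1 (f n).2) (z : W) :
    ∃ n, z ∉ cs.halfSpace hra (f n).1 (f n).2 := by
  by_contra! hz
  have hinj : Function.Injective fun n => cs.wall (f n).1 (f n).2 := fun m n hmn =>
    hf.injective (cs.halfSpace_eq_of_wall_eq hra hmn (hz m) (hz n))
  refine Set.infinite_of_injective_forall_mem hinj (fun n => ?_)
    (cs.finite_side_ne hra z (f 0).1)
  exact cs.side_wall_ne hra (hz n)
    (fun h => cs.notMem_halfSpace_self hra _ _ (hf.antitone (Nat.zero_le n) h))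

lemma smul_set_ssubset {U V : Set W} (h : U ⊂ V) (g : W) : g • U ⊂ g • V := by
  rw [Set.ssubset_iff_subset_ne] at *
  exact ⟨Set.smul_set_mono h.1, fun e => h.2 ((MulAction.injective g) e)⟩

lemma strictAnti_pow_smul {g : W} {A : Set W} (h : g • A ⊂ A) :
    StrictAnti fun n : ℕ => g ^ n • A := by
  refine strictAnti_nat_of_succ_lt fun n => ?_
  simp only [pow_succ, mul_smul]
  exact smul_set_ssubset h _

lemma exists_zpow_smul_halfSpace {g x : W} {b : B}
    (h : g • cs.halfSpace hra x b ⊂ cs.halfSpace hra x b) (z : W) :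
    ∃ n : ℤ, z ∈ g ^ n • cs.halfSpace hra x b ∧ z ∉ g ^ (n + 1) • cs.halfSpace hra x b := by
  obtain ⟨m, hm⟩ := cs.exists_notMem_of_strictAnti hra (fun n => (g ^ n * x, b))
    (by simpa only [← smul_halfSpace] using strictAnti_pow_smul h) z
  have hc : ∀ n : ℕ, cs.halfSpace hra (g⁻¹ ^ n * x * cs.simple b) b =
      (g⁻¹ ^ n • cs.halfSpace hra x b)ᶜ := fun n => by
    rw [smul_halfSpace, compl_halfSpace]
  obtain ⟨k, hk⟩ := cs.exists_notMem_of_strictAnti hra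
    (fun n => (g⁻¹ ^ n * x * cs.simple b, b))
    (by
      simp only [hc]
      refine strictAnti_nat_of_succ_lt fun n => compl_lt_compl_iff_lt.mpr ?_
      have := smul_set_ssubset h (g⁻¹ ^ (n + 1))
      rw [pow_succ] at this ⊢
      rwa [mul_smul, inv_smul_smul] at this) z
  simp only [hc, Set.mem_compl_iff, not_not] at hk
  simp only [← smul_halfSpace] at hm
  have hanti : ∀ i : ℤ, ∀ n : ℕ, g ^ (i + n) • cs.halfSpace hra x b ⊆
      g ^ i • cs.halfSpace hra x b := by
    intro i n
    rw [zpow_add, zpow_natCast, mul_smul]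
    refine Set.smul_set_mono ?_
    simpa using (strictAnti_pow_smul h).antitone (Nat.zero_le n)
  obtain ⟨n, hn, hmax⟩ := Int.exists_greatest_of_bdd
    (P := fun n : ℤ => z ∈ g ^ n • cs.halfSpace hra x b)
    ⟨m, fun i hi => by
      by_contra! hlt
      obtain ⟨j, rfl⟩ := Int.le.dest hlt.le
      have := hanti _ _ hi
      rw [zpow_natCast] at this
      exact hm this⟩
    ⟨-k, by simpa using hk⟩
  exact ⟨n, hn, fun h' => by have := hmax _ h'; omega⟩

end CoxeterSystem

lemma Subgroup.finiteIndex_of_forall_exists_mul_mem {G : Type*} [Group G] (K : Subgroup G)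
    {R : Set G} (hR : R.Finite) (h : ∀ c, ∃ k ∈ K, k * c ∈ R) : K.FiniteIndex := by
  have := hR.to_subtype
  have hs : Function.Surjective fun r : R => (((r : G)⁻¹ : G) : G ⧸ K) := by
    intro q
    induction q using QuotientGroup.induction_on with
    | H c =>
      obtain ⟨k, hk, hkc⟩ := h c⁻¹
      refine ⟨⟨_, hkc⟩, ?_⟩
      simp only [mul_inv_rev, inv_inv]
      exact QuotientGroup.mk_mul_of_mem _ (K.inv_mem hk)
  have := Finite.of_surjective _ hs
  exact K.finiteIndex_of_finite_quotient

lemma Subgroup.nonempty_zpowers_mulEquiv {G : Type*} [Group G] {g : G} (h : ¬ IsOfFinOrder g) :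
    Nonempty (Subgroup.zpowers g ≃* Multiplicative ℤ) := by
  have hinj : Function.Injective (zpowersHom G g) := injective_zpow_iff_not_isOfFinOrder.mpr h
  exact ⟨(MonoidHom.ofInjective hinj).symm⟩

namespace CoxeterSystem

variable {B : Type*} {W : Type*} [Group W] {M : CoxeterMatrix B} (cs : CoxeterSystem M W)
  (hra : M.IsRightAngled)

variable {cs hra}

lemma DeepInside.not_isOfFinOrder {g : W} {A : Set W} (h : cs.DeepInside hra (g • A) A) :
    ¬ IsOfFinOrder g := by
  rw [isOfFinOrder_iff_pow_eq_one]
  rintro ⟨n, hn, hg⟩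
  have := strictAnti_pow_smul h.1 hn
  simp [hg] at this

lemma DeepInside.finite_setOf_commute [Finite B] {g x : W} {b : B}
    (h : cs.DeepInside hra (g • cs.halfSpace hra x b) (cs.halfSpace hra x b)) :
    {c : W | Commute c g ∧ 1 ∈ c • cs.halfSpace hra x b ∧
      1 ∉ (g * c) • cs.halfSpace hra x b}.Finite := by
  obtain ⟨-, E, hE, hcen⟩ := h
  refine Set.Finite.of_finite_fibers (fun c (e : E) => cs.wall (c * e.1.1) e.1.2) ?_ ?_
  · refine (Set.Finite.pi' (t := fun _ => {t | cs.side hra g t ≠ cs.side hra g⁻¹ t})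
      fun _ => cs.finite_side_ne hra g g⁻¹).subset ?_
    rintro _ ⟨c, ⟨hc, h1, h2⟩, rfl⟩ e
    refine cs.side_wall_ne hra ?_ ?_
    · rw [← smul_halfSpace]
      refine Set.smul_set_mono (hE _ e.2).1 ?_
      rw [← mul_smul, hc.eq, mul_smul, Set.mem_smul_set_iff_inv_smul_mem, smul_eq_mul,
        inv_mul_cancel]
      exact h1
    · rw [← smul_halfSpace]
      refine fun hh => h2 ?_
      rw [mul_smul, Set.mem_smul_set_iff_inv_smul_mem, smul_eq_mul, mul_one]
      exact Set.smul_set_mono (hE _ e.2).2 hh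
  · rintro _ ⟨d, -, rfl⟩
    refine ((cs.finite_setOf_forall_commute hra).image (d * ·)).subset ?_
    rintro c ⟨-, hc⟩
    refine ⟨d⁻¹ * c, hcen _ fun e he => ?_, mul_inv_cancel_left _ _⟩
    have h3 := congrFun hc ⟨e, he⟩
    simp only [wall_mul_left] at h3
    rw [commute_iff_eq, mul_assoc, mul_inv_eq_iff_eq_mul.mp h3]
    group

lemma DeepInside.mem_algA [Finite B] {H : Subgroup W} {g : H} {x : W} {b : B}
    (h : cs.DeepInside hra ((g : W) • cs.halfSpace hra x b) (cs.halfSpace hra x b)) :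
    g ∈ algA H 1 := by
  have hg : g ∈ Subgroup.centralizer ({g} : Set H) := by
    simp [Subgroup.mem_centralizer_singleton_iff]
  refine ⟨Subgroup.zpowers ⟨g, hg⟩, ?_, 1, le_rfl, ?_⟩
  · refine Subgroup.finiteIndex_of_forall_exists_mul_mem _
      (R := (fun c => ((c : H) : W)) ⁻¹' {c : W | Commute c g ∧
        1 ∈ c • cs.halfSpace hra x b ∧ 1 ∉ ((g : W) * c) • cs.halfSpace hra x b})
      (h.finite_setOf_commute.preimage
        (Subtype.val_injective.comp Subtype.val_injective).injOn) ?_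
    rintro ⟨c, hc⟩
    have hcomm : Commute (c : W) g := by
      have := Subgroup.mem_centralizer_singleton_iff.mp hc
      exact congrArg Subtype.val this
    have hss : (g : W) • cs.halfSpace hra ((c : W) * x) b ⊂ cs.halfSpace hra ((c : W) * x) b := by
      rw [← smul_halfSpace, ← mul_smul, ← hcomm.eq, mul_smul]
      exact smul_set_ssubset h.1 _
    obtain ⟨n, hn, hn'⟩ := cs.exists_zpow_smul_halfSpace hra hss 1
    refine ⟨_, ⟨n, rfl⟩, ?_⟩
    simp only [Set.mem_preimage, Set.mem_ofPred_eq, Subgroup.coe_mul, Subgroup.coe_zpow]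
    rw [← smul_halfSpace, ← mul_smul] at hn hn'
    refine ⟨((Commute.refl (g : W)).zpow_left n).mul_left hcomm, hn, ?_⟩
    rwa [← mul_assoc, ← zpow_one_add, add_comm]
  · have hfin : ¬ IsOfFinOrder (⟨g, hg⟩ : Subgroup.centralizer ({g} : Set H)) := by
      intro hf
      apply h.not_isOfFinOrder
      exact ((Submonoid.isOfFinOrder_coe).mpr ((Submonoid.isOfFinOrder_coe).mpr hf))
    obtain ⟨e⟩ := Subgroup.nonempty_zpowers_mulEquiv hfin
    exact ⟨e.trans (AddEquiv.toMultiplicative (AddEquiv.funUnique (Fin 1) ℤ).symm)⟩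

end CoxeterSystem

namespace CoxeterSystem

variable {B : Type*} {W : Type*} [Group W] {M : CoxeterMatrix B} (cs : CoxeterSystem M W)
  (hra : M.IsRightAngled)

lemma pow_smul_halfSpace_subset_compl {a b s : B} (ha : ¬ Commute (cs.simple s) (cs.simple a))
    (hb : ¬ Commute (cs.simple s) (cs.simple b)) (hab : a ≠ b) (n : ℕ) :
    (cs.simple a * cs.simple s * cs.simple b) ^ (n + 1) • cs.halfSpace hra 1 s ⊆
      (cs.halfSpace hra 1 s)ᶜ := by
  have hmem : ∀ z c, z ∈ cs.halfSpace hra 1 c ↔ cs.side hra z (cs.simple c) = 1 := by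
    simp [mem_halfSpace]
  have hflip : ∀ z c, cs.side hra z (cs.simple c) = 0 →
      cs.side hra (cs.simple c * z) (cs.simple c) = 1 := by
    intro z c h
    rw [side_simple_mul_self, h, zero_add]
  have hz : ∀ {z : W} {c d : B}, ¬ Commute (cs.simple c) (cs.simple d) →
      cs.side hra z (cs.simple c) = 1 → cs.side hra z (cs.simple d) = 0 := fun h h1 =>
    cs.side_simple_eq_zero_of_not_commute hra h (by simp [h1])
  have hstep : ∀ z, cs.side hra z (cs.simple s) = 1 →
      cs.side hra (cs.simple s * (cs.simple b * (cs.simple a * z))) (cs.simple s) = 1 := by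
    intro z h
    refine hflip _ _ (hz (fun e => hb e.symm) (hflip _ _ ?_))
    by_cases hc : Commute (cs.simple a) (cs.simple b)
    · have hne : cs.simple b ≠ cs.simple a := fun e =>
        hab (cs.simple_injective_of_isRightAngled hra e).symm
      rw [side_simple_mul _ _ _ _ _ hne, hc.eq, mul_assoc, simple_mul_simple_self, mul_one]
      exact hz hb h
    · exact hz hc (hflip _ _ (hz ha h))
  have key : ∀ z, cs.side hra z (cs.simple s) = 1 →
      ∃ y, (cs.simple a * cs.simple s * cs.simple b) ^ (n + 1) * z = cs.simple a * y ∧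
        cs.side hra y (cs.simple s) = 1 := by
    intro z h
    induction n with
    | zero =>
      refine ⟨cs.simple s * (cs.simple b * z), by simp [mul_assoc], ?_⟩
      exact hflip _ _ (hz (fun e => hb e.symm) (hflip _ _ (hz hb h)))
    | succ n ih =>
      obtain ⟨y, h1, h2⟩ := ih
      refine ⟨_, ?_, hstep y h2⟩
      rw [pow_succ', mul_assoc, h1]
      simp [mul_assoc]
  rintro _ ⟨z, h, rfl⟩
  obtain ⟨y, h1, h2⟩ := key z ((hmem _ _).mp h)
  simp only [smul_eq_mul, h1, Set.mem_compl_iff, hmem]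
  rw [hz (fun e => ha e.symm) (hflip _ _ (hz ha h2))]
  exact zero_ne_one

variable {cs hra}

lemma DeepInside.exists_subset_compl {s : B} {p : W}
    (h : cs.DeepInside hra (cs.halfSpace hra p s) (cs.halfSpace hra 1 s))
    (hnc : ∀ a, ∃ b, ¬ Commute (cs.simple a) (cs.simple b)) (w : W) :
    (w • cs.halfSpace hra p s ⊆ cs.halfSpace hra 1 s ∨
      w • cs.halfSpace hra p s ⊆ (cs.halfSpace hra p s)ᶜ) ∨
    (w • (cs.halfSpace hra 1 s)ᶜ ⊆ cs.halfSpace hra 1 s ∨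
      w • (cs.halfSpace hra 1 s)ᶜ ⊆ (cs.halfSpace hra p s)ᶜ) := by
  have hX : cs.halfSpace hra p s ⊆ cs.halfSpace hra 1 s := h.1.subset
  have hX' := Set.compl_subset_compl.mpr hX
  have hw : w • (cs.halfSpace hra 1 s)ᶜ ⊆ (cs.halfSpace hra (w * p) s)ᶜ := by
    rw [← smul_halfSpace, ← Set.smul_set_compl]
    exact Set.smul_set_mono hX'
  rw [smul_halfSpace]
  rcases h.not_crosses (z := w * p) (c := s) hnc with h | h
  · rcases cs.nested_of_not_crosses hra h with h | h | h | h
    · exact .inl (.inl (h.trans hX))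
    · exact .inl (.inr h)
    · exact .inr (.inl ((hw.trans h).trans hX))
    · exact .inr (.inr (hw.trans h))
  · rcases cs.nested_of_not_crosses hra h with h | h | h | h
    · exact .inl (.inl h)
    · exact .inl (.inr (h.trans hX'))
    · exact .inr (.inl (hw.trans h))
    · exact .inr (.inr ((hw.trans h).trans hX'))

lemma DeepInside.exists_finset {s : B} {p q : W}
    (h : cs.DeepInside hra (cs.halfSpace hra p s) (cs.halfSpace hra 1 s))
    (hq : ∀ n : ℕ, q ^ (n + 1) • cs.halfSpace hra 1 s ⊆ (cs.halfSpace hra 1 s)ᶜ)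
    (hnc : ∀ a, ∃ b, ¬ Commute (cs.simple a) (cs.simple b)) (K : Subgroup W) [K.Normal]
    [K.FiniteIndex] :
    ∃ F : Finset W, (∀ f ∈ F, f ∈ K) ∧ ∀ w, ∃ f ∈ F, ∃ x b,
      cs.DeepInside hra ((f * w) • cs.halfSpace hra x b) (cs.halfSpace hra x b) := by
  classical
  obtain ⟨m, hm⟩ : ∃ m, K.index = m + 1 :=
    Nat.exists_eq_succ_of_ne_zero Subgroup.FiniteIndex.index_ne_zero
  have hK : ∀ g : W, g ^ (m + 1 + (m + 1)) ∈ K := fun g => by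
    rw [pow_add, ← hm]
    exact K.mul_mem (K.pow_index_mem g) (K.pow_index_mem g)
  set n := m + m with hn
  rw [show m + 1 + (m + 1) = n + 2 by omega] at hK
  have hP : cs.halfSpace hra (cs.simple s) s = (cs.halfSpace hra 1 s)ᶜ := by
    rw [compl_halfSpace, one_mul]
  have hsN : cs.simple s • cs.halfSpace hra 1 s = (cs.halfSpace hra 1 s)ᶜ := by
    rw [smul_halfSpace, mul_one, hP]
  have hsP : cs.simple s • (cs.halfSpace hra 1 s)ᶜ = cs.halfSpace hra 1 s := by
    rw [← hP, smul_halfSpace, simple_mul_simple_self]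
  have hsep := h.exists_subset_compl hnc
  have hpN : cs.halfSpace hra p s = p • cs.halfSpace hra 1 s := by rw [smul_halfSpace, mul_one]
  rw [hpN] at h hsep
  have hHS : ∃ x b, cs.halfSpace hra x b = cs.halfSpace hra 1 s := ⟨_, _, rfl⟩
  have hanti : ∀ k : ℕ, p ^ k • cs.halfSpace hra 1 s ⊆ cs.halfSpace hra 1 s := fun k => by
    simpa using (strictAnti_pow_smul h.1).antitone (Nat.zero_le k)
  have hmono : ∀ k : ℕ, (p ^ k)⁻¹ • (cs.halfSpace hra 1 s)ᶜ ⊆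
      (cs.halfSpace hra 1 s)ᶜ := fun k => by
    rw [Set.smul_set_subset_iff_subset_inv_smul_set, inv_inv, Set.smul_set_compl]
    exact Set.compl_subset_compl.mpr (hanti k)
  have hX : ∃ x b, cs.halfSpace hra x b = p • cs.halfSpace hra 1 s := ⟨_, _, hpN⟩
  have hY : ∃ x b, cs.halfSpace hra x b = (cs.halfSpace hra 1 s)ᶜ := ⟨_, _, hP⟩
  clear_value n
  generalize cs.halfSpace hra 1 s = N at *
  have hdX : cs.DeepInside hra (p ^ (n + 2) • N) (p • N) := by
    refine (h.smul p).mono ?_ subset_rfl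
    rw [add_comm, pow_add, mul_smul, pow_two, mul_smul]
    exact Set.smul_set_mono (Set.smul_set_mono (hanti n))
  have hdY : cs.DeepInside hra ((p ^ (n + 1))⁻¹ • Nᶜ) Nᶜ := by
    refine (h.compl.smul p⁻¹).mono ?_ ?_
    · rw [pow_succ, mul_inv_rev, mul_smul]
      exact Set.smul_set_mono (hmono n)
    · rw [← Set.smul_set_compl, inv_smul_smul]
  have hdY' : cs.DeepInside hra ((p ^ (n + 2))⁻¹ • Nᶜ) Nᶜ := by
    refine hdY.mono ?_ subset_rfl
    rw [pow_succ', mul_inv_rev, mul_smul]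
    exact Set.smul_set_mono (by simpa using hmono 1)
  have hcomp : (p ^ (n + 2))⁻¹ • (p • N)ᶜ = (p ^ (n + 1))⁻¹ • Nᶜ := by
    rw [← Set.smul_set_compl, ← mul_smul, pow_succ', mul_inv_rev, inv_mul_cancel_right]
  have final : ∀ {f w : W} {U A : Set W}, (∃ x b, cs.halfSpace hra x b = A) →
      w • A ⊆ U → cs.DeepInside hra (f • U) A → ∃ x b,
      cs.DeepInside hra ((f * w) • cs.halfSpace hra x b) (cs.halfSpace hra x b) := by
    rintro f w U _ ⟨x, b, rfl⟩ h1 h2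
    refine ⟨x, b, h2.mono ?_ subset_rfl⟩
    rw [mul_smul]
    exact Set.smul_set_mono h1
  refine ⟨{p ^ (n + 2), p ^ (n + 2) * (cs.simple s * q ^ (n + 2) * (cs.simple s)⁻¹) *
    (p ^ (n + 2))⁻¹, (p ^ (n + 2))⁻¹ * q ^ (n + 2) * p ^ (n + 2), (p ^ (n + 2))⁻¹}, ?_, ?_⟩
  · have h1 := hK p
    have h2 := hK q
    have h3 := Subgroup.Normal.conj_mem ‹_› _ h2 (cs.simple s)
    simp only [Finset.mem_insert, Finset.mem_singleton]
    rintro f (rfl | rfl | rfl | rfl)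
    · exact h1
    · exact K.mul_mem (K.mul_mem h1 h3) (K.inv_mem h1)
    · exact K.mul_mem (K.mul_mem (K.inv_mem h1) h2) h1
    · exact K.inv_mem h1
  · intro w
    rcases hsep w with (hw | hw) | (hw | hw)
    · exact ⟨p ^ (n + 2), by simp, final hX hw hdX⟩
    · refine ⟨p ^ (n + 2) * (cs.simple s * q ^ (n + 2) * (cs.simple s)⁻¹) * (p ^ (n + 2))⁻¹,
        by simp, final hX hw (hdX.mono ?_ subset_rfl)⟩
      rw [inv_simple]
      simp only [mul_smul, hcomp]
      refine Set.smul_set_mono ?_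
      have h1 : cs.simple s • (p ^ (n + 1))⁻¹ • Nᶜ ⊆ N := by
        conv_rhs => rw [← hsP]
        exact Set.smul_set_mono (hmono _)
      have h2 : q ^ (n + 2) • cs.simple s • (p ^ (n + 1))⁻¹ • Nᶜ ⊆ Nᶜ :=
        (Set.smul_set_mono h1).trans (hq _)
      conv_rhs => rw [← hsP]
      exact Set.smul_set_mono h2
    · refine ⟨(p ^ (n + 2))⁻¹ * q ^ (n + 2) * p ^ (n + 2), by simp,
        final hY hw (hdY'.mono ?_ subset_rfl)⟩
      simp only [mul_smul]
      exact Set.smul_set_mono ((Set.smul_set_mono (hanti _)).trans (hq _))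
    · exact ⟨(p ^ (n + 2))⁻¹, by simp, final hY hw (hcomp ▸ hdY)⟩

theorem IsIrreducible.algCovers_one_s15 [Finite B] (hirr : cs.IsIrreducible)
    (hra : M.IsRightAngled) (hnc : ∀ a, ∃ b, ¬ Commute (cs.simple a) (cs.simple b))
    {a b s : B} (ha : ¬ Commute (cs.simple s) (cs.simple a))
    (hb : ¬ Commute (cs.simple s) (cs.simple b)) (hab : a ≠ b) (H : Subgroup W)
    [H.FiniteIndex] : algCovers H 1 := by
  classical
  obtain ⟨p, hp⟩ := hirr.exists_link_univ (hra := hra) hnc s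
  obtain ⟨F, hF, hw⟩ := (hp.deepInside hnc).exists_finset
    (cs.pow_smul_halfSpace_subset_compl hra ha hb hab) hnc H.normalCore
  refine ⟨F.attach.image fun f : F => (⟨f, H.normalCore_le (hF f f.2)⟩ : H)⁻¹, ?_⟩
  refine Set.eq_univ_of_forall fun w => ?_
  obtain ⟨f, hf, x, b, h⟩ := hw w
  simp only [Set.mem_iUnion]
  refine ⟨_, Finset.mem_image_of_mem _ (Finset.mem_attach _ ⟨f, hf⟩), ?_⟩
  rw [Set.mem_smul_set_iff_inv_smul_mem, inv_inv]
  exact DeepInside.mem_algA h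

end CoxeterSystem

lemma isOfFinOrder_of_mem_algA_zero {G : Type*} [Group G] {g : G} (h : g ∈ algA G 0) :
    IsOfFinOrder g := by
  obtain ⟨K, hK, n, hn, ⟨e⟩⟩ := h
  obtain rfl := Nat.le_zero.mp hn
  have hg : g ∈ Subgroup.centralizer ({g} : Set G) := by
    simp [Subgroup.mem_centralizer_singleton_iff]
  obtain ⟨m, hm, -, hmem⟩ := K.exists_pow_mem_of_index_ne_zero hK.index_ne_zero ⟨g, hg⟩
  have h1 : (⟨_, hmem⟩ : K) = 1 := e.injective (Subsingleton.elim (α := Fin 0 → ℤ) _ _)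
  rw [isOfFinOrder_iff_pow_eq_one]
  exact ⟨m, hm, by simpa [Subtype.ext_iff] using h1⟩

namespace CoxeterSystem

variable {B : Type*} {W : Type*} [Group W] {M : CoxeterMatrix B} (cs : CoxeterSystem M W)

lemma exists_not_algCovers_zero (hra : M.IsRightAngled) {a b : B}
    (hab : ¬ Commute (cs.simple a) (cs.simple b)) :
    ∃ H : Subgroup W, H.FiniteIndex ∧ ¬ algCovers H 0 := by
  have hM : M a b = 0 := by
    by_contra h
    exact hab (cs.commute_of_isRightAngled_of_ne_zero hra h)
  obtain ⟨φ, ha, hb, hi⟩ := cs.exists_hom_perm_int hra hM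
  set H : Subgroup W := (Subgroup.centralizer {Equiv.addRight (1 : ℤ)}).comap φ with hH
  have hmem : ∀ g, g ∈ H ↔ ∀ x, φ g (x + 1) = φ g x + 1 := by
    intro g
    rw [hH, Subgroup.mem_comap, Subgroup.mem_centralizer_singleton_iff, Equiv.ext_iff]
    rfl
  have hadd : ∀ g ∈ H, ∀ x, φ g x = φ g 0 + x := by
    intro g hg x
    induction x using Int.induction_on with
    | zero => simp
    | succ i ih => rw [(hmem g).mp hg, ih, add_assoc]
    | pred i ih =>
      have := (hmem g).mp hg (-i - 1)
      rw [sub_add_cancel, ih] at this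
      omega
  have hdihedral : ∀ g, ∃ c, φ g = Equiv.addRight c ∨ φ g = Equiv.subLeft c := by
    intro g
    induction g using cs.simple_induction_left with
    | one => exact ⟨0, .inl (by ext; simp)⟩
    | mul_simple_left g i ih =>
      have hs : ∃ d, φ (cs.simple i) = 1 ∨ φ (cs.simple i) = Equiv.subLeft d := by
        by_cases h1 : i = a
        · exact ⟨0, .inr (h1 ▸ ha)⟩
        · by_cases h2 : i = b
          · exact ⟨1, .inr (h2 ▸ hb)⟩
          · exact ⟨0, .inl (hi i h1 h2)⟩
      obtain ⟨c, hc⟩ := ih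
      obtain ⟨d, hd | hd⟩ := hs
      · exact ⟨c, by rwa [map_mul, hd, one_mul]⟩
      · refine ⟨d - c, ?_⟩
        rw [map_mul, hd]
        rcases hc with hc | hc
        · right
          ext x
          simp [hc]
          ring
        · left
          ext x
          simp [hc]
          ring
  refine ⟨H, ?_, ?_⟩
  · refine H.finiteIndex_of_forall_exists_mul_mem (R := {1, cs.simple a}) (Set.toFinite _) ?_
    intro g
    obtain ⟨c, hc⟩ := hdihedral g⁻¹
    rcases hc with hc | hc
    · refine ⟨g⁻¹, ?_, by simp⟩
      rw [hmem, hc]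
      intro x
      simp
      ring
    · refine ⟨cs.simple a * g⁻¹, ?_, by simp⟩
      rw [hmem, map_mul, hc, ha]
      intro x
      simp
      ring
  · rintro ⟨F, hF⟩
    have hfin : (Set.range fun w : H => φ w 0).Finite := by
      refine (F.finite_toSet.image fun w : H => φ w 0).subset ?_
      rintro _ ⟨w, rfl⟩
      have hw := hF.ge (Set.mem_univ w)
      simp only [Set.mem_iUnion] at hw
      obtain ⟨f, hf, k, hk, rfl⟩ := hw
      refine ⟨f, hf, ?_⟩
      obtain ⟨n, hn, hkn⟩ := isOfFinOrder_iff_pow_eq_one.mp (isOfFinOrder_of_mem_algA_zero hk)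
      have hpow : ∀ n : ℕ, φ ((k : W) ^ n) 0 = n * φ k 0 := by
        intro n
        induction n with
        | zero => simp
        | succ n ih =>
          rw [pow_succ', map_mul, Equiv.Perm.mul_apply, ih, hadd _ k.2]
          push_cast
          ring
      have h0 := hpow n
      rw [← Subgroup.coe_pow, hkn] at h0
      have hk0 : φ k 0 = 0 := by
        simp at h0
        omega
      simp [hk0]
    have ht : ∀ n : ℕ, ∀ x, φ ((cs.simple b * cs.simple a) ^ n) x = n + x := by
      intro n
      induction n with
      | zero => simp
      | succ n ih =>
        intro x
        rw [pow_succ', map_mul, Equiv.Perm.mul_apply, ih, map_mul, ha, hb]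
        simp
        ring
    refine Set.infinite_of_injective_forall_mem (f := fun n : ℕ => (n : ℤ)) Nat.cast_injective
      (fun n => ?_) hfin
    refine ⟨⟨(cs.simple b * cs.simple a) ^ n, ?_⟩, (ht n 0).trans (add_zero _)⟩
    rw [hmem]
    intro x
    rw [ht, ht, add_assoc]

variable {cs}

lemma finiteIndex_zpowers {s a : B} (h : ∀ c, c = s ∨ c = a) :
    (Subgroup.zpowers (cs.simple s * cs.simple a)).FiniteIndex := by
  set K := Subgroup.zpowers (cs.simple s * cs.simple a)
  have hm : cs.simple s * cs.simple a ∈ K := Subgroup.mem_zpowers _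
  have key : ∀ w, w ∈ K ∨ cs.simple s * w ∈ K := by
    intro w
    induction w using cs.simple_induction_left with
    | one => exact .inl K.one_mem
    | mul_simple_left w i ih =>
      rcases h i with rfl | rfl
      · rw [simple_mul_simple_cancel_left]
        exact ih.symm
      · rcases ih with ih | ih
        · exact .inr (by simpa [mul_assoc] using K.mul_mem hm ih)
        · exact .inl (by simpa [mul_assoc] using K.mul_mem (K.inv_mem hm) ih)
  refine K.finiteIndex_of_forall_exists_mul_mem (R := {1, cs.simple s}) (Set.toFinite _) ?_
  intro w
  rcases key w⁻¹ with h | h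
  · exact ⟨_, h, by simp⟩
  · exact ⟨_, h, by simp⟩

lemma not_isOfFinOrder_of_forall_eq [Infinite W] {s a : B} (h : ∀ c, c = s ∨ c = a) :
    ¬ IsOfFinOrder (cs.simple s * cs.simple a) := by
  intro hf
  have := finiteIndex_zpowers (cs := cs) h
  have : Finite (Subgroup.zpowers (cs.simple s * cs.simple a)) := finite_zpowers.mpr hf
  exact not_finite_iff_infinite.mpr ‹_› (Finite.of_subgroup_quotient
    (Subgroup.zpowers (cs.simple s * cs.simple a)))

lemma IsIrreducible.exists_not_commute [Infinite W] (hirr : cs.IsIrreducible) (a : B) :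
    ∃ b, ¬ Commute (cs.simple a) (cs.simple b) := by
  by_contra! h
  have hall : ∀ c, c = a := by
    intro c
    induction hirr.reflTransGen a c with
    | refl => rfl
    | tail _ h1 ih => exact absurd (ih ▸ h _) h1
  refine not_isOfFinOrder_of_forall_eq (cs := cs) (fun c => .inl (hall c)) (s := a) (a := a) ?_
  simp

lemma IsIrreducible.exists_ne_not_commute [Infinite W] (hirr : cs.IsIrreducible)
    (hnaff : ¬ IsVirtuallyFreeAbelian W) :
    ∃ a b s, a ≠ b ∧ ¬ Commute (cs.simple s) (cs.simple a) ∧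
      ¬ Commute (cs.simple s) (cs.simple b) := by
  by_contra! h
  have hB : Nonempty B := by
    by_contra hB
    rw [not_nonempty_iff] at hB
    have h1 : ∀ w : W, w = 1 := fun w => by
      induction w using cs.simple_induction_left with
      | one => rfl
      | mul_simple_left w i => exact isEmptyElim i
    obtain ⟨w, hw⟩ := exists_ne (1 : W)
    exact hw (h1 w)
  obtain ⟨s⟩ := hB
  obtain ⟨a, ha⟩ := hirr.exists_not_commute s
  have hall : ∀ c, c = s ∨ c = a := by
    intro c
    induction hirr.reflTransGen s c with
    | refl => exact .inl rfl
    | @tail x y _ h1 ih =>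
      rcases ih with rfl | rfl
      · right
        by_contra hne
        exact ha (h y a x hne h1)
      · left
        by_contra hne
        exact ha (h y s x hne h1).symm
  obtain ⟨e⟩ := Subgroup.nonempty_zpowers_mulEquiv
    (not_isOfFinOrder_of_forall_eq (cs := cs) hall)
  exact hnaff ⟨_, finiteIndex_zpowers hall, Unit,
    ⟨e.trans (AddEquiv.toMultiplicative (Finsupp.uniqueAddEquiv ()).symm)⟩⟩

end CoxeterSystem

/-- Any infinite, irreducible, non-affine right-angled Coxeter group has algebraic
rank `1`. -/
theorem stmt_15 {B W : Type*} [Fintype B] [Group W] {M : CoxeterMatrix B}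
    (cs : CoxeterSystem M W) (hra : M.IsRightAngled) [Infinite W]
    (hirr : cs.IsIrreducible) (hnaff : ¬ IsVirtuallyFreeAbelian W) :
    algRank W = 1 := by
  obtain ⟨a, b, s, hab, ha, hb⟩ := hirr.exists_ne_not_commute hnaff
  refine le_antisymm (iSup₂_le fun H hH => sInf_le ⟨1, rfl, ?_⟩) ?_
  · exact hirr.algCovers_one_s15 hra hirr.exists_not_commute ha hb hab H
  · obtain ⟨H, hH, hcov⟩ := cs.exists_not_algCovers_zero hra ha
    refine le_trans (le_sInf ?_)
      (le_iSup₂ (f := fun (H : Subgroup W) (_ : H.FiniteIndex) => algr H) H hH)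
    rintro _ ⟨i, rfl, hi⟩
    rcases Nat.eq_zero_or_pos i with rfl | hpos
    · exact absurd hi hcov
    · exact_mod_cast hpos
end

section
/- Let Γ be a finite simple graph with at least one vertex that is not a join. Then rank(A_Γ) = 1. -/
open scoped Pointwise

/-- A simple graph is a join if its vertex set can be partitioned into two nonempty
sets such that every vertex of one is adjacent to every vertex of the other. -/
def SimpleGraph.IsJoin {V : Type*} (G : SimpleGraph V) : Prop :=
  ∃ A : Set V, A.Nonempty ∧ Aᶜ.Nonempty ∧ ∀ u ∈ A, ∀ v ∈ Aᶜ, G.Adj u v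

/-- The commutator relators of a right-angled Artin group: one relator
`u v u⁻¹ v⁻¹` for each edge `{u, v}` of the graph. -/
def raagRels {V : Type*} (G : SimpleGraph V) : Set (FreeGroup V) :=
  {r | ∃ u v : V, G.Adj u v ∧
    r = FreeGroup.of u * FreeGroup.of v * (FreeGroup.of u)⁻¹ * (FreeGroup.of v)⁻¹}

/-- The right-angled Artin group `A_Γ` of a finite simple graph `Γ`:
`⟨V ∣ uv = vu whenever {u,v} is an edge⟩`. -/
def RAAG {V : Type*} (G : SimpleGraph V) : Type _ := PresentedGroup (raagRels G)

noncomputable instance {V : Type*} (G : SimpleGraph V) : Group (RAAG G) :=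
  inferInstanceAs (Group (PresentedGroup (raagRels G)))

namespace MonoidAlgebra

/-- The subalgebra of elements of a monoid algebra supported in a submonoid. -/
def supportedIn {R M : Type*} [CommSemiring R] [Monoid M] (K : Submonoid M) :
    Subalgebra R (MonoidAlgebra R M) where
  carrier := {z | ∀ m ∈ z.coeff.support, m ∈ K}
  mul_mem' := by
    classical
    intro a b ha hb m hm
    obtain ⟨p, hp, q, hq, rfl⟩ := Finset.mem_mul.1 (support_coeff_mul_subset a b hm)
    exact K.mul_mem (ha p hp) (hb q hq)
  add_mem' := by
    classical
    intro a b ha hb m hm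
    rcases Finset.mem_union.1 (Finsupp.support_add hm) with h | h
    exacts [ha m h, hb m h]
  algebraMap_mem' := by
    intro r m hm
    have h : m ∈ ((single 1 r : MonoidAlgebra R M)).coeff.support := by simpa using hm
    rw [coeff_single] at h
    have := Finsupp.support_single_subset h
    rw [Finset.mem_singleton.1 this]
    exact K.one_mem

theorem mem_supportedIn {R M : Type*} [CommSemiring R] [Monoid M] {K : Submonoid M}
    {z : MonoidAlgebra R M} : z ∈ supportedIn K ↔ ∀ m, z.coeff m ≠ 0 → m ∈ K := by
  change (∀ m ∈ z.coeff.support, m ∈ K) ↔ _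
  simp

theorem single_mem_supportedIn {R M : Type*} [CommSemiring R] [Monoid M] {K : Submonoid M}
    {m : M} (hm : m ∈ K) (r : R) : single m r ∈ supportedIn (R := R) K := by
  classical
  rw [mem_supportedIn]
  intro m' h
  rw [coeff_single, Finsupp.single_apply] at h
  have : m = m' := by by_contra hne; simp [hne] at h
  exact this ▸ hm

theorem map_mem_of_support {R M A : Type*} [CommSemiring R] [Monoid M] [AddCommMonoid A]
    [Module R A] {z : MonoidAlgebra R M} (f : MonoidAlgebra R M →ₗ[R] A) (B : Submodule R A)
    (h : ∀ m, z.coeff m ≠ 0 → f (single m 1) ∈ B) : f z ∈ B := by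
  rw [← sum_coeff_single z, Finsupp.sum, map_sum]
  refine B.sum_mem fun m hm => ?_
  have : (single m (z.coeff m) : MonoidAlgebra R M) = z.coeff m • single m 1 := by
    simp
  rw [this, map_smul]
  exact B.smul_mem _ (h m (by simpa using hm))

end MonoidAlgebra

open scoped Polynomial

/-- Families of words indexed by pairs of letters; the trace monoid of a graph embeds here by
projecting a trace to all pairs of noncommuting letters. -/
abbrev PairMonoid (V : Type*) := V → V → FreeMonoid V

namespace PairMonoid

variable {V : Type*}

open Classical in
/-- The image of the letter `w` of the trace monoid of `G`. -/
noncomputable def gen (G : SimpleGraph V) (w : V) : PairMonoid V :=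
  fun u v => if ¬ G.Adj u v ∧ (w = u ∨ w = v) then FreeMonoid.of w else 1

theorem gen_commute (G : SimpleGraph V) {a b : V} (h : G.Adj a b) :
    Commute (gen G a) (gen G b) := by
  have hne := h.ne
  have h' := h.symm
  funext u v
  change gen G a u v * gen G b u v = gen G b u v * gen G a u v
  unfold gen
  split_ifs with h1 h2 <;> first | simp | skip
  exfalso
  obtain ⟨h1, rfl | rfl⟩ := h1 <;> obtain ⟨h2, rfl | rfl⟩ := h2 <;> tauto

/-- The number of letters in the component indexed by `(v, v)`. -/
def degree (v : V) (m : PairMonoid V) : ℕ := (m v v).toList.length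

@[simp] theorem degree_one (v : V) : degree v 1 = 0 := rfl

@[simp] theorem degree_mul (v : V) (m n : PairMonoid V) :
    degree v (m * n) = degree v m + degree v n := by
  simp [degree]

open Classical in
@[simp] theorem degree_gen (G : SimpleGraph V) (v w : V) :
    degree v (gen G w) = if w = v then 1 else 0 := by
  unfold degree gen
  by_cases h : w = v <;> simp [h]

/-- The homomorphism to a commutative monoid sending the letter `w` to `c w`. -/
noncomputable def weightHom [Fintype V] {K : Type*} [CommMonoid K] (c : V → K) :
    PairMonoid V →* K where
  toFun m := ∏ v, c v ^ degree v m
  map_one' := by simp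
  map_mul' m n := by simp [pow_add, Finset.prod_mul_distrib]

@[simp] theorem weightHom_gen [Fintype V] {K : Type*} [CommMonoid K] (c : V → K)
    (G : SimpleGraph V) (w : V) : weightHom c (gen G w) = c w := by
  classical
  simp [weightHom, pow_ite]

open Classical in
/-- Deletion of the letter `v`. -/
noncomputable def eraseHom (v : V) : PairMonoid V →* PairMonoid V where
  toFun m a b := FreeMonoid.lift (fun w => if w = v then 1 else FreeMonoid.of w) (m a b)
  map_one' := by funext a b; simp
  map_mul' m n := by funext a b; simp

theorem eraseHom_gen_self (G : SimpleGraph V) (v : V) : eraseHom v (gen G v) = 1 := by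
  funext a b
  simp only [eraseHom, gen, MonoidHom.coe_mk, OneHom.coe_mk]
  split_ifs <;> simp

theorem eraseHom_gen_of_ne (G : SimpleGraph V) {v w : V} (h : w ≠ v) :
    eraseHom v (gen G w) = gen G w := by
  funext a b
  simp only [eraseHom, gen, MonoidHom.coe_mk, OneHom.coe_mk]
  split_ifs <;> simp [h]

/-- An element of the trace monoid in which `v` commutes with all letters is a power of `v`
times an element that does not involve `v`. -/
theorem eq_pow_mul_erase (G : SimpleGraph V) (v : V) (S : Set V) {m : PairMonoid V}
    (hm : m ∈ Submonoid.closure (gen G '' insert v S))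
    (h : ∀ u, u ≠ v → ¬ G.Adj v u → u ∉ (m v u).toList) :
    m = gen G v ^ degree v m * eraseHom v m ∧
      eraseHom v m ∈ Submonoid.closure (gen G '' {w ∈ S | G.Adj v w}) := by
  induction hm using Submonoid.closure_induction_left with
  | one => simp
  | mul_left x hx m _ ih =>
    obtain ⟨w, hw, rfl⟩ := hx
    obtain ⟨ih1, ih2⟩ := ih fun u h1 h2 h3 => h u h1 h2 (by simp [h3])
    by_cases hwv : w = v
    · subst hwv
      simp only [degree_mul, degree_gen, if_true, map_mul, eraseHom_gen_self, one_mul]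
      refine ⟨?_, ih2⟩
      rw [pow_add, pow_one, mul_assoc, ← ih1]
    · have hadj : G.Adj v w := by
        by_contra hna
        exact h w hwv hna (by simp [gen, hna])
      simp only [degree_mul, degree_gen, if_neg hwv, zero_add, map_mul,
        eraseHom_gen_of_ne G hwv]
      refine ⟨?_, Submonoid.mul_mem _ (Submonoid.subset_closure
        ⟨w, ⟨hw.resolve_left hwv, hadj⟩, rfl⟩) ih2⟩
      rw [← mul_assoc, ((gen_commute G hadj).pow_left _).eq, mul_assoc, ← ih1]

end PairMonoid

/-- The rational monoid algebra containing the algebra of the trace monoid. -/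
abbrev PairAlgebra (V : Type*) := MonoidAlgebra ℚ (PairMonoid V)

namespace PairAlgebra

open PairMonoid MonoidAlgebra

variable {V : Type*}

/-- The generator of the partially commutative algebra. -/
noncomputable def gen (G : SimpleGraph V) (w : V) : PairAlgebra V :=
  single (PairMonoid.gen G w) 1

/-- The elements supported on traces with letters in `S`. -/
noncomputable def letters (G : SimpleGraph V) (S : Set V) : Subalgebra ℚ (PairAlgebra V) :=
  supportedIn (Submonoid.closure (PairMonoid.gen G '' S))

theorem gen_mem_letters (G : SimpleGraph V) {S : Set V} {w : V} (hw : w ∈ S) :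
    gen G w ∈ letters G S :=
  single_mem_supportedIn (Submonoid.subset_closure (Set.mem_image_of_mem _ hw)) 1

/-- Substitution of commuting values for the letters. -/
noncomputable def weight [Fintype V] {K : Type*} [CommSemiring K] [Algebra ℚ K] (c : V → K) :
    PairAlgebra V →ₐ[ℚ] K :=
  MonoidAlgebra.lift ℚ K _ (weightHom c)

@[simp] theorem weight_gen [Fintype V] {K : Type*} [CommSemiring K] [Algebra ℚ K] (c : V → K)
    (G : SimpleGraph V) (w : V) : weight c (gen G w) = c w := by
  simp [weight, gen]

/-- The grading by the degree in `v`, as a homomorphism to polynomials. -/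
noncomputable def grade (v : V) : PairAlgebra V →ₐ[ℚ] (PairAlgebra V)[X] :=
  MonoidAlgebra.lift ℚ _ _
    { toFun := fun m => Polynomial.monomial (degree v m) (single m 1)
      map_one' := by simp; rfl
      map_mul' := fun m n => by
        simp [Polynomial.monomial_mul_monomial, MonoidAlgebra.single_mul_single] }

theorem grade_single (v : V) (m : PairMonoid V) (r : ℚ) :
    grade v (single m r) = Polynomial.monomial (degree v m) (single m r) := by
  simp [grade, Polynomial.smul_monomial]

theorem coeff_coeff_grade (v : V) (z : PairAlgebra V) (n : ℕ) (m : PairMonoid V) :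
    ((grade v z).coeff n).coeff m = if degree v m = n then z.coeff m else 0 := by
  classical
  induction z using MonoidAlgebra.induction_linear with
  | zero => simp
  | add x y hx hy =>
    rw [map_add, Polynomial.coeff_add, coeff_add, Finsupp.add_apply, hx, hy]
    split_ifs <;> simp
  | single a r =>
    rw [grade_single, Polynomial.coeff_monomial]
    split_ifs with h1 h2 h2
    · rfl
    · rw [coeff_single, Finsupp.single_apply, if_neg]
      rintro rfl; exact h2 h1
    · rw [coeff_single, Finsupp.single_apply, if_neg]
      · rfl
      rintro rfl; exact h1 h2
    · rfl

/-- Deletion of the letter `v`, as an algebra homomorphism. -/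
noncomputable def erase (v : V) : PairAlgebra V →ₐ[ℚ] PairAlgebra V :=
  mapDomainAlgHom ℚ ℚ (eraseHom v)

theorem erase_single (v : V) (m : PairMonoid V) (r : ℚ) :
    erase v (single m r) = single (eraseHom v m) r := by
  simp [erase]

theorem erase_gen_self (G : SimpleGraph V) (v : V) : erase v (gen G v) = 1 := by
  rw [gen, erase_single, eraseHom_gen_self]; rfl

theorem erase_gen_of_ne (G : SimpleGraph V) {v w : V} (h : w ≠ v) :
    erase v (gen G w) = gen G w := by
  rw [gen, erase_single, eraseHom_gen_of_ne G h]

theorem not_mem_of_commute_gen (G : SimpleGraph V) {v u : V} (huv : u ≠ v) (hadj : ¬ G.Adj v u)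
    {z : PairAlgebra V} (hz : Commute (gen G v) z) {m : PairMonoid V} (hm : z.coeff m ≠ 0) :
    u ∉ (m v u).toList := by
  classical
  intro hu
  obtain ⟨m, hm, hmax⟩ := Finset.exists_max_image
    (z.coeff.support.filter fun m => u ∈ (m v u).toList)
    (fun m => (m v u).toList.idxOf u) ⟨m, by simp [hm, hu]⟩
  simp only [Finset.mem_filter, Finsupp.mem_support_iff] at hm hmax
  have h1 : (gen G v * z).coeff (PairMonoid.gen G v * m) ≠ 0 := by
    rw [gen, coeff_single_mul_mul]; simpa using hm.1
  rw [hz.eq] at h1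
  obtain ⟨m', hm', heq⟩ := Finset.mem_image.1
    (support_coeff_mul_single_subset z 1 _ (Finsupp.mem_support_iff.2 h1))
  have hg : PairMonoid.gen G v v u = FreeMonoid.of v := by simp [PairMonoid.gen, hadj]
  have h2 : (m' v u).toList ++ [v] = v :: (m v u).toList := by
    have := congrArg FreeMonoid.toList (congrFun (congrFun heq v) u)
    simpa [hg] using this
  have h3 : u ∈ (m' v u).toList := by
    have : u ∈ (m' v u).toList ++ [v] := by rw [h2]; simp [hm.2]
    simpa [huv] using this
  have h4 := hmax m' ⟨by simpa using hm', h3⟩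
  have h5 := congrArg (List.idxOf u) h2
  rw [List.idxOf_append_of_mem h3, List.idxOf_cons_ne _ huv.symm] at h5
  omega

end PairAlgebra

/-- Vertex sets whose induced subgraph has connected complement, presented by adding one vertex
at a time. -/
inductive SimpleGraph.CoConnected {V : Type*} (G : SimpleGraph V) : Finset V → Prop
  | empty : G.CoConnected ∅
  | cons (v : V) (S : Finset V) (hv : v ∉ S) (hS : S = ∅ ∨ ∃ u ∈ S, ¬ G.Adj v u)
      (h : G.CoConnected S) : G.CoConnected (S.cons v hv)

theorem SimpleGraph.coConnected_univ {V : Type*} [Fintype V] {G : SimpleGraph V}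
    (h : ¬ G.IsJoin) : G.CoConnected Finset.univ := by
  classical
  obtain ⟨S, hS, hmax⟩ := Finset.exists_max_image
    (Finset.univ.filter fun S : Finset V => G.CoConnected S) Finset.card
    ⟨∅, by simpa using SimpleGraph.CoConnected.empty⟩
  simp only [Finset.mem_filter, Finset.mem_univ, true_and] at hS hmax
  by_contra hne
  have hSne : ∃ v, v ∉ S := by
    by_contra! hall
    exact hne (Finset.eq_univ_of_forall hall ▸ hS)
  suffices ∃ v, ∃ _ : v ∉ S, S = ∅ ∨ ∃ u ∈ S, ¬ G.Adj v u by
    obtain ⟨v, hv, h'⟩ := this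
    have := hmax _ (SimpleGraph.CoConnected.cons v S hv h' hS)
    rw [Finset.card_cons] at this
    omega
  rcases S.eq_empty_or_nonempty with rfl | hn
  · obtain ⟨v, hv⟩ := hSne
    exact ⟨v, hv, Or.inl rfl⟩
  · by_contra! hcon
    refine h ⟨S, hn, hSne, fun u hu v hv => ?_⟩
    exact ((hcon v (by simpa using hv)).2 u (by simpa using hu)).symm

namespace PairAlgebra

open PairMonoid MonoidAlgebra

variable {V : Type*}

/-- The linear form with coefficients `a` in the letters of `S`. -/
noncomputable def linearForm (G : SimpleGraph V) (a : V → ℚ) (S : Finset V) : PairAlgebra V :=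
  ∑ v ∈ S, a v • gen G v

theorem linearForm_cons (G : SimpleGraph V) (a : V → ℚ) {v : V} {S : Finset V} (hv : v ∉ S) :
    linearForm G a (S.cons v hv) = a v • gen G v + linearForm G a S :=
  Finset.sum_cons hv

theorem linearForm_mem_letters (G : SimpleGraph V) (a : V → ℚ) (S : Finset V) :
    linearForm G a S ∈ letters G S :=
  Subalgebra.sum_mem _ fun _ hv => Subalgebra.smul_mem _ (gen_mem_letters G hv) _

theorem erase_linearForm (G : SimpleGraph V) (a : V → ℚ) {v : V} {S : Finset V} (hv : v ∉ S) :
    erase v (linearForm G a S) = linearForm G a S := by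
  rw [linearForm, map_sum]
  refine Finset.sum_congr rfl fun w hw => ?_
  rw [map_smul, erase_gen_of_ne G (by rintro rfl; exact hv hw)]

theorem grade_gen_of_ne (G : SimpleGraph V) {v w : V} (h : w ≠ v) :
    grade v (gen G w) = Polynomial.C (gen G w) := by
  rw [gen, grade_single, degree_gen, if_neg h]; rfl

theorem grade_gen_self (G : SimpleGraph V) (v : V) :
    grade v (gen G v) = Polynomial.C (gen G v) * Polynomial.X := by
  rw [gen, grade_single, degree_gen, if_pos rfl, Polynomial.C_mul_X_eq_monomial]

theorem grade_linearForm (G : SimpleGraph V) (a : V → ℚ) {v : V} {S : Finset V} (hv : v ∉ S) :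
    grade v (linearForm G a S) = Polynomial.C (linearForm G a S) := by
  rw [linearForm, map_sum, map_sum]
  refine Finset.sum_congr rfl fun w hw => ?_
  rw [map_smul, grade_gen_of_ne G (by rintro rfl; exact hv hw), Polynomial.smul_C]

theorem grade_linearForm_cons (G : SimpleGraph V) (a : V → ℚ) {v : V} {S : Finset V}
    (hv : v ∉ S) : grade v (linearForm G a (S.cons v hv)) =
      Polynomial.C (a v • gen G v) * Polynomial.X + Polynomial.C (linearForm G a S) := by
  rw [linearForm_cons, map_add, map_smul, grade_gen_self, grade_linearForm G a hv,
    ← Polynomial.smul_C, smul_mul_assoc]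

theorem coeff_grade_mem_letters (G : SimpleGraph V) {S : Set V} (v : V) {z : PairAlgebra V}
    (hz : z ∈ letters G S) (n : ℕ) : (grade v z).coeff n ∈ letters G S := by
  rw [letters, mem_supportedIn] at hz ⊢
  intro m hm
  rw [coeff_coeff_grade] at hm
  exact hz m (by by_contra h; simp [h] at hm)

theorem eq_zero_of_grade_eq_zero (v : V) {z : PairAlgebra V} (h : ∀ n, (grade v z).coeff n = 0) :
    z = 0 := by
  ext m
  have := congrArg (fun y => MonoidAlgebra.coeff y m) (h (degree v m))
  simpa [coeff_coeff_grade] using this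

theorem weight_linearForm [Fintype V] {K : Type*} [CommSemiring K] [Algebra ℚ K] (c : V → K)
    (G : SimpleGraph V) (a : V → ℚ) (S : Finset V) :
    weight c (linearForm G a S) = ∑ v ∈ S, a v • c v := by
  simp [linearForm]

open Classical in
/-- Setting all letters except `u` to zero. -/
noncomputable def toPolynomial [Fintype V] (u : V) : PairAlgebra V →ₐ[ℚ] ℚ[X] :=
  weight fun v => if v = u then Polynomial.X else 0

theorem toPolynomial_linearForm [Fintype V] (G : SimpleGraph V) (a : V → ℚ) {S : Finset V} {u : V}
    (hu : u ∈ S) : toPolynomial u (linearForm G a S) = a u • Polynomial.X := by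
  classical
  rw [toPolynomial, weight_linearForm]
  simp [hu]

theorem toPolynomial_aeval [Fintype V] (G : SimpleGraph V) (a : V → ℚ) {S : Finset V} {u : V}
    (hu : u ∈ S) (p : ℚ[X]) : toPolynomial u (Polynomial.aeval (linearForm G a S) p) =
      p.comp (Polynomial.C (a u) * Polynomial.X) := by
  rw [← Polynomial.aeval_algHom_apply, toPolynomial_linearForm G a hu, Polynomial.smul_eq_C_mul]
  rfl

theorem toPolynomial_mem_bot [Fintype V] (G : SimpleGraph V) {S : Set V} {u : V} (hu : u ∉ S)
    {z : PairAlgebra V} (hz : z ∈ letters G S) :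
    toPolynomial u z ∈ (⊥ : Subalgebra ℚ ℚ[X]) := by
  classical
  rw [letters, mem_supportedIn] at hz
  refine map_mem_of_support (toPolynomial u).toLinearMap
    (Subalgebra.toSubmodule (⊥ : Subalgebra ℚ ℚ[X])) fun m hm => ?_
  change toPolynomial u (single m 1) ∈ (⊥ : Subalgebra ℚ ℚ[X])
  replace hm := hz m hm
  clear hz
  induction hm using Submonoid.closure_induction with
  | mem x hx =>
    obtain ⟨w, hw, rfl⟩ := hx
    change toPolynomial u (gen G w) ∈ _
    rw [toPolynomial, weight_gen, if_neg (by rintro rfl; exact hu hw)]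
    exact zero_mem _
  | one => rw [← MonoidAlgebra.one_def, map_one]; exact one_mem _
  | mul x y _ _ hx hy =>
    have : (single (x * y) 1 : PairAlgebra V) = single x 1 * single y 1 := by
      simp [MonoidAlgebra.single_mul_single]
    rw [this, map_mul]
    exact mul_mem hx hy

theorem erase_mem_letters_and_eq (G : SimpleGraph V) {S : Set V} {v : V} {D : ℕ}
    {Y : PairAlgebra V} (hY : Y ∈ letters G (insert v S)) (hD : ∀ m, Y.coeff m ≠ 0 → degree v m = D)
    (hc : Commute (gen G v) Y) :
    erase v Y ∈ letters G {w ∈ S | G.Adj v w} ∧ Y = gen G v ^ D * erase v Y := by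
  rw [letters, mem_supportedIn] at hY
  have key : ∀ m, Y.coeff m ≠ 0 → _ := fun m hm => eq_pow_mul_erase G v S (hY m hm)
    fun u hu hadj => not_mem_of_commute_gen G hu hadj hc hm
  constructor
  · refine map_mem_of_support (erase v).toLinearMap (Subalgebra.toSubmodule (letters G _))
      fun m hm => ?_
    change erase v (single m 1) ∈ letters G _
    rw [erase_single]
    exact single_mem_supportedIn (key m hm).2 1
  · have h0 := map_mem_of_support (z := Y)
      (LinearMap.id - (LinearMap.mulLeft ℚ (gen G v ^ D)).comp (erase v).toLinearMap) ⊥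
      fun m hm => by
        have h1 := (key m hm).1
        rw [hD m hm] at h1
        simp only [LinearMap.sub_apply, LinearMap.id_apply, LinearMap.comp_apply,
          AlgHom.toLinearMap_apply, LinearMap.mulLeft_apply, erase_single, gen, single_pow,
          single_mul_single, Submodule.mem_bot, one_pow, one_mul, ← h1, sub_self]
    simpa [sub_eq_zero] using h0

theorem coeff_grade_commute (G : SimpleGraph V) (a : V → ℚ) {v : V} {S : Finset V} (hv : v ∉ S)
    {z : PairAlgebra V} (hz : Commute z (linearForm G a (S.cons v hv))) (n : ℕ) :
    (grade v z).coeff n * (a v • gen G v) + (grade v z).coeff (n + 1) * linearForm G a S =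
      (a v • gen G v) * (grade v z).coeff n + linearForm G a S * (grade v z).coeff (n + 1) := by
  have h := congrArg (fun p => Polynomial.coeff p (n + 1)) (hz.map (grade v)).eq
  simp only [grade_linearForm_cons, mul_add, add_mul, Polynomial.coeff_add] at h
  rwa [← mul_assoc, Polynomial.coeff_mul_X, Polynomial.coeff_mul_C, Polynomial.coeff_mul_C,
    mul_assoc, Polynomial.coeff_C_mul, Polynomial.coeff_X_mul, Polynomial.coeff_C_mul] at h

theorem coeff_zero_grade_commute (G : SimpleGraph V) (a : V → ℚ) {v : V} {S : Finset V}
    (hv : v ∉ S) {z : PairAlgebra V} (hz : Commute z (linearForm G a (S.cons v hv))) :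
    Commute ((grade v z).coeff 0) (linearForm G a S) := by
  have h := congrArg (fun p => Polynomial.coeff p 0) (hz.map (grade v)).eq
  rw [commute_iff_eq]
  simpa [grade_linearForm_cons, Polynomial.mul_coeff_zero] using h

theorem exists_eq_algebraMap [Fintype V] (G : SimpleGraph V) {a : V → ℚ} (ha : ∀ v, a v ≠ 0)
    {v : V} {S : Finset V} (hS : S = ∅ ∨ ∃ u ∈ S, ¬ G.Adj v u) {y : PairAlgebra V}
    (hy : y ∈ letters G {w ∈ (S : Set V) | G.Adj v w}) {p : ℚ[X]}
    (hp : y = Polynomial.aeval (linearForm G a S) p) :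
    ∃ c : ℚ, y = algebraMap ℚ _ c := by
  rcases hS with rfl | ⟨u, hu, hadj⟩
  · refine ⟨p.coeff 0, ?_⟩
    rw [hp, linearForm, Finset.sum_empty, ← Polynomial.coeff_zero_eq_aeval_zero']
  · have h := toPolynomial_mem_bot G (u := u) (by simp [hadj]) hy
    rw [hp, toPolynomial_aeval G a hu, Algebra.mem_bot] at h
    obtain ⟨c, hc⟩ := h
    have hdeg := congrArg Polynomial.natDegree hc
    rw [Polynomial.natDegree_comp, Polynomial.natDegree_C_mul_X _ (ha u), mul_one,
      Polynomial.algebraMap_eq, Polynomial.natDegree_C] at hdeg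
    refine ⟨p.coeff 0, ?_⟩
    rw [hp, Polynomial.eq_C_of_natDegree_eq_zero hdeg.symm, Polynomial.aeval_C,
      Polynomial.coeff_C_zero]

theorem exists_aeval_of_commute_cons [Fintype V] (G : SimpleGraph V) {a : V → ℚ}
    (ha : ∀ v, a v ≠ 0) {v : V} {S : Finset V} (hv : v ∉ S) (hS : S = ∅ ∨ ∃ u ∈ S, ¬ G.Adj v u)
    (ih : ∀ z ∈ letters G (S : Set V), Commute z (linearForm G a S) →
      ∃ p : ℚ[X], z = Polynomial.aeval (linearForm G a S) p) (D : ℕ) :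
    ∀ z ∈ letters G (S.cons v hv : Set V), Commute z (linearForm G a (S.cons v hv)) →
      (∀ n, D ≤ n → (grade v z).coeff n = 0) →
      ∃ p : ℚ[X], z = Polynomial.aeval (linearForm G a (S.cons v hv)) p := by
  induction D with
  | zero =>
    intro z _ _ h
    exact ⟨0, by simpa using eq_zero_of_grade_eq_zero v fun n => h n n.zero_le⟩
  | succ D ihD =>
    intro z hz hc h
    set Y := (grade v z).coeff D with hYdef
    have hcomm : Commute (gen G v) Y := by
      have h1 := coeff_grade_commute G a hv hc D
      rw [h (D + 1) le_rfl, zero_mul, mul_zero, add_zero, add_zero, mul_smul_comm,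
        smul_mul_assoc] at h1
      exact (smul_right_injective _ (ha v) h1).symm
    have hYl : Y ∈ letters G (insert v (S : Set V)) := by
      rw [← Finset.coe_cons]; exact coeff_grade_mem_letters G v hz D
    obtain ⟨hel, heq⟩ := erase_mem_letters_and_eq G hYl
      (D := D) (fun m hm => by
        rw [hYdef, coeff_coeff_grade] at hm
        by_contra hne
        exact hm (if_neg hne)) hcomm
    have hec : Commute (erase v Y) (linearForm G a S) := by
      cases D with
      | zero =>
        have h1 := (coeff_zero_grade_commute G a hv hc).map (erase v)
        rwa [erase_linearForm G a hv] at h1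
      | succ k =>
        have h1 := congrArg (erase v) (coeff_grade_commute G a hv hc k)
        simp only [map_add, map_mul, map_smul, erase_gen_self, erase_linearForm G a hv,
          mul_smul_comm, smul_mul_assoc, mul_one, one_mul] at h1
        exact add_left_cancel h1
    have hle : letters G {w ∈ (S : Set V) | G.Adj v w} ≤ letters G (S : Set V) := by
      intro y hy
      rw [letters, mem_supportedIn] at hy ⊢
      exact fun m hm => Submonoid.closure_mono (Set.image_mono fun _ hw => hw.1) (hy m hm)
    obtain ⟨p, hp⟩ := ih _ (hle hel) hec
    obtain ⟨c, hcst⟩ := exists_eq_algebraMap G ha hS hel hp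
    have hY : Y = c • gen G v ^ D := by
      rw [heq, hcst, ← Algebra.commutes, ← Algebra.smul_def]
    set L := linearForm G a (S.cons v hv) with hL
    have hdeg : (grade v L).natDegree ≤ 1 := by
      rw [hL, grade_linearForm_cons]
      exact Polynomial.natDegree_linear_le
    have hcoeff : (grade v L).coeff 1 = a v • gen G v := by
      simp [hL, grade_linearForm_cons]
    obtain ⟨q, hq⟩ := ihD (z - (c / a v ^ D) • L ^ D)
      (sub_mem hz (Subalgebra.smul_mem _ (pow_mem (linearForm_mem_letters G a _) _) _))
      (hc.sub_left (((Commute.refl L).pow_left D).smul_left _)) (fun n hn => by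
        rw [map_sub, map_smul, map_pow, Polynomial.coeff_sub, Polynomial.coeff_smul]
        rcases hn.eq_or_lt with rfl | hlt
        · have h2 := Polynomial.coeff_pow_of_natDegree_le (m := D) hdeg
          rw [mul_one] at h2
          rw [h2, hcoeff, smul_pow, smul_smul, div_mul_cancel₀ _ (pow_ne_zero _ (ha v)), ← hYdef,
            hY, sub_self]
        · rw [h n hlt, Polynomial.coeff_eq_zero_of_natDegree_lt, smul_zero, sub_zero]
          exact (Polynomial.natDegree_pow_le_of_le D hdeg).trans_lt (by omega))
    refine ⟨q + Polynomial.C (c / a v ^ D) * Polynomial.X ^ D, ?_⟩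
    rw [map_add, ← hq, map_mul, map_pow, Polynomial.aeval_X, Polynomial.aeval_C,
      ← Algebra.smul_def, sub_add_cancel]

/-- The centralizer of a linear form with full support is generated by that form when the
complement graph is connected. -/
theorem exists_aeval_of_commute [Fintype V] (G : SimpleGraph V) {a : V → ℚ} (ha : ∀ v, a v ≠ 0)
    {S : Finset V} (hS : G.CoConnected S) :
    ∀ z ∈ letters G (S : Set V), Commute z (linearForm G a S) →
      ∃ p : ℚ[X], z = Polynomial.aeval (linearForm G a S) p := by
  induction hS with
  | empty =>
    intro z hz _
    rw [letters, mem_supportedIn] at hz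
    refine ⟨Polynomial.C (z.coeff 1), ?_⟩
    rw [Polynomial.aeval_C]
    ext m
    by_cases hm : m = 1
    · subst hm; simp
    · have : z.coeff m = 0 := by
        by_contra hne
        exact hm (by simpa using hz m hne)
      simp [this, Ne.symm hm]
  | cons v S hv hS _ ih =>
    intro z hz hc
    exact exists_aeval_of_commute_cons G ha hv hS ih ((grade v z).natDegree + 1) z hz hc
      fun n hn => Polynomial.coeff_eq_zero_of_natDegree_lt (by omega)

end PairAlgebra

theorem List.exists_eq_append_cons_of_count {α : Type*} [DecidableEq α] (v : α) (w : List α) :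
    ∀ k, k < w.count v → ∃ a r, w = a ++ v :: r ∧ a.count v = k := by
  induction w with
  | nil => intro k hk; simp at hk
  | cons x w ih =>
    intro k hk
    by_cases hx : x = v
    · subst hx
      rcases k with _ | k
      · exact ⟨[], w, rfl, rfl⟩
      · obtain ⟨a, r, rfl, ha⟩ := ih k (by simpa using hk)
        exact ⟨x :: a, r, rfl, by simp [ha]⟩
    · obtain ⟨a, r, rfl, ha⟩ := ih k (by simpa [hx] using hk)
      exact ⟨x :: a, r, rfl, by simp [ha, hx]⟩

theorem List.eq_of_append_cons_eq_of_count_eq {α : Type*} [DecidableEq α] {v : α} :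
    ∀ {a b r s : List α}, a ++ v :: r = b ++ v :: s → a.count v = b.count v → r = s
  | [], [], _, _, h, _ => by simpa using h
  | [], y :: b, _, _, h, hc => by
    simp only [List.nil_append, List.cons_append, List.cons.injEq] at h
    simp [h.1] at hc
  | y :: a, [], _, _, h, hc => by
    simp only [List.nil_append, List.cons_append, List.cons.injEq] at h
    simp [h.1] at hc
  | x :: a, y :: b, _, _, h, hc => by
    simp only [List.cons_append, List.cons.injEq] at h
    obtain ⟨rfl, h⟩ := h
    refine List.eq_of_append_cons_eq_of_count_eq h ?_
    by_cases hx : x = v <;> simpa [hx, List.count_cons] using hc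

/-- A word is reduced if between any two occurrences of a letter there is a letter not commuting
with it. -/
def SimpleGraph.IsReducedWord {V : Type*} (G : SimpleGraph V) (w : List V) : Prop :=
  ∀ a v b c, w = a ++ v :: (b ++ v :: c) → ∃ u ∈ b, u ≠ v ∧ ¬ G.Adj v u

namespace PairMonoid

variable {V : Type*}

/-- The trace of a word. -/
noncomputable def ofWord (G : SimpleGraph V) (w : List V) : PairMonoid V :=
  (w.map (gen G)).prod

@[simp] theorem ofWord_cons (G : SimpleGraph V) (v : V) (w : List V) :
    ofWord G (v :: w) = gen G v * ofWord G w := by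
  simp [ofWord]

open Classical in
theorem toList_ofWord (G : SimpleGraph V) {u v : V} (h : ¬ G.Adj u v) (w : List V) :
    (ofWord G w u v).toList = w.filter fun x => x = u ∨ x = v := by
  induction w with
  | nil => rfl
  | cons x w ih =>
    rw [ofWord_cons, Pi.mul_apply, Pi.mul_apply, FreeMonoid.toList_mul, ih, List.filter_cons]
    by_cases hx : x = u ∨ x = v <;> simp [gen, h, hx]

/-- A family of words is square-free if it has no prefix consisting of a trace followed by the
same letter twice. -/
def SquareFree (G : SimpleGraph V) (m : PairMonoid V) : Prop :=
  ∀ p v q, m ≠ ofWord G p * (gen G v * (gen G v * q))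

theorem SquareFree.of_gen_mul {G : SimpleGraph V} {v : V} {m : PairMonoid V}
    (h : SquareFree G (gen G v * m)) : SquareFree G m := by
  rintro p u q rfl
  exact h (v :: p) u q (by rw [ofWord_cons, mul_assoc])

theorem squareFree_ofWord {G : SimpleGraph V} {w : List V} (hw : G.IsReducedWord w) :
    SquareFree G (ofWord G w) := by
  classical
  intro p v q h
  have key : ∀ u, ¬ G.Adj v u → w.filter (fun x => x = v ∨ x = u) =
      p.filter (fun x => x = v ∨ x = u) ++ v :: v :: (q v u).toList := by
    intro u hu
    have := congrArg FreeMonoid.toList (congrFun (congrFun h v) u)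
    simpa [toList_ofWord G hu, gen, hu] using this
  have hcount : ∀ (l : List V) (u : V), (l.filter fun x => x = v ∨ x = u).count v = l.count v :=
    fun l u => List.count_filter (by simp)
  have h1 : p.count v + 1 < w.count v := by
    have := congrArg (List.count v) (key v (G.loopless.irrefl v))
    rw [hcount, List.count_append, hcount] at this
    simp only [List.count_cons_self] at this
    omega
  obtain ⟨a, r, rfl, ha⟩ := List.exists_eq_append_cons_of_count v w (p.count v) (by omega)
  obtain ⟨b, c, rfl, hb⟩ := List.exists_eq_append_cons_of_count v r 0 (by
    simp [List.count_append] at h1; omega)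
  obtain ⟨u, hu, huv, hadj⟩ := hw a v b c rfl
  have h2 := key u hadj
  rw [List.filter_append, List.filter_cons_of_pos (by simp)] at h2
  have h3 := List.eq_of_append_cons_eq_of_count_eq h2 (by rw [hcount, hcount, ha])
  rw [List.filter_append, List.filter_cons_of_pos (by simp)] at h3
  have hvb : v ∉ b := List.count_eq_zero.1 hb
  cases hf : b.filter (fun x => x = v ∨ x = u) with
  | nil =>
    have := hf ▸ List.mem_filter.2 ⟨hu, by simp⟩
    simp at this
  | cons x t =>
    rw [hf] at h3
    simp only [List.cons_append, List.cons.injEq] at h3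
    have : x ∈ b.filter (fun x => x = v ∨ x = u) := hf ▸ List.mem_cons_self
    exact hvb (h3.1 ▸ (List.mem_filter.1 this).1)

end PairMonoid

namespace PowerSeries

variable {R S : Type*} [Ring R] [Ring S]

/-- The unit `1 + xX` of the ring of power series. -/
noncomputable def oneAddUnit (x : R) : R⟦X⟧ˣ where
  val := 1 + X * C x
  inv := mk fun n => (-x) ^ n
  val_inv := by
    ext n
    rw [add_mul, one_mul, mul_assoc, map_add]
    cases n with
    | zero => simp
    | succ n => simp [coeff_succ_X_mul, pow_succ']
  inv_val := by
    ext n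
    rw [mul_add, mul_one, ← mul_assoc, (commute_X _).eq, mul_assoc, map_add]
    cases n with
    | zero => simp
    | succ n => simp [coeff_succ_X_mul, pow_succ]

theorem val_oneAddUnit (x : R) : (oneAddUnit x : R⟦X⟧) = 1 + X * C x := rfl

theorem map_oneAddUnit (f : R →+* S) (x : R) :
    Units.map (map f : R⟦X⟧ →* S⟦X⟧) (oneAddUnit x) = oneAddUnit (f x) := by
  ext1
  simp [val_oneAddUnit]

theorem commute_oneAddUnit {x y : R} (h : Commute x y) :
    Commute (oneAddUnit x) (oneAddUnit y) := by
  refine Units.ext ?_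
  have hXY : Commute (X * C x) (X * C y : R⟦X⟧) :=
    (((Commute.refl X).mul_right (commute_X _).symm)).mul_left
      ((commute_X _).mul_right (h.map C))
  exact ((Commute.one_left _).add_left ((Commute.one_right _).add_right hXY)).eq

end PowerSeries

theorem Units.exists_zpow_eq {R : Type*} [Ring R] (u : Rˣ) {y : R} (hu : (u : R) = 1 + y) (e : ℤ) :
    ∃ s, ((u ^ e : Rˣ) : R) = 1 + e • y + y * (y * s) := by
  have hinv : (↑u⁻¹ : R) = 1 - y + y * (y * ↑u⁻¹) := by
    have h : (1 + y) * ↑u⁻¹ = 1 := by rw [← hu, Units.mul_inv]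
    have h' : (↑u⁻¹ : R) = 1 - y * ↑u⁻¹ := by
      rw [eq_sub_iff_add_eq, ← one_add_mul, h]
    calc (↑u⁻¹ : R) = 1 - y * ↑u⁻¹ := h'
      _ = 1 - y * (1 - y * ↑u⁻¹) := by rw [← h']; exact h'
      _ = _ := by noncomm_ring
  induction e using Int.induction_on with
  | zero => exact ⟨0, by simp⟩
  | succ n ih =>
    obtain ⟨s, hs⟩ := ih
    refine ⟨(n : ℤ) • 1 + s * (1 + y), ?_⟩
    rw [zpow_add, zpow_one, Units.val_mul, hs, hu, add_smul]
    noncomm_ring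
  | pred n ih =>
    obtain ⟨s, hs⟩ := ih
    generalize -(n : ℤ) = k at hs ⊢
    refine ⟨-(k • 1) + s * ↑u⁻¹ + ↑u⁻¹ + k • (y * ↑u⁻¹), ?_⟩
    rw [zpow_sub, zpow_one, Units.val_mul, hs]
    have h2 : (1 + k • y) * (↑u⁻¹ : R) = (1 + k • y) * (1 - y + y * (y * ↑u⁻¹)) := by
      rw [← hinv]
    rw [add_mul, h2, sub_smul]
    simp only [one_smul]
    noncomm_ring

namespace RAAG

variable {V : Type*}

/-- The standard generators. -/
def of (G : SimpleGraph V) (v : V) : RAAG G := PresentedGroup.of (rels := raagRels G) v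

theorem commute_of {G : SimpleGraph V} {u v : V} (h : G.Adj u v) :
    Commute (of G u) (of G v) := by
  have h1 := PresentedGroup.one_of_mem (rels := raagRels G) ⟨u, v, h, rfl⟩
  simp only [map_mul, map_inv] at h1
  rw [mul_inv_eq_one, mul_inv_eq_iff_eq_mul] at h1
  exact h1

/-- The universal property. -/
def lift {G : SimpleGraph V} {H : Type*} [Group H] (f : V → H)
    (hf : ∀ u v, G.Adj u v → Commute (f u) (f v)) : RAAG G →* H :=
  PresentedGroup.toGroup (rels := raagRels G) (f := f) <| by
    rintro _ ⟨u, v, h, rfl⟩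
    simp only [map_mul, map_inv, FreeGroup.lift_apply_of]
    rw [mul_inv_eq_one, mul_inv_eq_iff_eq_mul]
    exact hf u v h

@[simp] theorem lift_of {G : SimpleGraph V} {H : Type*} [Group H] (f : V → H)
    (hf : ∀ u v, G.Adj u v → Commute (f u) (f v)) (v : V) : lift f hf (of G v) = f v :=
  PresentedGroup.toGroup.of _

theorem closure_range_of (G : SimpleGraph V) : Subgroup.closure (Set.range (of G)) = ⊤ :=
  PresentedGroup.closure_range_of _

theorem hom_ext {G : SimpleGraph V} {H : Type*} [Group H] {f g : RAAG G →* H}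
    (h : ∀ v, f (of G v) = g (of G v)) : f = g :=
  MonoidHom.eq_of_eqOn_dense (closure_range_of G) <| by
    rintro _ ⟨v, rfl⟩
    exact h v

/-- The product of powers of generators described by a list. -/
noncomputable def wordProd (G : SimpleGraph V) (L : List (V × ℤ)) : RAAG G :=
  (L.map fun p => of G p.1 ^ p.2).prod

@[simp] theorem wordProd_nil (G : SimpleGraph V) : wordProd G [] = 1 := rfl

@[simp] theorem wordProd_cons (G : SimpleGraph V) (p : V × ℤ) (L : List (V × ℤ)) :
    wordProd G (p :: L) = of G p.1 ^ p.2 * wordProd G L := by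
  simp [wordProd]

@[simp] theorem wordProd_append (G : SimpleGraph V) (K L : List (V × ℤ)) :
    wordProd G (K ++ L) = wordProd G K * wordProd G L := by
  simp [wordProd]

theorem exists_wordProd_eq (G : SimpleGraph V) (g : RAAG G) : ∃ L, wordProd G L = g := by
  have hg : g ∈ Subgroup.closure (Set.range (of G)) := closure_range_of G ▸ Subgroup.mem_top g
  induction hg using Subgroup.closure_induction'' with
  | mem x hx =>
    obtain ⟨v, rfl⟩ := hx
    exact ⟨[(v, 1)], by simp⟩
  | inv_mem x hx =>
    obtain ⟨v, rfl⟩ := hx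
    exact ⟨[(v, -1)], by simp⟩
  | one => exact ⟨[], rfl⟩
  | mul x y _ _ hx hy =>
    obtain ⟨K, rfl⟩ := hx
    obtain ⟨L, rfl⟩ := hy
    exact ⟨K ++ L, by simp⟩

theorem commute_wordProd {G : SimpleGraph V} {v : V} {L : List (V × ℤ)}
    (h : ∀ p ∈ L, p.1 ≠ v → G.Adj v p.1) (e : ℤ) : Commute (wordProd G L) (of G v ^ e) := by
  induction L with
  | nil => exact Commute.one_left _
  | cons p L ih =>
    rw [wordProd_cons]
    refine Commute.mul_left (Commute.zpow_zpow ?_ _ _) (ih fun q hq => h q (by simp [hq]))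
    by_cases hp : p.1 = v
    · rw [hp]
    · exact (commute_of (h p (by simp) hp)).symm

/-- Every element is represented by a word without cancellations. -/
theorem exists_isReducedWord (G : SimpleGraph V) (g : RAAG G) :
    ∃ L, wordProd G L = g ∧ G.IsReducedWord (L.map Prod.fst) ∧ ∀ p ∈ L, p.2 ≠ 0 := by
  classical
  have hex : ∃ n, ∃ L, wordProd G L = g ∧ L.length = n := by
    obtain ⟨L, hL⟩ := exists_wordProd_eq G g
    exact ⟨_, L, hL, rfl⟩
  obtain ⟨L, hL, hlen⟩ := Nat.find_spec hex
  have hmin : ∀ K, wordProd G K = g → L.length ≤ K.length := fun K hK =>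
    hlen ▸ Nat.find_min' hex ⟨K, hK, rfl⟩
  refine ⟨L, hL, ?_, ?_⟩
  · intro a v b c h
    by_contra! hcon
    obtain ⟨A, L', rfl, rfl, h1⟩ := List.map_eq_append_iff.1 h
    obtain ⟨⟨_, e⟩, L', rfl, rfl, h2⟩ := List.map_eq_cons_iff.1 h1
    obtain ⟨B, L', rfl, rfl, h3⟩ := List.map_eq_append_iff.1 h2
    obtain ⟨⟨v, f⟩, C, rfl, h4, rfl⟩ := List.map_eq_cons_iff.1 h3
    simp only at h4 hcon
    subst h4
    have hcomm : Commute (wordProd G B) (of G v ^ f) :=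
      commute_wordProd (fun p hp hne => hcon p.1 (List.mem_map_of_mem hp) hne) f
    have := hmin (A ++ (v, e + f) :: (B ++ C)) (by
      rw [← hL]
      simp only [wordProd_append, wordProd_cons, zpow_add]
      rw [← mul_assoc (wordProd G B), hcomm.eq]
      simp only [mul_assoc])
    simp at this
  · rintro ⟨v, e⟩ hp rfl
    obtain ⟨A, B, rfl⟩ := List.append_of_mem hp
    have := hmin (A ++ B) (by rw [← hL]; simp)
    simp at this

end RAAG

namespace RAAG

open PowerSeries PairMonoid

variable {V : Type*}

/-- The Magnus homomorphism, sending the generator `v` to `1 + vX`. -/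
noncomputable def magnus (G : SimpleGraph V) : RAAG G →* (PairAlgebra V)⟦X⟧ˣ :=
  lift (fun v => oneAddUnit (PairAlgebra.gen G v)) fun _ _ h =>
    commute_oneAddUnit (by
      simp [commute_iff_eq, PairAlgebra.gen, MonoidAlgebra.single_mul_single,
        (PairMonoid.gen_commute G h).eq])

@[simp] theorem magnus_of (G : SimpleGraph V) (v : V) :
    magnus G (of G v) = oneAddUnit (PairAlgebra.gen G v) :=
  lift_of _ _ v

theorem exists_magnus_cons (G : SimpleGraph V) (p : V × ℤ) (L : List (V × ℤ)) :
    ∃ S : (PairAlgebra V)⟦X⟧, (magnus G (wordProd G (p :: L)) : (PairAlgebra V)⟦X⟧) =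
      (magnus G (wordProd G L)).val +
        p.2 • (X * (C (PairAlgebra.gen G p.1) * (magnus G (wordProd G L)).val)) +
        X * (C (PairAlgebra.gen G p.1) * (X * (C (PairAlgebra.gen G p.1) * S))) := by
  obtain ⟨s, hs⟩ := Units.exists_zpow_eq (oneAddUnit (PairAlgebra.gen G p.1))
    (val_oneAddUnit _) p.2
  refine ⟨s * magnus G (wordProd G L), ?_⟩
  rw [wordProd_cons, map_mul, map_zpow, magnus_of, Units.val_mul, hs]
  simp only [add_mul, one_mul, smul_mul_assoc, mul_assoc]

theorem coeff_coeff_X_mul_X_mul {G : SimpleGraph V} {m : PairMonoid V} (hm : SquareFree G m)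
    (v : V) (S : (PairAlgebra V)⟦X⟧) (k : ℕ) :
    (coeff k (X * (C (PairAlgebra.gen G v) *
      (X * (C (PairAlgebra.gen G v) * S))))).coeff m = 0 := by
  rcases k with _ | _ | k
  · simp
  · simp [coeff_succ_X_mul]
  · rw [coeff_succ_X_mul, coeff_C_mul, coeff_succ_X_mul, coeff_C_mul]
    have h := hm [] v
    simp only [ofWord, List.map_nil, List.prod_nil, one_mul] at h
    rw [← mul_assoc, PairAlgebra.gen, MonoidAlgebra.single_mul_single]
    exact MonoidAlgebra.coeff_single_mul_of_forall_mul_ne _ _ fun d => by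
      rw [mul_assoc]; exact (h d).symm

theorem coeff_coeff_magnus_wordProd_of_lt {G : SimpleGraph V} (L : List (V × ℤ)) :
    ∀ {m : PairMonoid V}, SquareFree G m → ∀ {k : ℕ}, L.length < k →
      (coeff k (magnus G (wordProd G L) : (PairAlgebra V)⟦X⟧)).coeff m = 0 := by
  induction L with
  | nil =>
    intro m _ k hk
    simp [coeff_one, (Nat.pos_iff_ne_zero.1 hk)]
  | cons p L ih =>
    intro m hm k hk
    obtain ⟨k, rfl⟩ := Nat.exists_eq_add_one_of_ne_zero (Nat.ne_zero_of_lt hk)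
    rw [List.length_cons, add_lt_add_iff_right] at hk
    obtain ⟨S, hS⟩ := exists_magnus_cons G p L
    rw [hS, map_add, map_add, map_zsmul, coeff_succ_X_mul, coeff_C_mul]
    simp only [MonoidAlgebra.coeff_add, MonoidAlgebra.coeff_smul, Finsupp.add_apply,
      Finsupp.smul_apply]
    rw [ih hm (by omega), coeff_coeff_X_mul_X_mul hm, PairAlgebra.gen]
    by_cases h : ∃ d, PairMonoid.gen G p.1 * d = m
    · obtain ⟨d, rfl⟩ := h
      rw [MonoidAlgebra.coeff_single_mul_mul, ih hm.of_gen_mul hk]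
      simp
    · rw [MonoidAlgebra.coeff_single_mul_of_forall_mul_ne _ _ (by simpa using h)]
      simp

theorem coeff_length_coeff_magnus_wordProd {G : SimpleGraph V} (L : List (V × ℤ))
    (hL : SquareFree G (ofWord G (L.map Prod.fst))) :
    (coeff L.length (magnus G (wordProd G L) : (PairAlgebra V)⟦X⟧)).coeff
      (ofWord G (L.map Prod.fst)) = (L.map fun p => (p.2 : ℚ)).prod := by
  induction L with
  | nil => simp [ofWord]
  | cons p L ih =>
    obtain ⟨S, hS⟩ := exists_magnus_cons G p L
    rw [hS, map_add, map_add, map_zsmul, List.length_cons, coeff_succ_X_mul, coeff_C_mul]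
    simp only [MonoidAlgebra.coeff_add, MonoidAlgebra.coeff_smul, Finsupp.add_apply,
      Finsupp.smul_apply]
    rw [coeff_coeff_magnus_wordProd_of_lt L hL (by omega), coeff_coeff_X_mul_X_mul hL,
      PairAlgebra.gen, List.map_cons, ofWord_cons, MonoidAlgebra.coeff_single_mul_mul,
      ih (by rw [List.map_cons, ofWord_cons] at hL; exact hL.of_gen_mul)]
    simp

theorem magnus_injective (G : SimpleGraph V) : Function.Injective (magnus G) := by
  rw [injective_iff_map_eq_one]
  intro g hg
  obtain ⟨L, rfl, hred, hne⟩ := exists_isReducedWord G g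
  have h := coeff_length_coeff_magnus_wordProd L (squareFree_ofWord hred)
  rw [hg, Units.val_one, coeff_one] at h
  cases L with
  | nil => rfl
  | cons p L =>
    rw [if_neg (by simp)] at h
    have h0 : ((p :: L).map fun q => (q.2 : ℚ)).prod ≠ 0 := by
      rw [Ne, List.prod_eq_zero_iff, List.mem_map]
      rintro ⟨q, hq, h0⟩
      exact hne q hq (by exact_mod_cast h0)
    exact absurd h.symm h0

/-- The exponent sum of the generator `v`. -/
noncomputable def expHom (G : SimpleGraph V) (v : V) : RAAG G →* Multiplicative ℤ :=
  open Classical in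
  lift (fun w => Multiplicative.ofAdd (if w = v then 1 else 0)) fun _ _ _ => Commute.all _ _

open Classical in
theorem expHom_of (G : SimpleGraph V) (v w : V) :
    (expHom G v (of G w)).toAdd = if w = v then 1 else 0 := by
  simp [expHom]

theorem coeff_zero_magnus (G : SimpleGraph V) (g : RAAG G) :
    coeff 0 (magnus G g : (PairAlgebra V)⟦X⟧) = 1 := by
  have h : (Units.map (constantCoeff (R := PairAlgebra V) : _ →* PairAlgebra V)).comp (magnus G)
      = 1 := hom_ext fun v => by
    ext1
    simp [val_oneAddUnit]
  simpa using congrArg Units.val (DFunLike.congr_fun h g)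

theorem coeff_one_magnus [Fintype V] (G : SimpleGraph V) (g : RAAG G) :
    coeff 1 (magnus G g : (PairAlgebra V)⟦X⟧) =
      PairAlgebra.linearForm G (fun v => ((expHom G v g).toAdd : ℚ)) Finset.univ := by
  obtain ⟨L, rfl⟩ := exists_wordProd_eq G g
  induction L with
  | nil => simp [PairAlgebra.linearForm, coeff_one]
  | cons p L ih =>
    obtain ⟨S, hS⟩ := exists_magnus_cons G p L
    rw [hS, map_add, map_add, map_zsmul, ih]
    have h0 := coeff_zero_magnus G (wordProd G L)
    classical
    rw [← zero_add 1, coeff_succ_X_mul, coeff_succ_X_mul, coeff_C_mul, coeff_C_mul,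
      coeff_zero_X_mul, mul_zero, add_zero, h0, mul_one]
    simp [PairAlgebra.linearForm, expHom_of, add_smul, Finset.sum_add_distrib]
    rw [add_comm, Int.cast_smul_eq_zsmul, zsmul_eq_mul]

theorem coeff_magnus_mem_letters (G : SimpleGraph V) (g : RAAG G) (n : ℕ) :
    coeff n (magnus G g : (PairAlgebra V)⟦X⟧) ∈ PairAlgebra.letters G Set.univ := by
  have hg : g ∈ Subgroup.closure (Set.range (of G)) := closure_range_of G ▸ Subgroup.mem_top g
  have hgen := fun v => PairAlgebra.gen_mem_letters G (Set.mem_univ v)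
  induction hg using Subgroup.closure_induction'' generalizing n with
  | mem x hx =>
    obtain ⟨v, rfl⟩ := hx
    rw [magnus_of, val_oneAddUnit, map_add, coeff_one]
    refine add_mem (by split_ifs; exacts [one_mem _, zero_mem _]) ?_
    cases n with
    | zero => simp
    | succ n =>
      rw [coeff_succ_X_mul, coeff_C]
      split_ifs
      exacts [hgen v, zero_mem _]
  | inv_mem x hx =>
    obtain ⟨v, rfl⟩ := hx
    rw [map_inv, magnus_of]
    change coeff n (mk fun n => (-PairAlgebra.gen G v) ^ n) ∈ _
    rw [coeff_mk]
    exact pow_mem (neg_mem (hgen v)) n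
  | one =>
    rw [map_one, Units.val_one, coeff_one]
    split_ifs
    exacts [one_mem _, zero_mem _]
  | mul x y _ _ hx hy =>
    rw [map_mul, Units.val_mul, coeff_mul]
    exact sum_mem fun i _ => mul_mem (hx _) (hy _)

theorem map_toPolynomial_magnus [Fintype V] (G : SimpleGraph V) (u : V) {h : RAAG G}
    (hu : expHom G u h = 1) :
    map (PairAlgebra.toPolynomial u).toRingHom (magnus G h : (PairAlgebra V)⟦X⟧) = 1 := by
  classical
  have hgen : ∀ v, (PairAlgebra.toPolynomial u).toRingHom (PairAlgebra.gen G v) =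
      if v = u then Polynomial.X else 0 := fun v => PairAlgebra.weight_gen _ G v
  have key : (Units.map (map (PairAlgebra.toPolynomial u).toRingHom :
      (PairAlgebra V)⟦X⟧ →* (Polynomial ℚ)⟦X⟧)).comp (magnus G) =
      (zpowersHom (Polynomial ℚ)⟦X⟧ˣ (oneAddUnit Polynomial.X)).comp (expHom G u) := hom_ext fun v => by
    rw [MonoidHom.comp_apply, magnus_of, map_oneAddUnit, MonoidHom.comp_apply, zpowersHom_apply,
      expHom_of, hgen]
    by_cases hv : v = u
    · rw [if_pos hv, if_pos hv, zpow_one]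
    · rw [if_neg hv, if_neg hv, zpow_zero]
      ext1
      simp [val_oneAddUnit]
  have h1 := DFunLike.congr_fun key h
  rw [MonoidHom.comp_apply, MonoidHom.comp_apply, hu, map_one] at h1
  exact congrArg Units.val h1

end RAAG

namespace PowerSeries

theorem commute_coeff_of_commute {R : Type*} [Ring R] {D F : R⟦X⟧} (h : Commute D F)
    (hF : coeff 0 F = 1) {k : ℕ} (hD : ∀ j < k, coeff j D = 0) :
    Commute (coeff k D) (coeff 1 F) := by
  obtain ⟨K, rfl⟩ := X_pow_dvd_iff.2 hD
  have h1 := congrArg (coeff (k + 1)) h.eq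
  rw [← mul_assoc F, ((commute_X F).pow_right k).eq, mul_assoc, mul_assoc, add_comm k 1,
    coeff_X_pow_mul, coeff_X_pow_mul, coeff_mul, coeff_mul] at h1
  simp only [Finset.Nat.antidiagonal_succ, Finset.Nat.antidiagonal_zero, Finset.map_singleton,
    Finset.sum_cons, Finset.sum_singleton, hF] at h1
  have hk : coeff k (X ^ k * K) = coeff 0 K := by simpa using coeff_X_pow_mul K k 0
  rw [hk, commute_iff_eq]
  simpa [hF, add_comm] using h1

end PowerSeries

namespace RAAG

open PowerSeries

variable {V : Type*} [Fintype V] {G : SimpleGraph V}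

/-- If the exponent sums of `g` are all nonzero, then a nontrivial element of the centralizer of
`g` has nonzero exponent sums. -/
theorem eq_one_of_commute (hG : ¬ G.IsJoin) {g h : RAAG G}
    (hg : ∀ v, expHom G v g ≠ 1) (hc : Commute h g) {u : V} (hu : expHom G u h = 1) : h = 1 := by
  refine magnus_injective G (Units.ext (PowerSeries.ext fun n => ?_))
  rw [map_one, Units.val_one]
  induction n using Nat.strong_induction_on with
  | h n ih =>
    rcases Nat.eq_zero_or_pos n with rfl | hn
    · rw [coeff_zero_magnus, coeff_zero_one]
    have ha : ∀ v, ((expHom G v g).toAdd : ℚ) ≠ 0 := fun v => by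
      rw [Int.cast_ne_zero]
      exact fun h0 => hg v (Multiplicative.toAdd.injective h0)
    have hc' : Commute (((magnus G h).val : (PairAlgebra V)⟦X⟧) - 1) (magnus G g).val :=
      Commute.sub_left (congrArg Units.val (hc.map (magnus G)).eq) (Commute.one_left _)
    have h1 := commute_coeff_of_commute hc' (coeff_zero_magnus G g) (k := n) fun j hj => by
      rw [map_sub, ih j hj, sub_self]
    have hn1 : coeff n (1 : (PairAlgebra V)⟦X⟧) = 0 := by rw [coeff_one, if_neg hn.ne']
    rw [map_sub, hn1, sub_zero, coeff_one_magnus] at h1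
    obtain ⟨p, hp⟩ := PairAlgebra.exists_aeval_of_commute G ha (SimpleGraph.coConnected_univ hG) _
      (by rw [Finset.coe_univ]; exact coeff_magnus_mem_letters G h n) h1
    have h2 := congrArg (coeff n) (map_toPolynomial_magnus G u hu)
    rw [coeff_map, coeff_one, if_neg hn.ne', hp] at h2
    replace h2 := (PairAlgebra.toPolynomial_aeval G _ (Finset.mem_univ u) p).symm.trans h2
    rw [Polynomial.comp_C_mul_X_eq_zero_iff] at h2
    · rw [hn1, hp, h2, map_zero]
    · exact mem_nonZeroDivisors_of_ne_zero (ha u)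

end RAAG

theorem Multiplicative.pow_right_injective_of_ne_one {z : Multiplicative ℤ} (hz : z ≠ 1) :
    Function.Injective fun n : ℕ => z ^ n := by
  intro m n h
  have h1 := congrArg Multiplicative.toAdd h
  simp only [toAdd_pow, nsmul_eq_mul] at h1
  have h2 : z.toAdd ≠ 0 := fun h0 => hz (Multiplicative.toAdd.injective h0)
  exact_mod_cast mul_right_cancel₀ h2 h1

theorem nonempty_mulEquiv_of_injective {K : Type*} [Group K] {f : K →* Multiplicative ℤ}
    (hf : Function.Injective f) {x : K} (hx : x ≠ 1) :
    Nonempty (K ≃* Multiplicative (Fin 1 → ℤ)) := by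
  have hx' : f x ≠ 1 := fun h => hx (hf (by rw [h, map_one]))
  have hcyc : IsCyclic K := isCyclic_of_injective f hf
  have hinf : Infinite K := Infinite.of_injective (fun n : ℕ => x ^ n) fun m n h =>
    Multiplicative.pow_right_injective_of_ne_one hx' (by
      simpa using congrArg f h)
  have e : K ≃* Multiplicative ℤ := mulEquivOfCyclicCardEq (by simp)
  exact ⟨e.trans (AddEquiv.funUnique (Fin 1) ℤ).symm.toMultiplicative⟩

theorem mem_algA_one {K : Type*} [Group K] {x : K} (f : K →* Multiplicative ℤ) (hx : f x ≠ 1)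
    (h : ∀ y, Commute y x → f y = 1 → y = 1) : x ∈ algA K 1 := by
  refine ⟨⊤, inferInstance, 1, le_rfl, ?_⟩
  have hinj : Function.Injective ((f.comp (Subgroup.centralizer {x}).subtype).comp
      (⊤ : Subgroup (Subgroup.centralizer {x})).subtype) := by
    rw [injective_iff_map_eq_one]
    rintro ⟨⟨y, hy⟩, _⟩ hfy
    ext
    exact h y (Subgroup.mem_centralizer_singleton_iff.1 hy) hfy
  refine nonempty_mulEquiv_of_injective hinj
    (x := ⟨⟨x, Subgroup.mem_centralizer_singleton_iff.2 rfl⟩, Subgroup.mem_top _⟩) fun h1 => hx ?_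
  have h2 : x = 1 := congrArg
    (fun z : (⊤ : Subgroup (Subgroup.centralizer {x})) => ((z : Subgroup.centralizer {x}) : K)) h1
  rw [h2, map_one]

theorem map_eq_one_of_mem_algA_zero {K : Type*} [Group K] (f : K →* Multiplicative ℤ) {x : K}
    (hx : x ∈ algA K 0) : f x = 1 := by
  obtain ⟨H, hH, n, hn, ⟨e⟩⟩ := hx
  obtain rfl : n = 0 := by omega
  obtain ⟨k, hk, -, hmem⟩ := H.exists_pow_mem_of_index_ne_zero hH.index_ne_zero
    ⟨x, Subgroup.mem_centralizer_singleton_iff.2 rfl⟩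
  have hsub : Subsingleton H := e.toEquiv.subsingleton
  have h1 := congrArg (fun z : H => ((z : Subgroup.centralizer {x}) : K))
    (Subsingleton.elim (⟨_, hmem⟩ : H) 1)
  have h2 : x ^ k = 1 := h1
  by_contra hne
  have := Multiplicative.pow_right_injective_of_ne_one hne (a₁ := k) (a₂ := 0)
    (by simp only [← map_pow, h2, map_one, pow_zero])
  omega

theorem not_algCovers_zero {K : Type*} [Group K] (f : K →* Multiplicative ℤ) {t : K}
    (ht : f t ≠ 1) : ¬ algCovers K 0 := by
  classical
  rintro ⟨F, hF⟩
  refine Set.infinite_of_injective_forall_mem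
    (Multiplicative.pow_right_injective_of_ne_one ht) (s := (F.image f : Set (Multiplicative ℤ)))
    (fun n => ?_) (Finset.finite_toSet _)
  have h : t ^ n ∈ ⋃ g ∈ F, g • algA K 0 := hF ▸ Set.mem_univ _
  simp only [Set.mem_iUnion, Set.mem_smul_set] at h
  obtain ⟨g, hg, a, ha, h⟩ := h
  simp only [← map_pow, ← h, smul_eq_mul, map_mul, map_eq_one_of_mem_algA_zero f ha, mul_one]
  exact Finset.mem_coe.2 (Finset.mem_image_of_mem f hg)

theorem algCovers_one {K V : Type*} [Group K] [Fintype V] (f : V → K →* Multiplicative ℤ) {t : K}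
    {N : ℕ} (hN : 0 < N) (ht : ∀ v, (f v t).toAdd = N)
    (h : ∀ x, (∀ v, f v x ≠ 1) → x ∈ algA K 1) : algCovers K 1 := by
  classical
  refine ⟨(Finset.range (Fintype.card V + 1)).image fun j => t ^ j,
    Set.eq_univ_of_forall fun x => ?_⟩
  obtain ⟨j, hj, hjx⟩ := Finset.exists_mem_notMem_of_card_lt_card
    (s := Finset.univ.image fun v => ((f v x).toAdd / N).toNat)
    (t := Finset.range (Fintype.card V + 1))
    (by rw [Finset.card_range]; exact Nat.lt_succ_of_le Finset.card_image_le)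
  simp only [Set.mem_iUnion]
  refine ⟨t ^ j, Finset.mem_image_of_mem _ hj, Set.mem_smul_set_iff_inv_smul_mem.2 (h _ ?_)⟩
  intro v hv
  refine hjx (Finset.mem_image.2 ⟨v, Finset.mem_univ v, ?_⟩)
  rw [smul_eq_mul, map_mul, map_inv, inv_mul_eq_one, map_pow] at hv
  rw [← hv, toAdd_pow, ht, nsmul_eq_mul, Int.mul_ediv_cancel _ (by omega), Int.toNat_natCast]

theorem RAAG.exists_expHom_eq_one {V : Type*} [Fintype V] (G : SimpleGraph V) :
    ∃ w : RAAG G, ∀ v, (expHom G v w).toAdd = 1 := by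
  classical
  suffices ∀ S : Finset V, ∃ w : RAAG G, ∀ v, (expHom G v w).toAdd = if v ∈ S then 1 else 0 by
    simpa using this Finset.univ
  intro S
  induction S using Finset.induction_on with
  | empty => exact ⟨1, by simp⟩
  | insert a S ha ih =>
    obtain ⟨w, hw⟩ := ih
    refine ⟨of G a * w, fun v => ?_⟩
    rw [map_mul, toAdd_mul, hw, expHom_of]
    by_cases hv : a = v
    · subst hv; simp [ha]
    · simp [hv, Ne.symm hv]

/-- If a finite simple graph `Γ` with at least one vertex is not a join, then the
right-angled Artin group `A_Γ` has algebraic rank `1`. -/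
theorem stmt_17 {V : Type*} [Fintype V] [Nonempty V] (G : SimpleGraph V)
    (h : ¬ G.IsJoin) : algRank (RAAG G) = 1 := by
  obtain ⟨w, hw⟩ := RAAG.exists_expHom_eq_one G
  obtain ⟨u⟩ := ‹Nonempty V›
  refine le_antisymm (iSup₂_le fun H hH => sInf_le ⟨1, rfl, ?_⟩) ?_
  · obtain ⟨N, hN, -, hmem⟩ := H.exists_pow_mem_of_index_ne_zero hH.index_ne_zero w
    refine algCovers_one (fun v => (RAAG.expHom G v).comp H.subtype) (t := ⟨w ^ N, hmem⟩) hN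
      (fun v => by simp [hw]) fun x hx => mem_algA_one _ (hx u) fun y hy hyu => ?_
    exact Subtype.ext (RAAG.eq_one_of_commute h hx (congrArg Subtype.val hy.eq) hyu)
  · refine le_iSup₂_of_le ⊤ inferInstance (le_sInf ?_)
    rintro _ ⟨i, rfl, hi⟩
    rcases Nat.eq_zero_or_pos i with rfl | hpos
    · refine absurd hi (not_algCovers_zero ((RAAG.expHom G u).comp (Subgroup.subtype ⊤))
        (t := ⟨w, Subgroup.mem_top w⟩) fun h1 => ?_)
      have h2 := hw u
      rw [show RAAG.expHom G u w = 1 from h1] at h2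
      exact zero_ne_one h2
    · exact_mod_cast hpos
end
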